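/- Let d ≥ 1, let 1 < p, q < ∞ with conjugate exponent p' (1/p' = 1 − 1/p), and let s, k₁, k₂ ∈ ℝ with k := k₁ + k₂. Assume s > k − d·min(1/p, 1/p') and p ≤ 2q. Then there exists a constant C > 0, independent of τ, such that for every τ ≥ 0 and all Schwartz functions A, B on ℝ^d, setting a := e^{−τΛ₁}A and b := e^{−τΛ₁}B, one has ‖e^{τΛ₁}(R(a,b))‖_{Ḃ^{s−k+d/q−d/p}_{q,∞}} ≤ C·‖A‖_{Ḃ^{d/p−k₁}_{p,∞}}·‖B‖_{Ḃ^{s−k₂}_{p,∞}}. -/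

import Mathlib

open MeasureTheory SchwartzMap Real
open scoped FourierTransform ENNReal NNReal

noncomputable section

abbrev Rd (d : ℕ) := EuclideanSpace ℝ (Fin d)

/-- Homogeneous Littlewood–Paley block Δ_j f = 𝓕⁻¹(φ(2^{-j}·)·𝓕 f). -/
def LPblock (d : ℕ) (φ : Rd d → ℝ) (j : ℤ) (f : Rd d → ℂ) : Rd d → ℂ :=
  𝓕⁻ fun ξ => (φ (((2:ℝ) ^ (-j)) • ξ) : ℂ) * 𝓕 f ξ

/-- ℓ^r norm (over ℤ) of a sequence of extended nonnegative reals. -/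
def seqNorm (r : ℝ≥0∞) (u : ℤ → ℝ≥0∞) : ℝ≥0∞ :=
  if r = ∞ then ⨆ j, u j else (∑' j, u j ^ r.toReal) ^ (1 / r.toReal)

/-- Homogeneous Besov norm ‖f‖_{Ḃ^s_{p,r}}. -/
def besovNorm (d : ℕ) (φ : Rd d → ℝ) (s : ℝ) (p r : ℝ≥0∞) (f : Rd d → ℂ) : ℝ≥0∞ :=
  seqNorm r fun j =>
    ENNReal.ofReal ((2:ℝ) ^ ((j : ℝ) * s)) * eLpNorm (LPblock d φ j f) p volume

/-- Low-frequency cut-off Ṡ_{j-1} f = ∑_{k ≤ j-2} Δ_k f. -/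
def lowFreq (d : ℕ) (φ : Rd d → ℝ) (j : ℤ) (f : Rd d → ℂ) : Rd d → ℂ :=
  fun x => ∑' k : ℤ, if k ≤ j - 2 then LPblock d φ k f x else 0

/-- Bony paraproduct T_a b = ∑_j Ṡ_{j-1}a · Δ_j b. -/
def para (d : ℕ) (φ : Rd d → ℝ) (a b : Rd d → ℂ) : Rd d → ℂ :=
  fun x => ∑' j : ℤ, lowFreq d φ j a x * LPblock d φ j b x

/-- Bony remainder R(a,b) = ∑_j (Δ_{j-1}a + Δ_j a + Δ_{j+1}a)·Δ_j b. -/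
def remainder (d : ℕ) (φ : Rd d → ℝ) (a b : Rd d → ℂ) : Rd d → ℂ :=
  fun x => ∑' j : ℤ,
    (LPblock d φ (j-1) a x + LPblock d φ j a x + LPblock d φ (j+1) a x) * LPblock d φ j b x

/-- Gevrey multiplier e^{τΛ₁} with symbol e^{τ|ξ|₁}, |ξ|₁ = ∑ᵢ|ξᵢ|. -/
def expL1 (d : ℕ) (τ : ℝ) (f : Rd d → ℂ) : Rd d → ℂ :=
  𝓕⁻ fun ξ => (Real.exp (τ * ∑ i, |ξ i|) : ℂ) * 𝓕 f ξ

section Plancherel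

variable {E : Type*} [NormedAddCommGroup E] [InnerProductSpace ℝ E] [FiniteDimensional ℝ E]
  [MeasurableSpace E] [BorelSpace E]

theorem continuous_fourier_of_integrable {u : E → ℂ} (hu : Integrable u) : Continuous (𝓕 u) :=
  VectorFourier.fourierIntegral_continuous Real.continuous_fourierChar
    (by simpa using (continuous_inner (𝕜 := ℝ) (E := E))) hu

theorem continuous_fourierInv_of_integrable {u : E → ℂ} (hu : Integrable u) :
    Continuous (𝓕⁻ u) := by
  have h : 𝓕⁻ u = fun x => 𝓕 u (-x) := funext (Real.fourierInv_eq_fourier_neg u)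
  rw [h]
  exact (continuous_fourier_of_integrable hu).comp continuous_neg

theorem norm_fourierInv_le (u : E → ℂ) (x : E) : ‖𝓕⁻ u x‖ ≤ ∫ ξ, ‖u ξ‖ := by
  rw [Real.fourierInv_eq]
  refine (norm_integral_le_integral_norm _).trans_eq ?_
  simp

theorem integral_fourierInv_mul_eq_of_integrable {f g : E → ℂ} (hf : Integrable f)
    (hg : Integrable g) : ∫ x, 𝓕⁻ f x * g x = ∫ x, f x * 𝓕⁻ g x := by
  have h := VectorFourier.integral_fourierIntegral_smul_eq_flip (L := -innerₗ E)
    Real.continuous_fourierChar (by simpa using (continuous_inner (𝕜 := ℝ) (E := E)).fun_neg) hf hg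
  have hflip : (-innerₗ E).flip = -innerₗ E := by
    ext x y; simp [real_inner_comm]
  rw [hflip] at h
  simpa [FourierTransformInv.fourierInv] using h

/-- **Plancherel's theorem** for the inverse Fourier integral on `L¹ ∩ L²`. -/
theorem eLpNorm_two_fourierInv {u : E → ℂ} (hu : Integrable u) (hu2 : MemLp u 2) :
    eLpNorm (𝓕⁻ u) 2 volume = eLpNorm u 2 volume := by
  set U : Lp ℂ 2 (volume : Measure E) := hu2.toLp u with hU
  have hae : 𝓕⁻ u =ᵐ[volume] ((𝓕⁻ U : Lp ℂ 2 (volume : Measure E)) : E → ℂ) := by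
    refine ae_eq_of_integral_contDiff_smul_eq
      (continuous_fourierInv_of_integrable hu).locallyIntegrable
      ((Lp.memLp (𝓕⁻ U : Lp ℂ 2 (volume : Measure E))).locallyIntegrable (by norm_num)) ?_
    intro g hg hgs
    have hg' : ContDiff ℝ (⊤ : ℕ∞) (fun x => (g x : ℂ)) := Complex.ofRealCLM.contDiff.comp hg
    have hgs' : HasCompactSupport (fun x => (g x : ℂ)) := hgs.comp_left Complex.ofReal_zero
    set ψ : 𝓢(E, ℂ) := hgs'.toSchwartzMap hg' with hψ
    have hψv : ∀ x, ψ x = (g x : ℂ) := fun x => rfl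
    have h1 := congrArg (fun T => T ψ) (MeasureTheory.Lp.fourierInv_toTemperedDistribution_eq U)
    simp only [TemperedDistribution.fourierInv_apply, Lp.toTemperedDistribution_apply] at h1
    have h2 := integral_fourierInv_mul_eq_of_integrable hu ψ.integrable
    calc ∫ x, g x • 𝓕⁻ u x = ∫ x, 𝓕⁻ u x * ψ x := by
          refine integral_congr_ae (Filter.Eventually.of_forall fun x => ?_)
          simp only [hψv, Complex.real_smul]; ring
      _ = ∫ x, u x * 𝓕⁻ (ψ : E → ℂ) x := h2
      _ = ∫ x, (𝓕⁻ ψ) x • (U : E → ℂ) x := by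
          refine integral_congr_ae ?_
          filter_upwards [hu2.coeFn_toLp] with x hx
          rw [hU, hx, ← SchwartzMap.fourierInv_coe, smul_eq_mul, mul_comm]
      _ = ∫ x, ψ x • ((𝓕⁻ U : Lp ℂ 2 (volume : Measure E)) : E → ℂ) x := h1
      _ = _ := by
          refine integral_congr_ae (Filter.Eventually.of_forall fun x => ?_)
          simp only [hψv, Complex.real_smul, smul_eq_mul]
  rw [eLpNorm_congr_ae hae]
  have hn : ‖(𝓕⁻ U : Lp ℂ 2 (volume : Measure E))‖ = ‖U‖ :=
    (Lp.fourierTransformₗᵢ E ℂ).symm.norm_map U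
  have : ‖(𝓕⁻ U : Lp ℂ 2 (volume : Measure E))‖ₑ = ‖U‖ₑ := by
    rw [← ofReal_norm, ← ofReal_norm, hn]
  rw [Lp.enorm_def, Lp.enorm_def] at this
  rw [this, hU, eLpNorm_congr_ae hu2.coeFn_toLp]

end Plancherel

/-- Bounded measurable functions with bounded support, used as Fourier-side data. -/
structure BddSpectrum {E : Type*} [NormedAddCommGroup E] [MeasureSpace E]
    (u : E → ℂ) : Prop where
  meas : AEStronglyMeasurable u volume
  bdd : ∃ M : ℝ, ∀ ξ, ‖u ξ‖ ≤ M
  supp : ∃ R : ℝ, ∀ ξ, R < ‖ξ‖ → u ξ = 0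

namespace BddSpectrum

variable {E : Type*} [NormedAddCommGroup E] [InnerProductSpace ℝ E] [FiniteDimensional ℝ E]
  [MeasurableSpace E] [BorelSpace E] {u v : E → ℂ}

theorem memLp (hu : BddSpectrum u) (p : ℝ≥0∞) : MemLp u p volume := by
  obtain ⟨M, hM⟩ := hu.bdd
  obtain ⟨R, hR⟩ := hu.supp
  have hb : MemLp u p (volume.restrict (Metric.closedBall (0 : E) R)) := by
    have : IsFiniteMeasure (volume.restrict (Metric.closedBall (0 : E) R)) :=
      ⟨by simpa using measure_closedBall_lt_top⟩
    exact MemLp.of_bound hu.meas.restrict M (Filter.Eventually.of_forall hM)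
  rw [← memLp_indicator_iff_restrict Metric.isClosed_closedBall.measurableSet] at hb
  convert hb using 1
  ext ξ
  by_cases h : ξ ∈ Metric.closedBall (0 : E) R
  · simp [h]
  · rw [Set.indicator_of_notMem h]
    exact hR ξ (by simpa using h)

theorem integrable (hu : BddSpectrum u) : Integrable u := memLp_one_iff_integrable.1 (hu.memLp 1)

theorem mul_of_continuous (hu : BddSpectrum u) {c : E → ℂ} (hc : Continuous c) :
    BddSpectrum (fun ξ => c ξ * u ξ) := by
  obtain ⟨M, hM⟩ := hu.bdd
  obtain ⟨R, hR⟩ := hu.supp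
  refine ⟨hc.aestronglyMeasurable.mul hu.meas, ?_, R, fun ξ h => by simp [hR ξ h]⟩
  obtain ⟨K, hK⟩ := (isCompact_closedBall (0 : E) R).exists_bound_of_continuousOn hc.continuousOn
  refine ⟨|K| * |M|, fun ξ => ?_⟩
  by_cases h : ξ ∈ Metric.closedBall (0 : E) R
  · rw [norm_mul]
    exact mul_le_mul ((hK ξ h).trans (le_abs_self _)) ((hM ξ).trans (le_abs_self _))
      (norm_nonneg _) (abs_nonneg _)
  · rw [hR ξ (by simpa using h)]
    simp only [mul_zero, norm_zero]; positivity

theorem indicator (hu : BddSpectrum u) {s : Set E} (hs : MeasurableSet s) :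
    BddSpectrum (s.indicator u) := by
  obtain ⟨M, hM⟩ := hu.bdd
  obtain ⟨R, hR⟩ := hu.supp
  refine ⟨hu.meas.indicator hs, ⟨M, fun ξ => (norm_indicator_le_norm_self u ξ).trans (hM ξ)⟩,
    R, fun ξ h => ?_⟩
  simp [Set.indicator, hR ξ h]

theorem add (hu : BddSpectrum u) (hv : BddSpectrum v) : BddSpectrum (fun ξ => u ξ + v ξ) := by
  obtain ⟨M, hM⟩ := hu.bdd
  obtain ⟨R, hR⟩ := hu.supp
  obtain ⟨M', hM'⟩ := hv.bdd
  obtain ⟨R', hR'⟩ := hv.supp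
  refine ⟨hu.meas.add hv.meas, ⟨M + M', fun ξ => (norm_add_le _ _).trans
    (add_le_add (hM ξ) (hM' ξ))⟩, max R R', fun ξ h => ?_⟩
  rw [hR ξ ((le_max_left _ _).trans_lt h), hR' ξ ((le_max_right _ _).trans_lt h), add_zero]

theorem const_mul (hu : BddSpectrum u) (c : ℂ) : BddSpectrum (fun ξ => c * u ξ) :=
  hu.mul_of_continuous continuous_const

theorem comp_add (hu : BddSpectrum u) (w : E) : BddSpectrum (fun ξ => u (ξ + w)) := by
  obtain ⟨M, hM⟩ := hu.bdd
  obtain ⟨R, hR⟩ := hu.supp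
  refine ⟨hu.meas.comp_measurePreserving (measurePreserving_add_right volume w),
    ⟨M, fun ξ => hM _⟩, R + ‖w‖, fun ξ h => hR _ ?_⟩
  have := norm_sub_le (ξ + w) w
  rw [add_sub_cancel_right] at this
  linarith

theorem conj_neg (hu : BddSpectrum u) : BddSpectrum (fun ξ => starRingEnd ℂ (u (-ξ))) := by
  obtain ⟨M, hM⟩ := hu.bdd
  obtain ⟨R, hR⟩ := hu.supp
  refine ⟨?_, ⟨M, fun ξ => by simpa using hM _⟩, R, fun ξ h => by rw [hR _ (by simpa)]; simp⟩
  exact Complex.continuous_conj.comp_aestronglyMeasurable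
    (hu.meas.comp_measurePreserving (Measure.measurePreserving_neg volume))

theorem continuous_fourierInv (hu : BddSpectrum u) : Continuous (𝓕⁻ u) :=
  continuous_fourierInv_of_integrable hu.integrable

theorem memLp_two_fourierInv (hu : BddSpectrum u) : MemLp (𝓕⁻ u) 2 volume :=
  ⟨hu.continuous_fourierInv.aestronglyMeasurable, by
    rw [eLpNorm_two_fourierInv hu.integrable (hu.memLp 2)]; exact (hu.memLp 2).2⟩

theorem integrable_norm_sq_fourierInv (hu : BddSpectrum u) :
    Integrable (fun x => ‖𝓕⁻ u x‖ ^ 2) :=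
  hu.memLp_two_fourierInv.integrable_norm_pow (by norm_num)

theorem integral_norm_sq_fourierInv (hu : BddSpectrum u) :
    ∫ x, ‖𝓕⁻ u x‖ ^ 2 = ∫ ξ, ‖u ξ‖ ^ 2 := by
  have h := eLpNorm_two_fourierInv hu.integrable (hu.memLp 2)
  rw [hu.memLp_two_fourierInv.eLpNorm_eq_integral_rpow_norm (by norm_num) (by norm_num),
    (hu.memLp 2).eLpNorm_eq_integral_rpow_norm (by norm_num) (by norm_num)] at h
  rw [ENNReal.ofReal_eq_ofReal_iff (by positivity) (by positivity)] at h
  have h2 := (Real.rpow_left_inj (integral_nonneg fun _ => by positivity)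
    (integral_nonneg fun _ => by positivity) (by norm_num)).1 h
  simpa using h2

end BddSpectrum

section RieszFunction

/-- The regularised Riesz function `λ Nᵐ (Re z)² - Nᵐ⁺¹ + δᵐ⁺¹` with `N = |z|² + δ` and
`λ = 2(m+1)²`; it is smooth and subharmonic, and vanishes at the origin. -/
def rieszFun (m δ : ℝ) (z : ℂ) : ℝ :=
  2 * (m + 1) ^ 2 * (z.re ^ 2 + z.im ^ 2 + δ) ^ m * z.re ^ 2
    - (z.re ^ 2 + z.im ^ 2 + δ) ^ (m + 1) + δ ^ (m + 1)

/-- First derivative of `rieszFun m δ` at `z` along a curve with velocity `z₁`. -/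
def rieszFunDeriv (m δ : ℝ) (z z₁ : ℂ) : ℝ :=
  2 * (z.re * z₁.re + z.im * z₁.im) *
      (2 * (m + 1) ^ 2 * m * (z.re ^ 2 + z.im ^ 2 + δ) ^ (m - 1) * z.re ^ 2
        - (m + 1) * (z.re ^ 2 + z.im ^ 2 + δ) ^ m)
    + 4 * (m + 1) ^ 2 * (z.re ^ 2 + z.im ^ 2 + δ) ^ m * (z.re * z₁.re)

/-- Second derivative of `rieszFun m δ` at `z` along a curve with velocity `z₁` and
acceleration `z₂`. -/
def rieszFunDeriv₂ (m δ : ℝ) (z z₁ z₂ : ℂ) : ℝ :=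
  2 * (z₁.re ^ 2 + z₁.im ^ 2 + z.re * z₂.re + z.im * z₂.im) *
      (2 * (m + 1) ^ 2 * m * (z.re ^ 2 + z.im ^ 2 + δ) ^ (m - 1) * z.re ^ 2
        - (m + 1) * (z.re ^ 2 + z.im ^ 2 + δ) ^ m)
    + 2 * (z.re * z₁.re + z.im * z₁.im) *
      (2 * (m + 1) ^ 2 * m * ((m - 1) * (z.re ^ 2 + z.im ^ 2 + δ) ^ (m - 2)
            * (2 * (z.re * z₁.re + z.im * z₁.im)) * z.re ^ 2
          + 2 * (z.re ^ 2 + z.im ^ 2 + δ) ^ (m - 1) * (z.re * z₁.re))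
        - (m + 1) * (m * (z.re ^ 2 + z.im ^ 2 + δ) ^ (m - 1)
            * (2 * (z.re * z₁.re + z.im * z₁.im))))
    + 4 * (m + 1) ^ 2 * ((z.re ^ 2 + z.im ^ 2 + δ) ^ m * (z₁.re ^ 2 + z.re * z₂.re)
        + m * (z.re ^ 2 + z.im ^ 2 + δ) ^ (m - 1)
          * (2 * (z.re * z₁.re + z.im * z₁.im)) * (z.re * z₁.re))

theorem hasDerivAt_re_of {f : ℝ → ℂ} {f' : ℂ} {t : ℝ} (h : HasDerivAt f f' t) :
    HasDerivAt (fun s => (f s).re) f'.re t := by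
  exact (Complex.reCLM.hasFDerivAt (x := f t)).comp_hasDerivAt t h

theorem hasDerivAt_im_of {f : ℝ → ℂ} {f' : ℂ} {t : ℝ} (h : HasDerivAt f f' t) :
    HasDerivAt (fun s => (f s).im) f'.im t := by
  exact (Complex.imCLM.hasFDerivAt (x := f t)).comp_hasDerivAt t h

theorem hasDerivAt_normSq_add_rpow {f : ℝ → ℂ} {f' : ℂ} {t δ : ℝ} (hδ : 0 < δ) (a : ℝ)
    (h : HasDerivAt f f' t) :
    HasDerivAt (fun s => ((f s).re ^ 2 + (f s).im ^ 2 + δ) ^ a)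
      (a * ((f t).re ^ 2 + (f t).im ^ 2 + δ) ^ (a - 1)
        * (2 * ((f t).re * f'.re + (f t).im * f'.im))) t := by
  have hN : HasDerivAt (fun s => (f s).re ^ 2 + (f s).im ^ 2 + δ)
      (2 * ((f t).re * f'.re + (f t).im * f'.im)) t := by
    convert! (((hasDerivAt_re_of h).pow 2).add ((hasDerivAt_im_of h).pow 2)).add_const δ using 1
    push_cast; ring
  have hpos : 0 < (f t).re ^ 2 + (f t).im ^ 2 + δ := by positivity
  convert! hN.rpow_const (p := a) (Or.inl hpos.ne') using 1
  ring

theorem hasDerivAt_rieszFun {f : ℝ → ℂ} {f' : ℂ} {t δ : ℝ} (m : ℝ) (hδ : 0 < δ)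
    (h : HasDerivAt f f' t) :
    HasDerivAt (fun s => rieszFun m δ (f s)) (rieszFunDeriv m δ (f t) f') t := by
  have h1 := ((hasDerivAt_normSq_add_rpow hδ m h).const_mul (2 * (m + 1) ^ 2)).mul
    ((hasDerivAt_re_of h).pow 2)
  have h2 := (h1.sub (hasDerivAt_normSq_add_rpow hδ (m + 1) h)).add_const (δ ^ (m + 1))
  convert! h2 using 1
  simp only [rieszFunDeriv, add_sub_cancel_right, Pi.pow_apply]
  push_cast; ring

theorem hasDerivAt_rieszFunDeriv {f g : ℝ → ℂ} {g' : ℂ} {t δ : ℝ} (m : ℝ) (hδ : 0 < δ)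
    (h : HasDerivAt f (g t) t) (hg : HasDerivAt g g' t) :
    HasDerivAt (fun s => rieszFunDeriv m δ (f s) (g s)) (rieszFunDeriv₂ m δ (f t) (g t) g') t := by
  have hu := hasDerivAt_re_of h
  have hv := hasDerivAt_im_of h
  have hu' := hasDerivAt_re_of hg
  have hv' := hasDerivAt_im_of hg
  have hN1 := ((hu.mul hu').add (hv.mul hv')).const_mul 2
  have hP := (((hasDerivAt_normSq_add_rpow hδ (m - 1) h).const_mul (2 * (m + 1) ^ 2 * m)).mul
    (hu.pow 2)).sub ((hasDerivAt_normSq_add_rpow hδ m h).const_mul (m + 1))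
  have hQ := ((hasDerivAt_normSq_add_rpow hδ m h).const_mul (4 * (m + 1) ^ 2)).mul (hu.mul hu')
  convert! (hN1.mul hP).add hQ using 1
  simp only [rieszFunDeriv₂, show m - 1 - 1 = m - 2 by ring, Pi.mul_apply, Pi.pow_apply,
    Pi.add_apply, Pi.sub_apply]
  push_cast; ring

/-- Subharmonicity of the Riesz function, tested on a holomorphic curve. -/
theorem rieszFunDeriv₂_add_nonneg {m δ : ℝ} (hm : 0 ≤ m) (hδ : 0 < δ) (z z₁ z₂ : ℂ) :
    0 ≤ rieszFunDeriv₂ m δ z z₁ z₂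
      + rieszFunDeriv₂ m δ z (Complex.I * z₁) (-z₂) := by
  obtain ⟨U, V⟩ := z
  obtain ⟨A, B⟩ := z₁
  obtain ⟨C, D⟩ := z₂
  simp only [rieszFunDeriv₂, Complex.mul_re, Complex.mul_im, Complex.I_re, Complex.I_im,
    Complex.neg_re, Complex.neg_im]
  set N := U ^ 2 + V ^ 2 + δ with hN
  have hNpos : 0 < N := by positivity
  have e1 : N ^ (m - 1) = N * N ^ (m - 2) := by
    rw [show m - 1 = 1 + (m - 2) by ring, Real.rpow_add hNpos, Real.rpow_one]
  have e2 : N ^ m = N ^ 2 * N ^ (m - 2) := by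
    conv_lhs => rw [show m = 2 + (m - 2) by ring]
    rw [Real.rpow_add hNpos, Real.rpow_two]
  rw [e1, e2]
  set X := N ^ (m - 2) with hX
  have hXpos : 0 < X := Real.rpow_pos_of_pos hNpos _
  have key : 0 ≤ (A ^ 2 + B ^ 2) * X * (4 * (m + 1) * m * δ * N
      + 8 * (m + 1) ^ 2 * m * U ^ 2 * (3 * N + (m - 1) * (U ^ 2 + V ^ 2))) := by
    have : 0 ≤ 3 * N + (m - 1) * (U ^ 2 + V ^ 2) := by
      have : 0 ≤ m * (U ^ 2 + V ^ 2) := by positivity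
      nlinarith [sq_nonneg U, sq_nonneg V]
    positivity
  refine key.trans_eq ?_
  have hV : δ = N - U ^ 2 - V ^ 2 := by rw [hN]; ring
  rw [hV]
  ring

theorem exists_rpow_le_on_Icc {δ L : ℝ} (hδ : 0 < δ) (a : ℝ) :
    ∃ B : ℝ, 0 ≤ B ∧ ∀ N, δ ≤ N → N ≤ L → N ^ a ≤ B := by
  have hc : ContinuousOn (fun N : ℝ => N ^ a) (Set.Icc δ L) := fun N hN =>
    (Real.continuousAt_rpow_const N a (Or.inl (hδ.trans_le hN.1).ne')).continuousWithinAt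
  obtain ⟨B, hB⟩ := isCompact_Icc.exists_bound_of_continuousOn hc
  exact ⟨|B|, abs_nonneg _, fun N h1 h2 =>
    (le_abs_self _).trans ((hB N ⟨h1, h2⟩).trans (le_abs_self _))⟩

theorem abs_re_mul_add_im_mul_le (w v : ℂ) : |w.re * v.re + w.im * v.im| ≤ ‖w‖ * ‖v‖ := by
  have := Complex.abs_re_le_norm (w * starRingEnd ℂ v)
  simpa [Complex.mul_re] using this

theorem abs_re_mul_re_le (w v : ℂ) : |w.re * v.re| ≤ ‖w‖ * ‖v‖ := by
  rw [abs_mul]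
  exact mul_le_mul (Complex.abs_re_le_norm _) (Complex.abs_re_le_norm _) (abs_nonneg _)
    (norm_nonneg _)

theorem re_sq_add_im_sq (z : ℂ) : z.re ^ 2 + z.im ^ 2 = ‖z‖ ^ 2 := by
  rw [Complex.sq_norm, Complex.normSq_apply]; ring

theorem re_sq_le_norm_sq (z : ℂ) : z.re ^ 2 ≤ ‖z‖ ^ 2 := by
  rw [← re_sq_add_im_sq]; nlinarith [sq_nonneg z.im]

theorem exists_rieszFun_bound {m δ : ℝ} (K : ℝ) (hm : 0 ≤ m) (hδ : 0 < δ) :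
    ∃ C : ℝ, 0 ≤ C ∧ ∀ z : ℂ, ‖z‖ ≤ K → |rieszFun m δ z| ≤ C * ‖z‖ ^ 2 := by
  obtain ⟨B, hB, hb⟩ := exists_rpow_le_on_Icc (L := K ^ 2 + δ) hδ m
  refine ⟨2 * (m + 1) ^ 2 * B + (m + 1) * B, by positivity, fun z hz => ?_⟩
  have hzK : ‖z‖ ^ 2 ≤ K ^ 2 := by gcongr
  have hN1 : δ ≤ ‖z‖ ^ 2 + δ := by nlinarith [norm_nonneg z]
  have hN2 : ‖z‖ ^ 2 + δ ≤ K ^ 2 + δ := by linarith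
  have hmvt : |(‖z‖ ^ 2 + δ) ^ (m + 1) - δ ^ (m + 1)| ≤ (m + 1) * B * ‖z‖ ^ 2 := by
    have := (convex_Icc δ (K ^ 2 + δ)).norm_image_sub_le_of_norm_hasDerivWithin_le
      (f := fun N : ℝ => N ^ (m + 1)) (f' := fun N => (m + 1) * N ^ m) (C := (m + 1) * B)
      (x := δ) (y := ‖z‖ ^ 2 + δ) (fun N hN => ?_) (fun N hN => ?_)
      ⟨le_rfl, by nlinarith⟩ ⟨hN1, hN2⟩
    · simpa [abs_of_nonneg] using this
    · have := Real.hasDerivAt_rpow_const (x := N) (p := m + 1)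
        (Or.inl (hδ.trans_le hN.1).ne')
      simpa using this.hasDerivWithinAt
    · have h0 : 0 ≤ N ^ m := Real.rpow_nonneg (hδ.le.trans hN.1) _
      rw [Real.norm_of_nonneg (by positivity)]
      gcongr
      exact hb _ hN.1 hN.2
  have x0 := hb _ hN1 hN2
  have h1 : rieszFun m δ z = 2 * (m + 1) ^ 2 * (‖z‖ ^ 2 + δ) ^ m * z.re ^ 2
      - ((‖z‖ ^ 2 + δ) ^ (m + 1) - δ ^ (m + 1)) := by
    simp only [rieszFun, re_sq_add_im_sq]; ring
  rw [h1, add_mul]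
  refine (abs_sub _ _).trans (add_le_add ?_ hmvt)
  rw [abs_of_nonneg (by positivity)]
  exact mul_le_mul (mul_le_mul_of_nonneg_left x0 (by positivity)) (re_sq_le_norm_sq z)
    (by positivity) (by positivity)

theorem abs_rieszFun_inner_le {m K B₀ B₁ : ℝ} (hm : 0 ≤ m) {z : ℂ} (hz : ‖z‖ ≤ K)
    {X₀ X₁ : ℝ} (y₀ : 0 ≤ X₀) (y₁ : 0 ≤ X₁) (x₀ : X₀ ≤ B₀) (x₁ : X₁ ≤ B₁) :
    |2 * (m + 1) ^ 2 * m * X₁ * z.re ^ 2 - (m + 1) * X₀|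
      ≤ 2 * (m + 1) ^ 2 * m * B₁ * K ^ 2 + (m + 1) * B₀ := by
  have hu : z.re ^ 2 ≤ K ^ 2 :=
    (re_sq_le_norm_sq z).trans (pow_le_pow_left₀ (norm_nonneg z) hz 2)
  have hu0 := sq_nonneg z.re
  generalize z.re ^ 2 = w at *
  refine (abs_sub _ _).trans ?_
  rw [abs_of_nonneg (by positivity), abs_of_nonneg (by positivity)]
  have : 0 ≤ B₁ := y₁.trans x₁
  gcongr

theorem exists_rieszFunDeriv_bound {m δ : ℝ} (K : ℝ) (hm : 0 ≤ m) (hδ : 0 < δ) :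
    ∃ C : ℝ, 0 ≤ C ∧ ∀ z z₁ : ℂ, ‖z‖ ≤ K →
      |rieszFunDeriv m δ z z₁| ≤ C * (‖z‖ * ‖z₁‖) := by
  obtain ⟨B₀, hB₀, hb₀⟩ := exists_rpow_le_on_Icc (L := K ^ 2 + δ) hδ m
  obtain ⟨B₁, hB₁, hb₁⟩ := exists_rpow_le_on_Icc (L := K ^ 2 + δ) hδ (m - 1)
  refine ⟨2 * (2 * (m + 1) ^ 2 * m * B₁ * K ^ 2 + (m + 1) * B₀) + 4 * (m + 1) ^ 2 * B₀,
    by positivity, fun z z₁ hz => ?_⟩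
  have hzK : ‖z‖ ^ 2 ≤ K ^ 2 := by gcongr
  have hN1 : δ ≤ ‖z‖ ^ 2 + δ := by nlinarith [norm_nonneg z]
  have hN2 : ‖z‖ ^ 2 + δ ≤ K ^ 2 + δ := by linarith
  have x0 := hb₀ _ hN1 hN2
  have x1 := hb₁ _ hN1 hN2
  have y0 : 0 ≤ (‖z‖ ^ 2 + δ) ^ m := by positivity
  have y1 : 0 ≤ (‖z‖ ^ 2 + δ) ^ (m - 1) := by positivity
  have hP := abs_rieszFun_inner_le hm hz y0 y1 x0 x1
  simp only [rieszFunDeriv, re_sq_add_im_sq]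
  generalize (‖z‖ ^ 2 + δ) ^ m = X0 at *
  generalize (‖z‖ ^ 2 + δ) ^ (m - 1) = X1 at *
  rw [add_mul _ _ (‖z‖ * ‖z₁‖)]
  refine (abs_add_le _ _).trans (add_le_add ?_ ?_)
  · rw [abs_mul, abs_mul, abs_two]
    calc _ ≤ 2 * (‖z‖ * ‖z₁‖) * _ := mul_le_mul (mul_le_mul_of_nonneg_left
          (abs_re_mul_add_im_mul_le z z₁) zero_le_two) hP (abs_nonneg _) (by positivity)
      _ = _ := by ring
  · rw [abs_mul, abs_of_nonneg (by positivity)]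
    exact mul_le_mul (mul_le_mul_of_nonneg_left x0 (by positivity)) (abs_re_mul_re_le z z₁)
      (abs_nonneg _) (by positivity)

theorem exists_rieszFunDeriv₂_bound {m δ : ℝ} (K : ℝ) (hm : 0 ≤ m) (hδ : 0 < δ) :
    ∃ C : ℝ, 0 ≤ C ∧ ∀ z z₁ z₂ : ℂ, ‖z‖ ≤ K →
      |rieszFunDeriv₂ m δ z z₁ z₂| ≤ C * (‖z‖ ^ 2 + ‖z₁‖ ^ 2 + ‖z₂‖ ^ 2) := by
  obtain ⟨B₀, hB₀, hb₀⟩ := exists_rpow_le_on_Icc (L := K ^ 2 + δ) hδ m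
  obtain ⟨B₁, hB₁, hb₁⟩ := exists_rpow_le_on_Icc (L := K ^ 2 + δ) hδ (m - 1)
  obtain ⟨B₂, hB₂, hb₂⟩ := exists_rpow_le_on_Icc (L := K ^ 2 + δ) hδ (m - 2)
  refine ⟨4 * (2 * (m + 1) ^ 2 * m * B₁ * K ^ 2 + (m + 1) * B₀) +
    2 * (2 * (m + 1) ^ 2 * m * (|m - 1| * B₂ * 2 * K ^ 2 + 2 * B₁) + (m + 1) * (m * B₁ * 2))
      * K ^ 2 + 4 * (m + 1) ^ 2 * (B₀ * 2 + m * B₁ * 2 * K ^ 2), by positivity,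
    fun z z₁ z₂ hz => ?_⟩
  have hzK : ‖z‖ ^ 2 ≤ K ^ 2 := by gcongr
  have hN1 : δ ≤ ‖z‖ ^ 2 + δ := by nlinarith [norm_nonneg z]
  have hN2 : ‖z‖ ^ 2 + δ ≤ K ^ 2 + δ := by linarith
  have x0 := hb₀ _ hN1 hN2
  have x1 := hb₁ _ hN1 hN2
  have x2 := hb₂ _ hN1 hN2
  have y0 : 0 ≤ (‖z‖ ^ 2 + δ) ^ m := by positivity
  have y1 : 0 ≤ (‖z‖ ^ 2 + δ) ^ (m - 1) := by positivity
  have y2 : 0 ≤ (‖z‖ ^ 2 + δ) ^ (m - 2) := by positivity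
  have hP := abs_rieszFun_inner_le hm hz y0 y1 x0 x1
  simp only [rieszFunDeriv₂, re_sq_add_im_sq]
  generalize (‖z‖ ^ 2 + δ) ^ m = X0 at *
  generalize (‖z‖ ^ 2 + δ) ^ (m - 1) = X1 at *
  generalize (‖z‖ ^ 2 + δ) ^ (m - 2) = X2 at *
  have hS0 : 0 ≤ ‖z‖ ^ 2 + ‖z₁‖ ^ 2 + ‖z₂‖ ^ 2 := by positivity
  have s1 : ‖z₁‖ ^ 2 + ‖z‖ * ‖z₂‖ ≤ 2 * (‖z‖ ^ 2 + ‖z₁‖ ^ 2 + ‖z₂‖ ^ 2) := by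
    nlinarith [sq_nonneg (‖z‖ - ‖z₂‖), sq_nonneg ‖z₁‖, sq_nonneg ‖z‖, sq_nonneg ‖z₂‖]
  have s2 : (‖z‖ * ‖z₁‖) * (‖z‖ * ‖z₁‖) ≤ K ^ 2 * (‖z‖ ^ 2 + ‖z₁‖ ^ 2 + ‖z₂‖ ^ 2) := by
    calc (‖z‖ * ‖z₁‖) * (‖z‖ * ‖z₁‖) = ‖z‖ ^ 2 * ‖z₁‖ ^ 2 := by ring
      _ ≤ _ := mul_le_mul hzK (by nlinarith [sq_nonneg ‖z‖, sq_nonneg ‖z₂‖])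
        (by positivity) (by positivity)
  have hdd : |‖z₁‖ ^ 2 + z.re * z₂.re + z.im * z₂.im|
      ≤ 2 * (‖z‖ ^ 2 + ‖z₁‖ ^ 2 + ‖z₂‖ ^ 2) := by
    refine le_trans ?_ s1
    rw [add_assoc]
    refine (abs_add_le _ _).trans (add_le_add ?_ (abs_re_mul_add_im_mul_le _ _))
    rw [abs_of_nonneg (by positivity)]
  have hrr : |z₁.re ^ 2 + z.re * z₂.re| ≤ 2 * (‖z‖ ^ 2 + ‖z₁‖ ^ 2 + ‖z₂‖ ^ 2) := by
    refine le_trans ?_ s1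
    refine (abs_add_le _ _).trans (add_le_add ?_ (abs_re_mul_re_le _ _))
    rw [abs_of_nonneg (by positivity)]
    exact re_sq_le_norm_sq _
  have hdot := abs_re_mul_add_im_mul_le z z₁
  have hre := abs_re_mul_re_le z z₁
  have hu : z.re ^ 2 ≤ K ^ 2 := (re_sq_le_norm_sq z).trans hzK
  have hu0 := sq_nonneg z.re
  have hab : 0 ≤ ‖z‖ * ‖z₁‖ := by positivity
  generalize ‖z‖ ^ 2 + ‖z₁‖ ^ 2 + ‖z₂‖ ^ 2 = S at *
  generalize ‖z₁‖ ^ 2 + z.re * z₂.re + z.im * z₂.im = G at *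
  generalize z₁.re ^ 2 + z.re * z₂.re = H at *
  generalize z.re * z₁.re + z.im * z₁.im = D at *
  generalize z.re * z₁.re = I at *
  generalize z.re ^ 2 = w at *
  generalize ‖z‖ * ‖z₁‖ = n at *
  generalize K ^ 2 = L at *
  have hL : 0 ≤ L := hu0.trans hu
  clear hz hzK hN1 hN2
  have t2 : |2 * (m + 1) ^ 2 * m * ((m - 1) * X2 * (2 * D) * w + 2 * X1 * I)
        - (m + 1) * (m * X1 * (2 * D))|
      ≤ (2 * (m + 1) ^ 2 * m * (|m - 1| * B₂ * 2 * L + 2 * B₁) + (m + 1) * (m * B₁ * 2)) * n := by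
    have i1 : |(m - 1) * X2 * (2 * D) * w| ≤ |m - 1| * B₂ * (2 * n) * L := by
      rw [abs_mul, abs_mul, abs_mul, abs_mul, abs_two, abs_of_nonneg y2, abs_of_nonneg hu0]
      gcongr
    have i2 : |2 * X1 * I| ≤ 2 * B₁ * n := by
      rw [abs_mul, abs_mul, abs_two, abs_of_nonneg y1]
      gcongr
    have i3 : |m * X1 * (2 * D)| ≤ m * B₁ * (2 * n) := by
      rw [abs_mul, abs_mul, abs_mul, abs_two, abs_of_nonneg y1, abs_of_nonneg hm]
      gcongr
    refine (abs_sub _ _).trans ?_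
    rw [abs_mul, abs_of_nonneg (show 0 ≤ 2 * (m + 1) ^ 2 * m by positivity), abs_mul (m + 1),
      abs_of_nonneg (show 0 ≤ m + 1 by positivity)]
    calc _ ≤ 2 * (m + 1) ^ 2 * m * (|m - 1| * B₂ * (2 * n) * L + 2 * B₁ * n)
          + (m + 1) * (m * B₁ * (2 * n)) :=
          add_le_add (mul_le_mul_of_nonneg_left ((abs_add_le _ _).trans (add_le_add i1 i2))
            (by positivity)) (mul_le_mul_of_nonneg_left i3 (by positivity))
      _ = _ := by ring
  have t3 : |X0 * H + m * X1 * (2 * D) * I| ≤ (B₀ * 2 + m * B₁ * 2 * L) * S := by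
    have i1 : |X0 * H| ≤ B₀ * (2 * S) := by
      rw [abs_mul, abs_of_nonneg y0]
      gcongr
    have i2 : |m * X1 * (2 * D) * I| ≤ m * B₁ * 2 * (n * n) := by
      rw [abs_mul, abs_mul, abs_mul, abs_mul, abs_two, abs_of_nonneg y1, abs_of_nonneg hm]
      calc m * X1 * (2 * |D|) * |I| ≤ m * B₁ * (2 * n) * n := by gcongr
        _ = _ := by ring
    have i3 : m * B₁ * 2 * (n * n) ≤ m * B₁ * 2 * (L * S) :=
      mul_le_mul_of_nonneg_left s2 (by positivity)
    calc _ ≤ B₀ * (2 * S) + m * B₁ * 2 * (L * S) :=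
          (abs_add_le _ _).trans (add_le_add i1 (i2.trans i3))
      _ = _ := by ring
  rw [add_mul _ _ S, add_mul _ _ S]
  refine (abs_add_le _ _).trans (add_le_add ((abs_add_le _ _).trans (add_le_add ?_ ?_)) ?_)
  · rw [abs_mul, abs_mul, abs_two]
    calc _ ≤ 2 * (2 * S) * (2 * (m + 1) ^ 2 * m * B₁ * L + (m + 1) * B₀) :=
          mul_le_mul (mul_le_mul_of_nonneg_left hdd zero_le_two) hP (abs_nonneg _) (by positivity)
      _ = _ := by ring
  · rw [abs_mul, abs_mul, abs_two]
    have hQ : 0 ≤ 2 * (m + 1) ^ 2 * m * (|m - 1| * B₂ * 2 * L + 2 * B₁)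
      + (m + 1) * (m * B₁ * 2) := by positivity
    generalize (2 * (m + 1) ^ 2 * m * (|m - 1| * B₂ * 2 * L + 2 * B₁) + (m + 1) * (m * B₁ * 2))
      = Q at *
    calc _ ≤ 2 * n * (Q * n) :=
          mul_le_mul (mul_le_mul_of_nonneg_left hdot zero_le_two) t2 (abs_nonneg _) (by positivity)
      _ = 2 * Q * (n * n) := by ring
      _ ≤ 2 * Q * (L * S) := ?_
      _ = _ := by ring
    gcongr
  · rw [abs_mul, abs_of_nonneg (by positivity), mul_assoc _ _ S]
    exact mul_le_mul_of_nonneg_left t3 (by positivity)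

theorem continuous_rieszFun {m δ : ℝ} (hδ : 0 < δ) : Continuous (rieszFun m δ) := by
  have h : ∀ (z : ℂ), z.re ^ 2 + z.im ^ 2 + δ ≠ 0 := fun z => by positivity
  unfold rieszFun
  have hr : ∀ a : ℝ, Continuous (fun z : ℂ => (z.re ^ 2 + z.im ^ 2 + δ) ^ a) := fun a =>
    Continuous.rpow_const (by fun_prop) (fun z => Or.inl (h z))
  have := hr m
  have := hr (m + 1)
  fun_prop

theorem continuous_rieszFunDeriv {m δ : ℝ} (hδ : 0 < δ) :
    Continuous (fun w : ℂ × ℂ => rieszFunDeriv m δ w.1 w.2) := by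
  have hr : ∀ a : ℝ, Continuous (fun z : ℂ × ℂ => (z.1.re ^ 2 + z.1.im ^ 2 + δ) ^ a) := fun a =>
    Continuous.rpow_const (by fun_prop) (fun z => Or.inl (by positivity))
  unfold rieszFunDeriv
  have := hr m
  have := hr (m - 1)
  fun_prop

theorem continuous_rieszFunDeriv₂ {m δ : ℝ} (hδ : 0 < δ) :
    Continuous (fun w : ℂ × ℂ × ℂ => rieszFunDeriv₂ m δ w.1 w.2.1 w.2.2) := by
  have hr : ∀ a : ℝ, Continuous (fun z : ℂ × ℂ × ℂ => (z.1.re ^ 2 + z.1.im ^ 2 + δ) ^ a) :=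
    fun a => Continuous.rpow_const (by fun_prop) (fun z => Or.inl (by positivity))
  unfold rieszFunDeriv₂
  have := hr m
  have := hr (m - 1)
  have := hr (m - 2)
  fun_prop

attribute [irreducible] rieszFun rieszFunDeriv rieszFunDeriv₂

end RieszFunction

section HolomorphicExtension

variable {E : Type*} [NormedAddCommGroup E] [InnerProductSpace ℝ E]

/-- The spectrum of the translate of `𝓕⁻ u` by the complex multiple `z` of `e`. -/
def shiftSpectrum (e : E) (u : E → ℂ) (z : ℂ) (ξ : E) : ℂ :=
  Complex.exp (2 * π * Complex.I * z * (inner ℝ e ξ : ℝ)) * u ξ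

/-- The spectrum of the derivative of `𝓕⁻ u` in the direction `e`. -/
def derivSpectrum (e : E) (u : E → ℂ) (ξ : E) : ℂ :=
  (2 * π * Complex.I * (inner ℝ e ξ : ℝ)) * u ξ

theorem norm_shiftSpectrum (e : E) (u : E → ℂ) (z : ℂ) (ξ : E) :
    ‖shiftSpectrum e u z ξ‖ = Real.exp (-(2 * π * z.im * inner ℝ e ξ)) * ‖u ξ‖ := by
  rw [shiftSpectrum, norm_mul, Complex.norm_exp]
  congr 2
  simp [Complex.mul_re, Complex.mul_im]

theorem norm_derivSpectrum (e : E) (u : E → ℂ) (ξ : E) :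
    ‖derivSpectrum e u ξ‖ = 2 * π * |inner ℝ e ξ| * ‖u ξ‖ := by
  simp [derivSpectrum, abs_of_pos Real.pi_pos]

theorem shiftSpectrum_zero (e : E) (u : E → ℂ) : shiftSpectrum e u 0 = u := by
  ext ξ; simp [shiftSpectrum]

theorem derivSpectrum_shiftSpectrum (e : E) (u : E → ℂ) (z : ℂ) :
    derivSpectrum e (shiftSpectrum e u z) = shiftSpectrum e (derivSpectrum e u) z := by
  ext ξ
  simp only [shiftSpectrum, derivSpectrum]
  ring

variable [FiniteDimensional ℝ E] [MeasurableSpace E] [BorelSpace E]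

theorem BddSpectrum.shift {u : E → ℂ} (hu : BddSpectrum u) (e : E) (z : ℂ) :
    BddSpectrum (shiftSpectrum e u z) :=
  hu.mul_of_continuous (by fun_prop)

theorem BddSpectrum.deriv {u : E → ℂ} (hu : BddSpectrum u) (e : E) :
    BddSpectrum (derivSpectrum e u) :=
  hu.mul_of_continuous (by fun_prop)

theorem fourierInv_add_smul (e : E) (u : E → ℂ) (x : E) (s : ℝ) :
    𝓕⁻ u (x + s • e) = 𝓕⁻ (shiftSpectrum e u s) x := by
  simp only [Real.fourierInv_eq', shiftSpectrum, smul_eq_mul]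
  congr 1; ext ξ
  rw [← mul_assoc, ← Complex.exp_add]
  congr 2
  rw [inner_add_right, inner_smul_right, real_inner_comm e ξ]
  push_cast; ring

theorem BddSpectrum.norm_shift_le {u : E → ℂ} (hu : BddSpectrum u) (e : E) (r : ℝ) :
    ∃ b : E → ℝ, Integrable b ∧ ∀ z : ℂ, ‖z‖ ≤ r → ∀ ξ, ‖shiftSpectrum e u z ξ‖ ≤ b ξ := by
  refine ⟨fun ξ => Real.exp (2 * π * r * ‖e‖ * ‖ξ‖) * ‖u ξ‖, ?_, fun z hz ξ => ?_⟩
  · have := (hu.mul_of_continuous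
      (c := fun ξ => Complex.exp (2 * π * r * ‖e‖ * ‖ξ‖ : ℝ)) (by fun_prop)).integrable.norm
    simpa [Complex.norm_exp] using this
  · rw [norm_shiftSpectrum]
    refine mul_le_mul_of_nonneg_right (Real.exp_le_exp.2 ?_) (norm_nonneg _)
    have h1 : |z.im * inner ℝ e ξ| ≤ r * (‖e‖ * ‖ξ‖) := by
      rw [abs_mul]
      exact mul_le_mul ((Complex.abs_im_le_norm z).trans hz) (abs_real_inner_le_norm e ξ)
        (abs_nonneg _) ((norm_nonneg z).trans hz)
    have h2 := neg_le_of_abs_le h1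
    nlinarith [Real.pi_pos]

theorem BddSpectrum.hasDerivAt_fourierInv_shift {u : E → ℂ} (hu : BddSpectrum u) (e x : E)
    (z : ℂ) : HasDerivAt (fun z => 𝓕⁻ (shiftSpectrum e u z) x)
      (𝓕⁻ (shiftSpectrum e (derivSpectrum e u) z) x) z := by
  obtain ⟨b, hb, hbb⟩ := (hu.deriv e).norm_shift_le e (‖z‖ + 1)
  simp only [Real.fourierInv_eq]
  have hm : ∀ {v : E → ℂ}, BddSpectrum v →
      Integrable (fun ξ => 𝐞 (inner ℝ ξ x) • v ξ) volume := by
    intro v hv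
    refine (integrable_norm_iff ?_).1 (by simpa using hv.integrable.norm)
    exact (Real.continuous_fourierChar.comp (by fun_prop)).aestronglyMeasurable.smul hv.meas
  refine (hasDerivAt_integral_of_dominated_loc_of_deriv_le (F := fun z ξ =>
    𝐞 (inner ℝ ξ x) • shiftSpectrum e u z ξ) (F' := fun z ξ =>
    𝐞 (inner ℝ ξ x) • shiftSpectrum e (derivSpectrum e u) z ξ) (bound := b)
    (Metric.ball_mem_nhds z one_pos) (Filter.Eventually.of_forall fun w => (hm (hu.shift e w)).1)
    (hm (hu.shift e z)) (hm ((hu.deriv e).shift e z)).1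
    (Filter.Eventually.of_forall fun ξ w hw => ?_) hb
    (Filter.Eventually.of_forall fun ξ w hw => ?_)).2
  · rw [Circle.norm_smul]
    refine hbb w ?_ ξ
    have := norm_sub_norm_le w z
    rw [Metric.mem_ball, dist_eq_norm] at hw
    linarith
  · have h1 : HasDerivAt (fun w : ℂ => 2 * π * Complex.I * w * (inner ℝ e ξ : ℝ))
        (2 * π * Complex.I * (inner ℝ e ξ : ℝ)) w := by
      simpa using ((hasDerivAt_id w).const_mul (2 * π * Complex.I)).mul_const
        ((inner ℝ e ξ : ℝ) : ℂ)
    have h2 := (h1.cexp.mul_const (u ξ)).const_smul (𝐞 (inner ℝ ξ x))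
    convert! h2 using 1
    simp only [shiftSpectrum, derivSpectrum, mul_assoc]

theorem BddSpectrum.continuous_fourierInv_shift {u : E → ℂ} (hu : BddSpectrum u) (e : E) :
    Continuous (fun w : ℂ × E => 𝓕⁻ (shiftSpectrum e u w.1) w.2) := by
  rw [continuous_iff_continuousAt]
  intro w₀
  obtain ⟨b, hb, hbb⟩ := hu.norm_shift_le e (‖w₀.1‖ + 1)
  simp only [Real.fourierInv_eq]
  refine continuousAt_of_dominated (bound := b) (Filter.Eventually.of_forall fun w => ?_) ?_ hb
    (Filter.Eventually.of_forall fun ξ => ?_)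
  · exact (Real.continuous_fourierChar.comp (by fun_prop)).aestronglyMeasurable.smul
      (hu.shift e w.1).meas
  · have : Continuous fun w : ℂ × E => ‖w.1‖ := by fun_prop
    filter_upwards [this.continuousAt.eventually_lt continuousAt_const
      (lt_add_one ‖w₀.1‖)] with w hw
    refine Filter.Eventually.of_forall fun ξ => ?_
    rw [Circle.norm_smul]
    exact hbb _ hw.le ξ
  · have hi : Continuous fun w : ℂ × E => (inner ℝ ξ w.2 : ℝ) := by fun_prop
    have hs : Continuous fun w : ℂ × E => shiftSpectrum e u w.1 ξ := by
      unfold shiftSpectrum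
      fun_prop
    exact ((Real.continuous_fourierChar.comp hi).smul hs).continuousAt

end HolomorphicExtension

section RieszPositivity

variable {E : Type*} [NormedAddCommGroup E] [InnerProductSpace ℝ E]

/-- The spectrum of the extension of `𝓕⁻ u` to height `y` in the imaginary direction `e`. -/
def dampedSpectrum (e : E) (u : E → ℂ) (y : ℝ) : E → ℂ := shiftSpectrum e u (Complex.I * y)

theorem norm_dampedSpectrum (e : E) (u : E → ℂ) (y : ℝ) (ξ : E) :
    ‖dampedSpectrum e u y ξ‖ = Real.exp (-(2 * π * y * inner ℝ e ξ)) * ‖u ξ‖ := by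
  rw [dampedSpectrum, norm_shiftSpectrum]; simp

theorem norm_dampedSpectrum_le {e : E} {u : E → ℂ} {y : ℝ} (hy : 0 ≤ y) {ξ : E}
    (h : u ξ ≠ 0 → 0 < inner ℝ e ξ) : ‖dampedSpectrum e u y ξ‖ ≤ ‖u ξ‖ := by
  rw [norm_dampedSpectrum]
  by_cases h0 : u ξ = 0
  · simp [h0]
  · have := h h0
    refine mul_le_of_le_one_left (norm_nonneg _) (Real.exp_le_one_iff.2 ?_)
    have := Real.pi_pos
    rw [neg_nonpos]
    positivity

variable [FiniteDimensional ℝ E] [MeasurableSpace E] [BorelSpace E]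

theorem integral_lineDeriv_eq_zero {g g' : E → ℝ} {e : E} (hg : Integrable g)
    (hg' : Integrable g') (h : ∀ x, HasLineDerivAt ℝ g (g' x) x e) : ∫ x, g' x = 0 := by
  have := integral_bilinear_hasLineDerivAt_right_eq_neg_left_of_integrable (μ := volume)
    (f := fun _ : E => (1 : ℝ)) (f' := fun _ => 0) (g := g) (g' := g') (v := e)
    (B := ContinuousLinearMap.mul ℝ ℝ) (by simp) (by simpa) (by simpa)
    (fun x _ => hasDerivAt_const _ _) (fun x _ => h x)
  simpa using this

variable {e : E} {u : E → ℂ}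

theorem BddSpectrum.damped (hu : BddSpectrum u) (e : E) (y : ℝ) :
    BddSpectrum (dampedSpectrum e u y) := hu.shift e _

theorem BddSpectrum.hasDerivAt_damped (hu : BddSpectrum u) (e x : E) (y : ℝ) :
    HasDerivAt (fun y : ℝ => 𝓕⁻ (dampedSpectrum e u y) x)
      (Complex.I * 𝓕⁻ (dampedSpectrum e (derivSpectrum e u) y) x) y := by
  have h1 : HasDerivAt (fun y : ℝ => Complex.I * (y : ℂ)) Complex.I y := by
    simpa using (Complex.ofRealCLM.hasDerivAt (x := y)).const_mul Complex.I
  have := (hu.hasDerivAt_fourierInv_shift e x (Complex.I * y)).scomp y h1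
  exact this

theorem BddSpectrum.hasDerivAt_fourierInv_line (hu : BddSpectrum u) (e x : E) :
    HasDerivAt (fun s : ℝ => 𝓕⁻ u (x + s • e)) (𝓕⁻ (derivSpectrum e u) x) 0 := by
  have := (hu.hasDerivAt_fourierInv_shift e x ((0 : ℝ) : ℂ)).comp_ofReal
  simp only [Complex.ofReal_zero, shiftSpectrum_zero] at this
  simpa only [fourierInv_add_smul] using this

theorem BddSpectrum.continuous_damped (hu : BddSpectrum u) (e : E) :
    Continuous (fun w : ℝ × E => 𝓕⁻ (dampedSpectrum e u w.1) w.2) :=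
  (hu.continuous_fourierInv_shift e).comp
    (f := fun w : ℝ × E => ((Complex.I * (w.1 : ℂ), w.2) : ℂ × E)) (by fun_prop)

theorem BddSpectrum.integral_norm_sq_damped_le (hu : BddSpectrum u)
    (h : ∀ ξ, u ξ ≠ 0 → 0 < inner ℝ e ξ) {y : ℝ} (hy : 0 ≤ y) :
    ∫ x, ‖𝓕⁻ (dampedSpectrum e u y) x‖ ^ 2 ≤ ∫ ξ, ‖u ξ‖ ^ 2 := by
  rw [(hu.damped e y).integral_norm_sq_fourierInv]
  refine integral_mono ((hu.damped e y).memLp 2).norm.integrable_sq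
    (hu.memLp 2).norm.integrable_sq fun ξ => ?_
  exact pow_le_pow_left₀ (norm_nonneg _) (norm_dampedSpectrum_le hy (h ξ)) 2

theorem BddSpectrum.norm_fourierInv_damped_le (hu : BddSpectrum u)
    (h : ∀ ξ, u ξ ≠ 0 → 0 < inner ℝ e ξ) {y : ℝ} (hy : 0 ≤ y) (x : E) :
    ‖𝓕⁻ (dampedSpectrum e u y) x‖ ≤ ∫ ξ, ‖u ξ‖ :=
  (norm_fourierInv_le _ _).trans (integral_mono (hu.damped e y).integrable.norm
    hu.integrable.norm fun ξ => norm_dampedSpectrum_le hy (h ξ))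

theorem BddSpectrum.tendsto_integral_norm_sq_damped (hu : BddSpectrum u)
    (h : ∀ ξ, u ξ ≠ 0 → 0 < inner ℝ e ξ) :
    Filter.Tendsto (fun y : ℝ => ∫ x, ‖𝓕⁻ (dampedSpectrum e u y) x‖ ^ 2)
      Filter.atTop (nhds 0) := by
  simp_rw [(hu.damped e _).integral_norm_sq_fourierInv]
  have h0 : (0 : ℝ) = ∫ ξ : E, (0 : ℝ) := by simp
  rw [h0]
  refine tendsto_integral_filter_of_dominated_convergence (fun ξ => ‖u ξ‖ ^ 2)
    (Filter.Eventually.of_forall fun y => (hu.damped e y).meas.norm.pow 2) ?_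
    (hu.memLp 2).norm.integrable_sq (Filter.Eventually.of_forall fun ξ => ?_)
  · filter_upwards [Filter.eventually_ge_atTop 0] with y hy
    refine Filter.Eventually.of_forall fun ξ => ?_
    rw [Real.norm_of_nonneg (by positivity)]
    exact pow_le_pow_left₀ (norm_nonneg _) (norm_dampedSpectrum_le hy (h ξ)) 2
  · simp_rw [norm_dampedSpectrum]
    by_cases hξ : u ξ = 0
    · simp [hξ]
    have hpos : 0 < 2 * π * inner ℝ e ξ := mul_pos Real.two_pi_pos (h ξ hξ)
    have h1 : Filter.Tendsto (fun y : ℝ => Real.exp (-(2 * π * y * inner ℝ e ξ)))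
        Filter.atTop (nhds 0) := by
      refine Real.tendsto_exp_neg_atTop_nhds_zero.comp ?_
      refine (Filter.tendsto_id.const_mul_atTop hpos).congr fun y => ?_
      simp only [id]; ring
    simpa using (h1.mul_const ‖u ξ‖).pow 2

theorem BddSpectrum.tendsto_sq_mul_integral_norm_sq_damped (hu : BddSpectrum u)
    (h : ∀ ξ, u ξ ≠ 0 → 0 < inner ℝ e ξ) :
    Filter.Tendsto
      (fun y : ℝ => y ^ 2 * ∫ x, ‖𝓕⁻ (dampedSpectrum e (derivSpectrum e u) y) x‖ ^ 2)
      Filter.atTop (nhds 0) := by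
  simp_rw [((hu.deriv e).damped e _).integral_norm_sq_fourierInv, ← integral_const_mul]
  have h0 : (0 : ℝ) = ∫ ξ : E, (0 : ℝ) := by simp
  rw [h0]
  have key : ∀ (y : ℝ) ξ, y ^ 2 * ‖dampedSpectrum e (derivSpectrum e u) y ξ‖ ^ 2
      = ((2 * π * y * inner ℝ e ξ) * Real.exp (-(2 * π * y * inner ℝ e ξ))) ^ 2 * ‖u ξ‖ ^ 2 := by
    intro y ξ
    rw [norm_dampedSpectrum, norm_derivSpectrum]
    have := sq_abs (inner ℝ e ξ : ℝ)
    calc _ = (2 * π * y) ^ 2 * |inner ℝ e ξ| ^ 2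
        * Real.exp (-(2 * π * y * inner ℝ e ξ)) ^ 2 * ‖u ξ‖ ^ 2 := by ring
      _ = _ := by rw [this]; ring
  refine tendsto_integral_filter_of_dominated_convergence (fun ξ => ‖u ξ‖ ^ 2)
    (Filter.Eventually.of_forall fun y =>
      (((hu.deriv e).damped e y).meas.norm.pow 2).const_mul _) ?_
    (hu.memLp 2).norm.integrable_sq (Filter.Eventually.of_forall fun ξ => ?_)
  · filter_upwards [Filter.eventually_ge_atTop 0] with y hy
    refine Filter.Eventually.of_forall fun ξ => ?_
    rw [Real.norm_of_nonneg (by positivity), key]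
    by_cases hξ : u ξ = 0
    · simp [hξ]
    have hpos : 0 ≤ 2 * π * y * inner ℝ e ξ :=
      mul_nonneg (mul_nonneg Real.two_pi_pos.le hy) (h ξ hξ).le
    generalize 2 * π * y * inner ℝ e ξ = t at *
    refine mul_le_of_le_one_left (by positivity) (pow_le_one₀ (by positivity) ?_)
    rw [Real.exp_neg, mul_inv_le_iff₀ (Real.exp_pos t)]
    linarith [Real.add_one_le_exp t]
  · simp_rw [key]
    by_cases hξ : u ξ = 0
    · simp [hξ]
    have hpos : 0 < 2 * π * inner ℝ e ξ := mul_pos Real.two_pi_pos (h ξ hξ)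
    have h1 : Filter.Tendsto (fun y : ℝ => (2 * π * y * inner ℝ e ξ)
        * Real.exp (-(2 * π * y * inner ℝ e ξ))) Filter.atTop (nhds 0) := by
      have h2 := Real.tendsto_pow_mul_exp_neg_atTop_nhds_zero 1
      refine (h2.comp (Filter.tendsto_id.const_mul_atTop hpos)).congr fun y => ?_
      simp only [id, Function.comp, pow_one]
      rw [show 2 * π * inner ℝ e ξ * y = 2 * π * y * inner ℝ e ξ by ring]
    simpa using (h1.pow 2).mul_const (‖u ξ‖ ^ 2)

end RieszPositivity

section RieszIntegral

variable {E : Type*} [NormedAddCommGroup E] [InnerProductSpace ℝ E] [FiniteDimensional ℝ E]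
  [MeasurableSpace E] [BorelSpace E] {e : E} {u : E → ℂ} {m δ : ℝ}

theorem BddSpectrum.integrable_rieszFun (hu : BddSpectrum u) (hm : 0 ≤ m) (hδ : 0 < δ) :
    Integrable (fun x => rieszFun m δ (𝓕⁻ u x)) := by
  obtain ⟨C, -, hC⟩ := exists_rieszFun_bound (∫ ξ, ‖u ξ‖) hm hδ
  refine (hu.integrable_norm_sq_fourierInv.const_mul C).mono'
    ((continuous_rieszFun hδ).comp hu.continuous_fourierInv).aestronglyMeasurable
    (Filter.Eventually.of_forall fun x => hC _ (norm_fourierInv_le u x))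

theorem integrable_rieszFunDeriv {u v : E → ℂ} (hu : BddSpectrum u) (hv : BddSpectrum v)
    (hm : 0 ≤ m) (hδ : 0 < δ) (c : ℂ) :
    Integrable (fun x => rieszFunDeriv m δ (𝓕⁻ u x) (c * 𝓕⁻ v x)) := by
  obtain ⟨C, hC0, hC⟩ := exists_rieszFunDeriv_bound (∫ ξ, ‖u ξ‖) hm hδ
  have hi := ((hu.integrable_norm_sq_fourierInv.add
    ((hv.integrable_norm_sq_fourierInv).const_mul (‖c‖ ^ 2))).const_mul C)
  refine hi.mono' ((continuous_rieszFunDeriv hδ).comp (hu.continuous_fourierInv.prodMk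
      (continuous_const.mul hv.continuous_fourierInv))).aestronglyMeasurable
    (Filter.Eventually.of_forall fun x => (hC _ _ (norm_fourierInv_le u x)).trans ?_)
  refine mul_le_mul_of_nonneg_left ?_ hC0
  simp only [Pi.add_apply]
  rw [← mul_pow, ← norm_mul c]
  nlinarith [sq_nonneg (‖𝓕⁻ u x‖ - ‖c * 𝓕⁻ v x‖), sq_nonneg ‖𝓕⁻ u x‖,
    sq_nonneg ‖c * 𝓕⁻ v x‖]

theorem integrable_rieszFunDeriv₂ {u v w : E → ℂ} (hu : BddSpectrum u) (hv : BddSpectrum v)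
    (hw : BddSpectrum w) (hm : 0 ≤ m) (hδ : 0 < δ) (c c' : ℂ) :
    Integrable (fun x => rieszFunDeriv₂ m δ (𝓕⁻ u x) (c * 𝓕⁻ v x) (c' * 𝓕⁻ w x)) := by
  obtain ⟨C, hC0, hC⟩ := exists_rieszFunDeriv₂_bound (∫ ξ, ‖u ξ‖) hm hδ
  have hi := (((hu.integrable_norm_sq_fourierInv.add
    ((hv.integrable_norm_sq_fourierInv).const_mul (‖c‖ ^ 2))).add
    ((hw.integrable_norm_sq_fourierInv).const_mul (‖c'‖ ^ 2))).const_mul C)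
  refine hi.mono' ((continuous_rieszFunDeriv₂ hδ).comp (hu.continuous_fourierInv.prodMk
      ((continuous_const.mul hv.continuous_fourierInv).prodMk
      (continuous_const.mul hw.continuous_fourierInv)))).aestronglyMeasurable
    (Filter.Eventually.of_forall fun x => (hC _ _ _ (norm_fourierInv_le u x)).trans_eq ?_)
  simp only [Pi.add_apply, norm_mul, mul_pow]

theorem integral_rieszFunDeriv₂_line (hu : BddSpectrum u) (hm : 0 ≤ m) (hδ : 0 < δ) (e : E) :
    ∫ x, rieszFunDeriv₂ m δ (𝓕⁻ u x) (𝓕⁻ (derivSpectrum e u) x)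
      (𝓕⁻ (derivSpectrum e (derivSpectrum e u)) x) = 0 := by
  have h1 := integrable_rieszFunDeriv hu (hu.deriv e) hm hδ 1
  have h2 := integrable_rieszFunDeriv₂ hu (hu.deriv e) ((hu.deriv e).deriv e) hm hδ 1 1
  simp only [one_mul] at h1 h2
  refine integral_lineDeriv_eq_zero (e := e) h1 h2 fun x => ?_
  have d1 := hu.hasDerivAt_fourierInv_line e x
  have d2 := (hu.deriv e).hasDerivAt_fourierInv_line e x
  have := hasDerivAt_rieszFunDeriv (f := fun s : ℝ => 𝓕⁻ u (x + s • e))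
    (g := fun s : ℝ => 𝓕⁻ (derivSpectrum e u) (x + s • e)) (t := 0) m hδ (by simpa using d1) d2
  simpa [HasLineDerivAt] using this

theorem integral_rieszFunDeriv₂_damped_nonneg (hu : BddSpectrum u) (hm : 0 ≤ m) (hδ : 0 < δ)
    (e : E) (y : ℝ) :
    0 ≤ ∫ x, rieszFunDeriv₂ m δ (𝓕⁻ (dampedSpectrum e u y) x)
      (Complex.I * 𝓕⁻ (dampedSpectrum e (derivSpectrum e u) y) x)
      (-𝓕⁻ (dampedSpectrum e (derivSpectrum e (derivSpectrum e u)) y) x) := by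
  have hd := hu.damped e y
  have hd' := (hu.deriv e).damped e y
  have hd'' := ((hu.deriv e).deriv e).damped e y
  have h0 := integral_rieszFunDeriv₂_line hd hm hδ e
  have i1 := integrable_rieszFunDeriv₂ hd hd' hd'' hm hδ 1 1
  have i2 := integrable_rieszFunDeriv₂ hd hd' hd'' hm hδ Complex.I (-1)
  simp only [one_mul, neg_one_mul] at i1 i2
  simp only [dampedSpectrum, derivSpectrum_shiftSpectrum] at h0 i1 i2 ⊢
  have key := integral_add i1 i2
  rw [h0, zero_add] at key
  rw [← key]
  exact integral_nonneg fun x => rieszFunDeriv₂_add_nonneg hm hδ _ _ _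

theorem integrable_prod_rieszFunDeriv₂_damped (hu : BddSpectrum u)
    (h : ∀ ξ, u ξ ≠ 0 → 0 < inner ℝ e ξ) (hm : 0 ≤ m) (hδ : 0 < δ) (Y : ℝ) :
    Integrable (fun w : ℝ × E => w.1 * rieszFunDeriv₂ m δ (𝓕⁻ (dampedSpectrum e u w.1) w.2)
      (Complex.I * 𝓕⁻ (dampedSpectrum e (derivSpectrum e u) w.1) w.2)
      (-𝓕⁻ (dampedSpectrum e (derivSpectrum e (derivSpectrum e u)) w.1) w.2))
      ((volume.restrict (Set.Ioc 0 Y)).prod volume) := by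
  have hu' := hu.deriv e
  have hu'' := hu'.deriv e
  have h' : ∀ ξ, derivSpectrum e u ξ ≠ 0 → 0 < inner ℝ e ξ := fun ξ hξ =>
    h ξ fun h0 => hξ (by simp [derivSpectrum, h0])
  have h'' : ∀ ξ, derivSpectrum e (derivSpectrum e u) ξ ≠ 0 → 0 < inner ℝ e ξ := fun ξ hξ =>
    h' ξ fun h0 => hξ (by rw [derivSpectrum, h0, mul_zero])
  have hcont : Continuous (fun w : ℝ × E => w.1 * rieszFunDeriv₂ m δ
      (𝓕⁻ (dampedSpectrum e u w.1) w.2)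
      (Complex.I * 𝓕⁻ (dampedSpectrum e (derivSpectrum e u) w.1) w.2)
      (-𝓕⁻ (dampedSpectrum e (derivSpectrum e (derivSpectrum e u)) w.1) w.2)) :=
    continuous_fst.mul ((continuous_rieszFunDeriv₂ hδ).comp ((hu.continuous_damped e).prodMk
      ((continuous_const.mul (hu'.continuous_damped e)).prodMk (hu''.continuous_damped e).neg)))
  obtain ⟨C, hC0, hC⟩ := exists_rieszFunDeriv₂_bound (∫ ξ, ‖u ξ‖) hm hδ
  have hInt : ∀ y : ℝ, Integrable (fun x => rieszFunDeriv₂ m δ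
      (𝓕⁻ (dampedSpectrum e u y) x)
      (Complex.I * 𝓕⁻ (dampedSpectrum e (derivSpectrum e u) y) x)
      (-𝓕⁻ (dampedSpectrum e (derivSpectrum e (derivSpectrum e u)) y) x)) := fun y => by
    have := integrable_rieszFunDeriv₂ (hu.damped e y) (hu'.damped e y) (hu''.damped e y) hm hδ
      Complex.I (-1)
    simpa using this
  rw [integrable_prod_iff hcont.aestronglyMeasurable]
  refine ⟨Filter.Eventually.of_forall fun y => (hInt y).const_mul y, ?_⟩
  have : IsFiniteMeasure (volume.restrict (Set.Ioc 0 Y)) := ⟨by simp⟩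
  refine Integrable.of_bound (hcont.aestronglyMeasurable.norm.integral_prod_right')
    (Y * (C * ((∫ ξ, ‖u ξ‖ ^ 2) + (∫ ξ, ‖derivSpectrum e u ξ‖ ^ 2)
      + ∫ ξ, ‖derivSpectrum e (derivSpectrum e u) ξ‖ ^ 2)))
    ((ae_restrict_iff' measurableSet_Ioc).2 (Filter.Eventually.of_forall fun y hy => ?_))
  rw [Real.norm_of_nonneg (integral_nonneg fun _ => norm_nonneg _)]
  have j0 := (hu.damped e y).integrable_norm_sq_fourierInv
  have j1 := (hu'.damped e y).integrable_norm_sq_fourierInv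
  have j2 := (hu''.damped e y).integrable_norm_sq_fourierInv
  calc _ ≤ ∫ x, Y * (C * (‖𝓕⁻ (dampedSpectrum e u y) x‖ ^ 2
          + ‖𝓕⁻ (dampedSpectrum e (derivSpectrum e u) y) x‖ ^ 2
          + ‖𝓕⁻ (dampedSpectrum e (derivSpectrum e (derivSpectrum e u)) y) x‖ ^ 2)) := by
        refine integral_mono ((hInt y).const_mul y).norm
          ((((j0.add j1).add j2).const_mul C).const_mul Y) fun x => ?_
        simp only [norm_mul]
        rw [Real.norm_of_nonneg hy.1.le]
        refine mul_le_mul hy.2 ?_ (norm_nonneg _) (hy.1.le.trans hy.2)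
        have := hC _ (Complex.I * 𝓕⁻ (dampedSpectrum e (derivSpectrum e u) y) x)
          (-𝓕⁻ (dampedSpectrum e (derivSpectrum e (derivSpectrum e u)) y) x)
          (hu.norm_fourierInv_damped_le h hy.1.le x)
        simpa using this
    _ = Y * (C * ((∫ x, ‖𝓕⁻ (dampedSpectrum e u y) x‖ ^ 2)
          + (∫ x, ‖𝓕⁻ (dampedSpectrum e (derivSpectrum e u) y) x‖ ^ 2)
          + ∫ x, ‖𝓕⁻ (dampedSpectrum e (derivSpectrum e (derivSpectrum e u)) y) x‖ ^ 2)) := by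
        rw [integral_const_mul, integral_const_mul, integral_add (j0.fun_add j1) j2, integral_add j0 j1]
    _ ≤ _ := by
        refine mul_le_mul_of_nonneg_left (mul_le_mul_of_nonneg_left (add_le_add (add_le_add ?_ ?_) ?_)
          hC0) (hy.1.le.trans hy.2)
        · exact hu.integral_norm_sq_damped_le h hy.1.le
        · exact hu'.integral_norm_sq_damped_le h' hy.1.le
        · exact hu''.integral_norm_sq_damped_le h'' hy.1.le

theorem le_integral_rieszFun (hu : BddSpectrum u)
    (h : ∀ ξ, u ξ ≠ 0 → 0 < inner ℝ e ξ) (hm : 0 ≤ m) (hδ : 0 < δ) {Y : ℝ} (hY : 0 ≤ Y) :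
    (∫ x, rieszFun m δ (𝓕⁻ (dampedSpectrum e u Y) x))
      - Y * ∫ x, rieszFunDeriv m δ (𝓕⁻ (dampedSpectrum e u Y) x)
        (Complex.I * 𝓕⁻ (dampedSpectrum e (derivSpectrum e u) Y) x)
      ≤ ∫ x, rieszFun m δ (𝓕⁻ u x) := by
  have hu' := hu.deriv e
  have hu'' := hu'.deriv e
  have hprod := integrable_prod_rieszFunDeriv₂_damped hu h hm hδ Y
  have hftc : ∀ x, ∫ y in Set.Ioc 0 Y, y * rieszFunDeriv₂ m δ (𝓕⁻ (dampedSpectrum e u y) x)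
      (Complex.I * 𝓕⁻ (dampedSpectrum e (derivSpectrum e u) y) x)
      (-𝓕⁻ (dampedSpectrum e (derivSpectrum e (derivSpectrum e u)) y) x)
      = Y * rieszFunDeriv m δ (𝓕⁻ (dampedSpectrum e u Y) x)
        (Complex.I * 𝓕⁻ (dampedSpectrum e (derivSpectrum e u) Y) x)
        - rieszFun m δ (𝓕⁻ (dampedSpectrum e u Y) x) + rieszFun m δ (𝓕⁻ u x) := by
    intro x
    have hx : Continuous (fun y : ℝ => ((y, x) : ℝ × E)) := by fun_prop
    have hcont : Continuous (fun y : ℝ => y * rieszFunDeriv₂ m δ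
        (𝓕⁻ (dampedSpectrum e u y) x)
        (Complex.I * 𝓕⁻ (dampedSpectrum e (derivSpectrum e u) y) x)
        (-𝓕⁻ (dampedSpectrum e (derivSpectrum e (derivSpectrum e u)) y) x)) :=
      continuous_id.mul ((continuous_rieszFunDeriv₂ hδ).comp
        (((hu.continuous_damped e).comp hx).prodMk
          ((continuous_const.mul ((hu'.continuous_damped e).comp hx)).prodMk
            ((hu''.continuous_damped e).comp hx).neg)))
    rw [← intervalIntegral.integral_of_le hY]
    rw [intervalIntegral.integral_eq_sub_of_hasDerivAt (f := fun y =>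
      y * rieszFunDeriv m δ (𝓕⁻ (dampedSpectrum e u y) x)
        (Complex.I * 𝓕⁻ (dampedSpectrum e (derivSpectrum e u) y) x)
        - rieszFun m δ (𝓕⁻ (dampedSpectrum e u y) x)) (fun y _ => ?_)
      (hcont.intervalIntegrable _ _)]
    · simp [dampedSpectrum, shiftSpectrum_zero]
    · have d1 := hu.hasDerivAt_damped e x y
      have d2 := (hu'.hasDerivAt_damped e x y).const_mul Complex.I
      have r1 := hasDerivAt_rieszFun m hδ d1
      have r2 := hasDerivAt_rieszFunDeriv m hδ (g := fun y : ℝ =>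
        Complex.I * 𝓕⁻ (dampedSpectrum e (derivSpectrum e u) y) x) d1 d2
      rw [← mul_assoc, Complex.I_mul_I, neg_one_mul] at r2
      convert! ((hasDerivAt_id y).mul r2).sub r1 using 1
      simp
  have i1 := (integrable_rieszFunDeriv (hu.damped e Y) (hu'.damped e Y) hm hδ
    Complex.I).const_mul Y
  have i2 := (hu.damped e Y).integrable_rieszFun hm hδ
  have i3 := hu.integrable_rieszFun hm hδ
  have hsw := integral_integral_swap (f := fun (y : ℝ) (x : E) => y * rieszFunDeriv₂ m δ
    (𝓕⁻ (dampedSpectrum e u y) x) (Complex.I * 𝓕⁻ (dampedSpectrum e (derivSpectrum e u) y) x)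
      (-𝓕⁻ (dampedSpectrum e (derivSpectrum e (derivSpectrum e u)) y) x)) hprod
  have hpos : 0 ≤ ∫ y in Set.Ioc 0 Y, ∫ x, y * rieszFunDeriv₂ m δ
      (𝓕⁻ (dampedSpectrum e u y) x) (Complex.I * 𝓕⁻ (dampedSpectrum e (derivSpectrum e u) y) x)
      (-𝓕⁻ (dampedSpectrum e (derivSpectrum e (derivSpectrum e u)) y) x) := by
    refine setIntegral_nonneg measurableSet_Ioc fun y hy => ?_
    rw [integral_const_mul]
    exact mul_nonneg hy.1.le (integral_rieszFunDeriv₂_damped_nonneg hu hm hδ e y)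
  rw [hsw] at hpos
  simp_rw [hftc] at hpos
  have i12 := i1.sub i2
  rw [Pi.sub_def] at i12
  rw [integral_add i12 i3, integral_sub i1 i2, integral_const_mul] at hpos
  linarith

/-- M. Riesz's positivity: the Riesz function of a function with spectrum in an open half
space has nonnegative integral. -/
theorem integral_rieszFun_nonneg (hu : BddSpectrum u)
    (h : ∀ ξ, u ξ ≠ 0 → 0 < inner ℝ e ξ) (hm : 0 ≤ m) (hδ : 0 < δ) :
    0 ≤ ∫ x, rieszFun m δ (𝓕⁻ u x) := by
  have hu' := hu.deriv e
  obtain ⟨C, hC0, hC⟩ := exists_rieszFun_bound (∫ ξ, ‖u ξ‖) hm hδ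
  obtain ⟨C', hC0', hC'⟩ := exists_rieszFunDeriv_bound (∫ ξ, ‖u ξ‖) hm hδ
  have hlim := ((hu.tendsto_integral_norm_sq_damped h).const_mul (-(C + C'))).add
    ((hu.tendsto_sq_mul_integral_norm_sq_damped h).const_mul (-C'))
  rw [mul_zero, mul_zero, add_zero] at hlim
  refine le_of_tendsto hlim ?_
  filter_upwards [Filter.eventually_ge_atTop 0] with Y hY
  refine le_trans ?_ (le_integral_rieszFun hu h hm hδ hY)
  have j0 := (hu.damped e Y).integrable_norm_sq_fourierInv
  have j1 := (hu'.damped e Y).integrable_norm_sq_fourierInv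
  rw [← integral_const_mul, ← integral_const_mul, ← integral_const_mul, ← integral_const_mul,
    ← integral_add (j0.const_mul _) ((j1.const_mul _).const_mul _),
    ← integral_sub ((hu.damped e Y).integrable_rieszFun hm hδ)
      ((integrable_rieszFunDeriv (hu.damped e Y) (hu'.damped e Y) hm hδ _).const_mul Y)]
  refine integral_mono ((j0.const_mul _).add ((j1.const_mul _).const_mul _))
    (((hu.damped e Y).integrable_rieszFun hm hδ).sub
      ((integrable_rieszFunDeriv (hu.damped e Y) (hu'.damped e Y) hm hδ _).const_mul Y))
    fun x => ?_
  have b0 := hu.norm_fourierInv_damped_le h hY x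
  have b1 := neg_le_of_abs_le (hC _ b0)
  have b2 := le_of_abs_le (hC' _ (Complex.I * 𝓕⁻ (dampedSpectrum e (derivSpectrum e u) Y) x) b0)
  rw [norm_mul, Complex.norm_I, one_mul] at b2
  have b3 := mul_le_mul_of_nonneg_left b2 hY
  set α := ‖𝓕⁻ (dampedSpectrum e u Y) x‖
  set β := ‖𝓕⁻ (dampedSpectrum e (derivSpectrum e u) Y) x‖
  have b4 : Y * (C' * (α * β)) ≤ C' * (α ^ 2 + Y ^ 2 * β ^ 2) := by
    have : α * (Y * β) ≤ α ^ 2 + Y ^ 2 * β ^ 2 := by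
      nlinarith [sq_nonneg (α - Y * β), sq_nonneg α, sq_nonneg (Y * β)]
    calc _ = C' * (α * (Y * β)) := by ring
      _ ≤ _ := mul_le_mul_of_nonneg_left this hC0'
  linarith

end RieszIntegral

section HalfSpaceProjection

variable {E : Type*} [NormedAddCommGroup E] [InnerProductSpace ℝ E] [FiniteDimensional ℝ E]
  [MeasurableSpace E] [BorelSpace E] {e : E} {u : E → ℂ} {m : ℝ}

theorem rieszFun_le {δ : ℝ} (hm : 0 ≤ m) (hδ : 0 < δ) (z : ℂ) :
    rieszFun m δ z ≤ 2 * (m + 1) ^ 2 * ((‖z‖ ^ 2 + δ) ^ m * z.re ^ 2) - ‖z‖ ^ (2 * m + 2) := by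
  have h1 : ‖z‖ ^ (2 * m + 2) = (‖z‖ ^ 2) ^ (m + 1) := by
    rw [← Real.rpow_natCast ‖z‖ 2, ← Real.rpow_mul (norm_nonneg z)]
    congr 1; push_cast; ring
  have h2 := Real.add_rpow_le_rpow_add (sq_nonneg ‖z‖) hδ.le (show 1 ≤ m + 1 by linarith)
  rw [rieszFun, re_sq_add_im_sq, h1]
  linarith

theorem eLpNorm_le_of_enorm_le_of_le {h : E → ℂ} {M : ℝ≥0∞} (hM : M ≠ ∞)
    (hb : ∀ x, ‖h x‖ₑ ≤ M) {r q : ℝ} (hr : 0 < r) (hrq : r ≤ q) :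
    eLpNorm h (ENNReal.ofReal q) volume
      ≤ M ^ (1 - r / q) * eLpNorm h (ENNReal.ofReal r) volume ^ (r / q) := by
  have hq : 0 < q := hr.trans_le hrq
  rw [eLpNorm_eq_lintegral_rpow_enorm_toReal (by simpa using hq) ENNReal.ofReal_ne_top,
    eLpNorm_eq_lintegral_rpow_enorm_toReal (by simpa using hr) ENNReal.ofReal_ne_top,
    ENNReal.toReal_ofReal hq.le, ENNReal.toReal_ofReal hr.le, ← ENNReal.rpow_mul,
    show 1 / r * (r / q) = 1 / q by field_simp, show 1 - r / q = (q - r) * (1 / q) by field_simp,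
    ENNReal.rpow_mul, ← ENNReal.mul_rpow_of_nonneg _ _ (by positivity)]
  refine ENNReal.rpow_le_rpow ?_ (by positivity)
  rw [← lintegral_const_mul' _ _ (ENNReal.rpow_ne_top_of_nonneg (by linarith) hM)]
  refine lintegral_mono fun x => ?_
  calc ‖h x‖ₑ ^ q = ‖h x‖ₑ ^ (q - r) * ‖h x‖ₑ ^ r := by
        rw [← ENNReal.rpow_add_of_nonneg _ _ (by linarith) hr.le]; ring_nf
    _ ≤ _ := mul_le_mul_left (ENNReal.rpow_le_rpow (hb x) (by linarith)) _

theorem BddSpectrum.memLp_fourierInv (hu : BddSpectrum u) {q : ℝ} (hq : 2 ≤ q) :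
    MemLp (𝓕⁻ u) (ENNReal.ofReal q) volume := by
  refine ⟨hu.continuous_fourierInv.aestronglyMeasurable, ?_⟩
  have hb : ∀ x, ‖𝓕⁻ u x‖ₑ ≤ ENNReal.ofReal (∫ ξ, ‖u ξ‖) := fun x => by
    rw [← ofReal_norm]; exact ENNReal.ofReal_le_ofReal (norm_fourierInv_le u x)
  refine (eLpNorm_le_of_enorm_le_of_le ENNReal.ofReal_ne_top hb two_pos hq).trans_lt ?_
  have h2 := hu.memLp_two_fourierInv.2.ne
  rw [ENNReal.ofReal_ofNat]
  have h0 : 0 ≤ 1 - 2 / q := by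
    rw [sub_nonneg, div_le_one (by linarith)]; exact hq
  exact ENNReal.mul_lt_top (ENNReal.rpow_lt_top_of_nonneg h0 ENNReal.ofReal_ne_top)
    (ENNReal.rpow_lt_top_of_nonneg (by positivity) h2)

theorem integral_norm_rpow_le_of_half_space (hu : BddSpectrum u)
    (h : ∀ ξ, u ξ ≠ 0 → 0 < inner ℝ e ξ) (hm : 0 ≤ m)
    (hInt : Integrable fun x => ‖𝓕⁻ u x‖ ^ (2 * m + 2)) :
    ∫ x, ‖𝓕⁻ u x‖ ^ (2 * m + 2)
      ≤ 2 * (m + 1) ^ 2 * ∫ x, (‖𝓕⁻ u x‖ ^ 2) ^ m * (𝓕⁻ u x).re ^ 2 := by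
  set K := ∫ ξ, ‖u ξ‖ with hK
  have hF := hu.continuous_fourierInv
  have hcont : ∀ δ : ℝ, Continuous fun x => (‖𝓕⁻ u x‖ ^ 2 + δ) ^ m * (𝓕⁻ u x).re ^ 2 := fun δ =>
    (Continuous.rpow_const (by fun_prop) fun _ => Or.inr hm).mul (by fun_prop)
  have hb : ∀ δ : ℝ, 0 ≤ δ → δ ≤ 1 → ∀ x, ‖(‖𝓕⁻ u x‖ ^ 2 + δ) ^ m * (𝓕⁻ u x).re ^ 2‖
      ≤ (K ^ 2 + 1) ^ m * ‖𝓕⁻ u x‖ ^ 2 := by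
    intro δ h0 h1 x
    rw [Real.norm_of_nonneg (by positivity)]
    refine mul_le_mul (Real.rpow_le_rpow (by positivity) (add_le_add
      (pow_le_pow_left₀ (norm_nonneg _) (norm_fourierInv_le u x) 2) h1) hm)
      (re_sq_le_norm_sq _) (by positivity) (by positivity)
  have hdom := hu.integrable_norm_sq_fourierInv.const_mul ((K ^ 2 + 1) ^ m)
  have hi : ∀ δ : ℝ, 0 ≤ δ → δ ≤ 1 →
      Integrable fun x => (‖𝓕⁻ u x‖ ^ 2 + δ) ^ m * (𝓕⁻ u x).re ^ 2 := fun δ h0 h1 =>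
    hdom.mono' (hcont δ).aestronglyMeasurable (Filter.Eventually.of_forall (hb δ h0 h1))
  have hδ0 : ∀ n : ℕ, (0 : ℝ) < 1 / (n + 1) := fun n => Nat.one_div_pos_of_nat
  have hδ1 : ∀ n : ℕ, (1 : ℝ) / (n + 1) ≤ 1 := fun n => by
    rw [div_le_one (by positivity)]; linarith [Nat.cast_nonneg (α := ℝ) n]
  have hlim : Filter.Tendsto (fun n : ℕ => 2 * (m + 1) ^ 2 *
      ∫ x, (‖𝓕⁻ u x‖ ^ 2 + 1 / ((n : ℝ) + 1)) ^ m * (𝓕⁻ u x).re ^ 2) Filter.atTop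
      (nhds (2 * (m + 1) ^ 2 * ∫ x, (‖𝓕⁻ u x‖ ^ 2) ^ m * (𝓕⁻ u x).re ^ 2)) := by
    refine Filter.Tendsto.const_mul _ ?_
    refine tendsto_integral_of_dominated_convergence _
      (fun n => (hcont _).aestronglyMeasurable) hdom
      (fun n => Filter.Eventually.of_forall (hb _ (hδ0 n).le (hδ1 n)))
      (Filter.Eventually.of_forall fun x => ?_)
    have h1 := (tendsto_one_div_add_atTop_nhds_zero_nat (𝕜 := ℝ)).const_add (‖𝓕⁻ u x‖ ^ 2)
    rw [add_zero] at h1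
    exact (h1.rpow_const (Or.inr hm)).mul_const _
  refine ge_of_tendsto' hlim fun n => ?_
  have hr := integral_rieszFun_nonneg hu h hm (hδ0 n)
  have hi' := (hi _ (hδ0 n).le (hδ1 n)).const_mul (2 * (m + 1) ^ 2)
  have := hr.trans (integral_mono (hu.integrable_rieszFun hm (hδ0 n)) (hi'.sub hInt)
    fun x => rieszFun_le hm (hδ0 n) (𝓕⁻ u x))
  simp only [Pi.sub_apply] at this
  rw [integral_sub hi' hInt, integral_const_mul] at this
  linarith

theorem rpow_mul_re_sq_le (hm : 0 ≤ m) {l : ℝ} (hl : 0 < l) (z : ℂ) :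
    l * ((‖z‖ ^ 2) ^ m * z.re ^ 2)
      ≤ 1 / 2 * ‖z‖ ^ (2 * m + 2) + l * (2 * l) ^ m * |z.re| ^ (2 * m + 2) := by
  have e1 : ∀ t : ℝ, 0 ≤ t → t ^ (2 * m + 2) = (t ^ 2) ^ m * t ^ 2 := fun t ht => by
    rw [Real.rpow_add' ht (by positivity), Real.rpow_mul ht]
    norm_num
  rw [e1 _ (norm_nonneg z), e1 _ (abs_nonneg _), sq_abs]
  have hz := re_sq_le_norm_sq z
  have hw := sq_nonneg z.re
  generalize z.re ^ 2 = w at *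
  generalize ‖z‖ ^ 2 = t at *
  have ht : 0 ≤ t := hw.trans hz
  rcases le_total (2 * l * w) t with h | h
  · have : t ^ m * (2 * l * w) ≤ t ^ m * t := mul_le_mul_of_nonneg_left h (by positivity)
    have h2 : 0 ≤ l * (2 * l) ^ m * (w ^ m * w) := by positivity
    linarith
  · have : t ^ m ≤ (2 * l) ^ m * w ^ m := by
      rw [← Real.mul_rpow (by positivity) hw]
      exact Real.rpow_le_rpow ht h hm
    have h2 := mul_le_mul_of_nonneg_left (mul_le_mul_of_nonneg_right this hw) hl.le
    have h3 : 0 ≤ 1 / 2 * (t ^ m * t) := by positivity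
    linarith

theorem eLpNorm_fourierInv_le_eLpNorm_re (hm : 0 ≤ m) : ∃ C : ℝ≥0, ∀ (e : E) (u : E → ℂ),
    BddSpectrum u → (∀ ξ, u ξ ≠ 0 → 0 < inner ℝ e ξ) →
    eLpNorm (𝓕⁻ u) (ENNReal.ofReal (2 * m + 2)) volume
      ≤ C * eLpNorm (fun x => (𝓕⁻ u x).re) (ENNReal.ofReal (2 * m + 2)) volume := by
  set l : ℝ := 2 * (m + 1) ^ 2 with hl
  have hl0 : 0 < l := by positivity
  set D : ℝ := 2 * (l * (2 * l) ^ m) with hD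
  have hD0 : 0 ≤ D := by positivity
  refine ⟨(D ^ (2 * m + 2)⁻¹).toNNReal, fun e u hu h => ?_⟩
  have hp : 2 ≤ ENNReal.ofReal (2 * m + 2) := by
    rw [← ENNReal.ofReal_ofNat]; exact ENNReal.ofReal_le_ofReal (by linarith)
  have hF := hu.memLp_fourierInv (show 2 ≤ 2 * m + 2 by linarith)
  have hR : MemLp (fun x => (𝓕⁻ u x).re) (ENNReal.ofReal (2 * m + 2)) volume := hF.re
  have hp0 : ENNReal.ofReal (2 * m + 2) ≠ 0 := (two_pos.trans_le hp).ne'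
  have hpt : (ENNReal.ofReal (2 * m + 2)).toReal = 2 * m + 2 :=
    ENNReal.toReal_ofReal (by positivity)
  have iF := hF.integrable_norm_rpow hp0 ENNReal.ofReal_ne_top
  have iR := hR.integrable_norm_rpow hp0 ENNReal.ofReal_ne_top
  rw [hF.eLpNorm_eq_integral_rpow_norm hp0 ENNReal.ofReal_ne_top,
    hR.eLpNorm_eq_integral_rpow_norm hp0 ENNReal.ofReal_ne_top]
  rw [hpt] at iF iR ⊢
  have h1 := integral_norm_rpow_le_of_half_space hu h hm iF
  have h2 : l * ∫ x, (‖𝓕⁻ u x‖ ^ 2) ^ m * (𝓕⁻ u x).re ^ 2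
      ≤ 1 / 2 * (∫ x, ‖𝓕⁻ u x‖ ^ (2 * m + 2))
        + l * (2 * l) ^ m * ∫ x, ‖(𝓕⁻ u x).re‖ ^ (2 * m + 2) := by
    rw [← integral_const_mul, ← integral_const_mul, ← integral_const_mul,
      ← integral_add (iF.const_mul _) (iR.const_mul _)]
    refine integral_mono_of_nonneg (Filter.Eventually.of_forall fun x => ?_)
      ((iF.const_mul _).add (iR.const_mul _)) (Filter.Eventually.of_forall fun x => ?_)
    · simp only [Pi.zero_apply]; positivity
    · exact rpow_mul_re_sq_le hm hl0 _
  have h3 : ∫ x, ‖𝓕⁻ u x‖ ^ (2 * m + 2) ≤ D * ∫ x, ‖(𝓕⁻ u x).re‖ ^ (2 * m + 2) := by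
    have := h1.trans h2
    rw [hD]; linarith
  change ENNReal.ofReal _ ≤ ENNReal.ofReal _ * _
  rw [← ENNReal.ofReal_mul (by positivity), ← Real.mul_rpow hD0 (by positivity)]
  exact ENNReal.ofReal_le_ofReal (Real.rpow_le_rpow (integral_nonneg fun _ => by positivity) h3
    (by positivity))

end HalfSpaceProjection

section HalfSpaceProjectionBound

theorem measurableSet_lt_inner {E : Type*} [NormedAddCommGroup E] [InnerProductSpace ℝ E]
    [MeasurableSpace E] [BorelSpace E] (e : E) (t : ℝ) : MeasurableSet {ξ : E | t < inner ℝ e ξ} :=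
  (isOpen_lt continuous_const (by fun_prop)).measurableSet

variable {E : Type*} [NormedAddCommGroup E] [InnerProductSpace ℝ E] [FiniteDimensional ℝ E]
  [MeasurableSpace E] [BorelSpace E] {u v : E → ℂ}

theorem fourierInv_conj_neg (u : E → ℂ) (x : E) :
    𝓕⁻ (fun ξ => starRingEnd ℂ (u (-ξ))) x = starRingEnd ℂ (𝓕⁻ u x) := by
  rw [Real.fourierInv_eq, Real.fourierInv_eq, ← integral_conj, ← integral_neg_eq_self]
  refine integral_congr_ae (Filter.Eventually.of_forall fun ξ => ?_)
  simp [Circle.smul_def, AddChar.map_neg_eq_inv, ← Circle.coe_inv_eq_conj]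

theorem fourierInv_fun_add (hu : Integrable u) (hv : Integrable v) (x : E) :
    𝓕⁻ (fun ξ => u ξ + v ξ) x = 𝓕⁻ u x + 𝓕⁻ v x := by
  have h := fun w : E → ℂ => fun hw : Integrable w =>
    (Real.fourierIntegral_convergent_iff (f := w) (-x)).2 hw
  simp only [inner_neg_right, neg_neg] at h
  simp only [Real.fourierInv_eq, smul_add]
  exact integral_add (h u hu) (h v hv)

theorem fourierInv_fun_const_mul (c : ℂ) (u : E → ℂ) (x : E) :
    𝓕⁻ (fun ξ => c * u ξ) x = c * 𝓕⁻ u x := by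
  rw [Real.fourierInv_eq, Real.fourierInv_eq, ← integral_const_mul]
  refine integral_congr_ae (Filter.Eventually.of_forall fun ξ => ?_)
  simp only [Circle.smul_def, smul_eq_mul]; ring

theorem norm_fourierInv_comp_add (u : E → ℂ) (w x : E) :
    ‖𝓕⁻ (fun ξ => u (ξ + w)) x‖ = ‖𝓕⁻ u x‖ := by
  have h : 𝓕⁻ u x = 𝐞 (inner ℝ w x) • 𝓕⁻ (fun ξ => u (ξ + w)) x := by
    rw [Real.fourierInv_eq, Real.fourierInv_eq, ← integral_add_right_eq_self _ w,
      Circle.smul_def, ← integral_smul]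
    refine integral_congr_ae (Filter.Eventually.of_forall fun ξ => ?_)
    simp only [inner_add_left, AddChar.map_add_eq_mul, Circle.smul_def, smul_eq_mul, Circle.coe_mul]
    ring
  rw [h, Circle.norm_smul]

theorem volume_inner_eq_zero {e : E} (he : e ≠ 0) : volume {ξ : E | inner ℝ e ξ = 0} = 0 := by
  have := Measure.addHaar_submodule (volume : Measure E) (LinearMap.ker (innerₗ E e)) fun h => he ?_
  · convert this using 2
    ext ξ; simp
  · have h1 : e ∈ LinearMap.ker (innerₗ E e) := h ▸ Submodule.mem_top
    simpa using h1

theorem re_fourierInv_indicator_half_space {e : E} (he : e ≠ 0) (hu : BddSpectrum u) (x : E) :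
    (𝓕⁻ ({ξ | 0 < inner ℝ e ξ}.indicator fun ξ => u ξ + starRingEnd ℂ (u (-ξ))) x).re
      = (𝓕⁻ u x).re := by
  set H := {ξ : E | 0 < inner ℝ e ξ} with hH
  set w : E → ℂ := fun ξ => u ξ + starRingEnd ℂ (u (-ξ)) with hw
  have hwb : BddSpectrum w := hu.add hu.conj_neg
  have hvb := hwb.indicator (measurableSet_lt_inner e 0)
  have h1 : 𝓕⁻ w x = 𝓕⁻ u x + starRingEnd ℂ (𝓕⁻ u x) := by
    rw [hw, fourierInv_fun_add hu.integrable hu.conj_neg.integrable, fourierInv_conj_neg]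
  have h2 : 𝓕⁻ w x = 𝓕⁻ (H.indicator w) x + starRingEnd ℂ (𝓕⁻ (H.indicator w) x) := by
    rw [← fourierInv_conj_neg, ← fourierInv_fun_add hvb.integrable hvb.conj_neg.integrable,
      Real.fourierInv_eq, Real.fourierInv_eq]
    refine integral_congr_ae ?_
    have h0 : ∀ᵐ ξ : E, inner ℝ e ξ ≠ 0 := by
      rw [ae_iff]; simpa using volume_inner_eq_zero he
    filter_upwards [h0] with ξ hξ
    congr 1
    rcases lt_or_gt_of_ne hξ with h | h
    · have a1 : ξ ∉ H := by simp [hH, h.le]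
      have a2 : -ξ ∈ H := by simp [hH, h]
      rw [Set.indicator_of_notMem a1, Set.indicator_of_mem a2]
      simp [hw, add_comm]
    · have a1 : ξ ∈ H := by simp [hH, h]
      have a2 : -ξ ∉ H := by simp [hH, h.le]
      rw [Set.indicator_of_mem a1, Set.indicator_of_notMem a2]
      simp
  rw [h1] at h2
  have := congrArg Complex.re h2
  simp only [Complex.add_re, Complex.conj_re] at this
  linarith

theorem exists_eLpNorm_fourierInv_half_space_le {P : ℝ} (hP : 2 ≤ P) :
    ∃ C : ℝ≥0, 1 ≤ C ∧ ∀ (e : E) (t : ℝ) (u : E → ℂ), BddSpectrum u →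
      eLpNorm (𝓕⁻ ({ξ | t < inner ℝ e ξ}.indicator u)) (ENNReal.ofReal P) volume
        ≤ C * eLpNorm (𝓕⁻ u) (ENNReal.ofReal P) volume := by
  obtain ⟨C, hC⟩ := eLpNorm_fourierInv_le_eLpNorm_re (E := E) (m := (P - 2) / 2) (by linarith)
  rw [show 2 * ((P - 2) / 2) + 2 = P by ring] at hC
  have hP1 : 1 ≤ ENNReal.ofReal P := by simpa using (by linarith : 1 ≤ P)
  have key : ∀ (e : E) (u : E → ℂ), e ≠ 0 → BddSpectrum u →
      eLpNorm (𝓕⁻ ({ξ | 0 < inner ℝ e ξ}.indicator fun ξ => u ξ + starRingEnd ℂ (u (-ξ))))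
        (ENNReal.ofReal P) volume ≤ C * eLpNorm (𝓕⁻ u) (ENNReal.ofReal P) volume := by
    intro e u he hu
    refine (hC e _ ((hu.add hu.conj_neg).indicator (measurableSet_lt_inner e 0)) ?_).trans ?_
    · intro ξ hξ
      exact (Set.mem_of_indicator_ne_zero hξ : ξ ∈ {ξ : E | 0 < inner ℝ e ξ})
    · simp only [re_fourierInv_indicator_half_space he hu]
      gcongr
      exact eLpNorm_mono fun x => Complex.abs_re_le_norm _
  have zero : ∀ (e : E) (u : E → ℂ), e ≠ 0 → BddSpectrum u →
      eLpNorm (𝓕⁻ ({ξ | 0 < inner ℝ e ξ}.indicator u)) (ENNReal.ofReal P) volume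
        ≤ C * eLpNorm (𝓕⁻ u) (ENNReal.ofReal P) volume := by
    intro e u he hu
    have hw := hu.const_mul (-Complex.I)
    have k1 := key e u he hu
    have k2 := key e _ he hw
    have n2 : eLpNorm (𝓕⁻ fun ξ => -Complex.I * u ξ) (ENNReal.ofReal P) volume
        = eLpNorm (𝓕⁻ u) (ENNReal.ofReal P) volume :=
      eLpNorm_congr_norm_ae (Filter.Eventually.of_forall fun x => by
        rw [fourierInv_fun_const_mul]; simp)
    rw [n2] at k2
    have b1 := (hu.add hu.conj_neg).indicator (measurableSet_lt_inner e 0)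
    have b2 := (hw.add hw.conj_neg).indicator (measurableSet_lt_inner e 0)
    set H := {ξ : E | 0 < inner ℝ e ξ}
    set v₁ := H.indicator fun ξ => u ξ + starRingEnd ℂ (u (-ξ)) with hv₁
    set v₂ := H.indicator fun ξ => -Complex.I * u ξ + starRingEnd ℂ (-Complex.I * u (-ξ)) with hv₂
    have hsplit : H.indicator u = fun ξ => (1 / 2 : ℂ) * (v₁ ξ + Complex.I * v₂ ξ) := by
      ext ξ
      by_cases h : ξ ∈ H
      · simp only [hv₁, hv₂, Set.indicator_of_mem h, map_mul, map_neg, Complex.conj_I]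
        linear_combination (1 / 2 * (u ξ - starRingEnd ℂ (u (-ξ)))) * Complex.I_mul_I
      · simp [hv₁, hv₂, Set.indicator_of_notMem h]
    have hsum : 𝓕⁻ (H.indicator u)
        = (1 / 2 : ℂ) • (𝓕⁻ v₁ + Complex.I • 𝓕⁻ v₂) := by
      ext x
      rw [hsplit, fourierInv_fun_const_mul, fourierInv_fun_add b1.integrable
        (b2.const_mul Complex.I).integrable, fourierInv_fun_const_mul]
      rfl
    rw [hsum, eLpNorm_const_smul]
    have htri := eLpNorm_add_le (μ := volume) (p := ENNReal.ofReal P)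
      b1.continuous_fourierInv.aestronglyMeasurable
      (b2.continuous_fourierInv.aestronglyMeasurable.const_smul Complex.I) hP1
    rw [eLpNorm_const_smul] at htri
    have hI : ‖Complex.I‖ₑ = 1 := by rw [← ofReal_norm]; simp
    have hh : ‖(1 / 2 : ℂ)‖ₑ = 2⁻¹ := by
      rw [← ofReal_norm, norm_div, norm_one, Complex.norm_ofNat, one_div,
        ENNReal.ofReal_inv_of_pos two_pos, ENNReal.ofReal_ofNat]
    rw [hI, one_mul] at htri
    rw [hh]
    calc _ ≤ 2⁻¹ * (C * eLpNorm (𝓕⁻ u) (ENNReal.ofReal P) volume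
          + C * eLpNorm (𝓕⁻ u) (ENNReal.ofReal P) volume) :=
        mul_le_mul_right (htri.trans (add_le_add k1 k2)) _
      _ = _ := by
        rw [← two_mul, ← mul_assoc, ENNReal.inv_mul_cancel two_ne_zero ENNReal.ofNat_ne_top, one_mul]
  refine ⟨max 1 C, le_max_left _ _, fun e t u hu => ?_⟩
  rcases eq_or_ne e 0 with rfl | he
  · have hone : eLpNorm (𝓕⁻ u) (ENNReal.ofReal P) volume
        ≤ ((max 1 C : ℝ≥0) : ℝ≥0∞) * eLpNorm (𝓕⁻ u) (ENNReal.ofReal P) volume :=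
      le_mul_of_one_le_left zero_le (by exact_mod_cast le_max_left 1 C)
    by_cases ht : t < 0
    · simpa [ht] using hone
    · have h0 : 𝓕⁻ (fun _ : E => (0 : ℂ)) = 0 := by
        ext x; simp [Real.fourierInv_eq]
      simp [ht, h0]
  · set w : E := (t / ‖e‖ ^ 2) • e with hw
    have hin : ∀ ξ, inner ℝ e (ξ + w) = inner ℝ e ξ + t := fun ξ => by
      have : ‖e‖ ≠ 0 := norm_ne_zero_iff.2 he
      rw [inner_add_right, hw, inner_smul_right, real_inner_self_eq_norm_sq]
      field_simp
    have e1 : eLpNorm (𝓕⁻ ({ξ | t < inner ℝ e ξ}.indicator u)) (ENNReal.ofReal P) volume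
        = eLpNorm (𝓕⁻ ({ξ | 0 < inner ℝ e ξ}.indicator fun ξ => u (ξ + w)))
          (ENNReal.ofReal P) volume := by
      refine eLpNorm_congr_norm_ae (Filter.Eventually.of_forall fun x => ?_)
      rw [← norm_fourierInv_comp_add _ w]
      have hs : (fun ξ => {ξ | t < inner ℝ e ξ}.indicator u (ξ + w))
          = {ξ | 0 < inner ℝ e ξ}.indicator fun ξ => u (ξ + w) := by
        ext ξ
        simp [Set.indicator, hin]
      rw [hs]
    have e2 : eLpNorm (𝓕⁻ fun ξ => u (ξ + w)) (ENNReal.ofReal P) volume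
        = eLpNorm (𝓕⁻ u) (ENNReal.ofReal P) volume :=
      eLpNorm_congr_norm_ae (Filter.Eventually.of_forall fun x => norm_fourierInv_comp_add u w x)
    rw [e1, ← e2]
    refine (zero e _ he (hu.comp_add w)).trans (mul_le_mul_left ?_ _)
    exact_mod_cast le_max_right 1 C

end HalfSpaceProjectionBound

section BilinearMultiplier

/-- The sum of the indicators of the two regions of opposite signs in the layer-cake
representation of `exp (|a + b| - |a| - |b|)`. -/
def signLayer (a b θ : ℝ) : ℝ :=
  (if -Real.log θ < 2 * a ∧ -Real.log θ < -(2 * b) then 1 else 0)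
    + (if -Real.log θ < -(2 * a) ∧ -Real.log θ < 2 * b then 1 else 0)

theorem measurableSet_layer (c₁ c₂ : ℝ) :
    MeasurableSet {θ : ℝ | -Real.log θ < c₁ ∧ -Real.log θ < c₂} :=
  (measurableSet_lt Real.measurable_log.neg measurable_const).inter
    (measurableSet_lt Real.measurable_log.neg measurable_const)

theorem integral_layer {c₁ c₂ : ℝ} :
    ∫ θ in Set.Ioo (0 : ℝ) 1, (if -Real.log θ < c₁ ∧ -Real.log θ < c₂ then (1 : ℝ) else 0)
      = 1 - Real.exp (-(max (min c₁ c₂) 0)) := by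
  have h1 : Real.exp (-(max (min c₁ c₂) 0)) ≤ 1 := Real.exp_le_one_iff.2 (by simp)
  have hs : Set.Ioo (0 : ℝ) 1 ∩ {θ | -Real.log θ < c₁ ∧ -Real.log θ < c₂}
      = Set.Ioo (Real.exp (-(max (min c₁ c₂) 0))) 1 := by
    ext θ
    simp only [Set.mem_inter_iff, Set.mem_Ioo, Set.mem_ofPred_eq]
    constructor
    · rintro ⟨⟨h0, h1⟩, h⟩
      refine ⟨(Real.lt_log_iff_exp_lt h0).1 ?_, h1⟩
      have := Real.log_neg h0 h1
      rw [neg_lt]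
      exact (lt_min h.1 h.2).trans_le (le_max_left _ _)
    · rintro ⟨h0, h1⟩
      have hθ : 0 < θ := (Real.exp_pos _).trans h0
      have h2 := (Real.lt_log_iff_exp_lt hθ).2 h0
      have h3 := Real.log_neg hθ h1
      refine ⟨⟨hθ, h1⟩, ?_⟩
      rw [neg_lt, lt_max_iff, lt_min_iff] at h2
      rcases h2 with h2 | h2
      · exact h2
      · linarith
  have hind : (fun θ : ℝ => if -Real.log θ < c₁ ∧ -Real.log θ < c₂ then (1 : ℝ) else 0)
      = {θ : ℝ | -Real.log θ < c₁ ∧ -Real.log θ < c₂}.indicator fun _ => 1 := by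
    ext θ; simp [Set.indicator]
  rw [hind, setIntegral_indicator (measurableSet_layer c₁ c₂), hs]
  simp [h1]

theorem exp_abs_add_sub_eq (a b : ℝ) :
    Real.exp (|a + b| - |a| - |b|) = 1 - ∫ θ in Set.Ioo (0 : ℝ) 1, signLayer a b θ := by
  have hi : ∀ c₁ c₂ : ℝ, IntegrableOn
      (fun θ : ℝ => if -Real.log θ < c₁ ∧ -Real.log θ < c₂ then (1 : ℝ) else 0)
      (Set.Ioo 0 1) := fun c₁ c₂ => by
    refine Measure.integrableOn_of_bounded (M := 1) (by simp)
      (Measurable.ite (measurableSet_layer c₁ c₂) measurable_const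
        measurable_const).aestronglyMeasurable (Filter.Eventually.of_forall fun θ => ?_)
    split_ifs <;> simp
  simp only [signLayer]
  rw [integral_add (hi _ _) (hi _ _), integral_layer, integral_layer]
  rcases le_total 0 a with ha | ha <;> rcases le_total 0 b with hb | hb
  · rw [abs_of_nonneg ha, abs_of_nonneg hb, abs_of_nonneg (add_nonneg ha hb),
      max_eq_right ((min_le_right _ _).trans (by linarith)),
      max_eq_right ((min_le_left _ _).trans (by linarith))]
    simp
  · rw [abs_of_nonneg ha, abs_of_nonpos hb,
      max_eq_left (le_min (by linarith) (by linarith)),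
      max_eq_right ((min_le_left _ _).trans (by linarith))]
    rcases le_total (2 * a) (-(2 * b)) with h | h
    · rw [min_eq_left h, abs_of_nonpos (by linarith)]
      ring_nf; simp
    · rw [min_eq_right h, abs_of_nonneg (by linarith)]
      ring_nf; simp
  · rw [abs_of_nonpos ha, abs_of_nonneg hb,
      max_eq_right ((min_le_left _ _).trans (by linarith)),
      max_eq_left (le_min (by linarith) (by linarith))]
    rcases le_total (-(2 * a)) (2 * b) with h | h
    · rw [min_eq_left h, abs_of_nonneg (by linarith)]
      ring_nf; simp
    · rw [min_eq_right h, abs_of_nonpos (by linarith)]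
      ring_nf; simp
  · rw [abs_of_nonpos ha, abs_of_nonpos hb, abs_of_nonpos (add_nonpos ha hb),
      max_eq_right ((min_le_left _ _).trans (by linarith)),
      max_eq_right ((min_le_right _ _).trans (by linarith))]
    ring_nf; norm_num

/-- **Minkowski's inequality** over a probability space, for a uniform bound. -/
theorem eLpNorm_integral_le_of_forall_le {α β : Type*} [MeasurableSpace α] [MeasurableSpace β]
    {μ : Measure α} {ν : Measure β} [SFinite μ] [IsProbabilityMeasure ν] {f : β → α → ℂ}
    (hf : AEStronglyMeasurable (fun z : β × α => f z.1 z.2) (ν.prod μ)) {r : ℝ} (hr : 1 ≤ r)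
    {M : ℝ≥0∞} (hM : ∀ θ, eLpNorm (f θ) (ENNReal.ofReal r) μ ≤ M) :
    eLpNorm (fun x => ∫ θ, f θ x ∂ν) (ENNReal.ofReal r) μ ≤ M := by
  have hr0 : 0 < r := by linarith
  have h0 : ENNReal.ofReal r ≠ 0 := by simpa using hr0
  have hM' : ∀ θ, ∫⁻ x, ‖f θ x‖ₑ ^ r ∂μ ≤ M ^ r := fun θ => by
    have := hM θ
    rw [eLpNorm_eq_lintegral_rpow_enorm_toReal h0 ENNReal.ofReal_ne_top,
      ENNReal.toReal_ofReal hr0.le, one_div, ENNReal.rpow_inv_le_iff hr0] at this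
    exact this
  rw [eLpNorm_eq_lintegral_rpow_enorm_toReal h0 ENNReal.ofReal_ne_top,
    ENNReal.toReal_ofReal hr0.le, one_div, ENNReal.rpow_inv_le_iff hr0]
  have hswap : AEStronglyMeasurable (fun z : α × β => f z.2 z.1) (μ.prod ν) := hf.prod_swap
  calc ∫⁻ x, ‖∫ θ, f θ x ∂ν‖ₑ ^ r ∂μ ≤ ∫⁻ x, ∫⁻ θ, ‖f θ x‖ₑ ^ r ∂ν ∂μ := by
        refine lintegral_mono_ae ?_
        filter_upwards [hswap.prodMk_left] with x hx
        refine (ENNReal.rpow_le_rpow (enorm_integral_le_lintegral_enorm _) hr0.le).trans ?_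
        have := eLpNorm_le_eLpNorm_of_exponent_le (μ := ν) (p := 1) (q := ENNReal.ofReal r)
          (by simpa using hr) hx
        rw [eLpNorm_one_eq_lintegral_enorm,
          eLpNorm_eq_lintegral_rpow_enorm_toReal h0 ENNReal.ofReal_ne_top,
          ENNReal.toReal_ofReal hr0.le, one_div, ENNReal.le_rpow_inv_iff hr0] at this
        exact this
    _ = ∫⁻ θ, ∫⁻ x, ‖f θ x‖ₑ ^ r ∂μ ∂ν :=
        lintegral_lintegral_swap (hswap.enorm.pow_const r)
    _ ≤ ∫⁻ _, M ^ r ∂ν := lintegral_mono hM'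
    _ = M ^ r := by simp

end BilinearMultiplier

section BilinearMultiplierBound

variable {E : Type*} [NormedAddCommGroup E] [InnerProductSpace ℝ E] {ι : Type*}

/-- The symbol `∏ i ∈ S, exp (|⟪eᵢ, ξ + η⟫| - |⟪eᵢ, ξ⟫| - |⟪eᵢ, η⟫|)`. -/
def bilinSymbol (e : ι → E) (S : Finset ι) (z : E × E) : ℝ :=
  ∏ i ∈ S, Real.exp (|inner ℝ (e i) z.1 + inner ℝ (e i) z.2| - |inner ℝ (e i) z.1|
    - |inner ℝ (e i) z.2|)

theorem continuous_bilinSymbol (e : ι → E) (S : Finset ι) : Continuous (bilinSymbol e S) := by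
  unfold bilinSymbol
  fun_prop

theorem bilinSymbol_nonneg (e : ι → E) (S : Finset ι) (z : E × E) : 0 ≤ bilinSymbol e S z :=
  Finset.prod_nonneg fun _ _ => (Real.exp_pos _).le

theorem bilinSymbol_le_one (e : ι → E) (S : Finset ι) (z : E × E) : bilinSymbol e S z ≤ 1 :=
  Finset.prod_le_one (fun _ _ => (Real.exp_pos _).le) fun i _ => Real.exp_le_one_iff.2 (by
    linarith [abs_add_le (inner ℝ (e i) z.1) (inner ℝ (e i) z.2)])

theorem norm_bilinSymbol_le (e : ι → E) (S : Finset ι) (x : E) (z : E × E) (c : ℂ) :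
    ‖(𝐞 (inner ℝ (z.1 + z.2) x) : ℂ) * bilinSymbol e S z * c‖ ≤ ‖c‖ := by
  rw [norm_mul, norm_mul, Circle.norm_coe, one_mul, Complex.norm_real,
    Real.norm_of_nonneg (bilinSymbol_nonneg e S z)]
  exact mul_le_of_le_one_left (norm_nonneg _) (bilinSymbol_le_one e S z)

theorem continuous_bilinKernel (e : ι → E) (S : Finset ι) :
    Continuous fun y : E × (E × E) =>
      (𝐞 (inner ℝ (y.2.1 + y.2.2) y.1) : ℂ) * bilinSymbol e S y.2 := by
  have h1 : Continuous fun y : E × (E × E) => inner ℝ (y.2.1 + y.2.2) y.1 := by fun_prop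
  exact (continuous_subtype_val.comp (Real.continuous_fourierChar.comp h1)).mul
    (Complex.continuous_ofReal.comp ((continuous_bilinSymbol e S).comp continuous_snd))

/-- The projection to the half space `{-log θ < ⟪e, ξ⟫}`. -/
def layerProj (e : E) (θ : ℝ) (u : E → ℂ) : E → ℂ := {ξ | -Real.log θ < inner ℝ e ξ}.indicator u

theorem layerProj_mul_add (e : E) (θ : ℝ) (u v : E → ℂ) (z : E × E) :
    layerProj ((2 : ℝ) • e) θ u z.1 * layerProj (-((2 : ℝ) • e)) θ v z.2
      + layerProj (-((2 : ℝ) • e)) θ u z.1 * layerProj ((2 : ℝ) • e) θ v z.2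
      = (signLayer (inner ℝ e z.1) (inner ℝ e z.2) θ : ℂ) * (u z.1 * v z.2) := by
  simp only [layerProj, Set.indicator_apply, Set.mem_ofPred_eq, signLayer, inner_neg_left,
    real_inner_smul_left]
  split_ifs <;> simp_all
  ring

variable [FiniteDimensional ℝ E] [MeasurableSpace E] [BorelSpace E]
  {u v : E → ℂ}

/-- The bilinear Fourier multiplier with symbol `bilinSymbol e S`. -/
def bilinOp (e : ι → E) (S : Finset ι) (u v : E → ℂ) (x : E) : ℂ :=
  ∫ z : E × E, (𝐞 (inner ℝ (z.1 + z.2) x) : ℂ) * bilinSymbol e S z * (u z.1 * v z.2)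

theorem integrable_bilinOp (e : ι → E) (S : Finset ι) (x : E) {w : E × E → ℂ}
    (hw : Integrable w) : Integrable fun z : E × E =>
      (𝐞 (inner ℝ (z.1 + z.2) x) : ℂ) * bilinSymbol e S z * w z :=
  hw.mono (((continuous_bilinKernel e S).comp
    (Continuous.prodMk_right x)).aestronglyMeasurable.mul hw.1)
    (Filter.Eventually.of_forall fun z => norm_bilinSymbol_le e S x z _)

theorem bilinOp_empty (e : ι → E) (u v : E → ℂ) (x : E) :
    bilinOp e ∅ u v x = 𝓕⁻ u x * 𝓕⁻ v x := by
  rw [Real.fourierInv_eq, Real.fourierInv_eq, ← integral_prod_mul]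
  refine integral_congr_ae (Filter.Eventually.of_forall fun z => ?_)
  simp only [bilinSymbol, Finset.prod_empty, inner_add_left, AddChar.map_add_eq_mul,
    Circle.smul_def, smul_eq_mul, Circle.coe_mul, Complex.ofReal_one]
  ring

theorem BddSpectrum.layerProj (hu : BddSpectrum u) (e : E) (θ : ℝ) :
    BddSpectrum (layerProj e θ u) := hu.indicator (measurableSet_lt_inner e _)

theorem norm_signLayer_le (a b θ : ℝ) : ‖(signLayer a b θ : ℂ)‖ ≤ 2 := by
  rw [Complex.norm_real, signLayer]
  split_ifs <;> norm_num

theorem measurable_signLayer (e : E) :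
    Measurable fun y : ℝ × (E × E) => signLayer (inner ℝ e y.2.1) (inner ℝ e y.2.2) y.1 := by
  have hl : Measurable fun y : ℝ × (E × E) => -Real.log y.1 :=
    (Real.measurable_log.comp measurable_fst).neg
  have h1 : Measurable fun y : ℝ × (E × E) => inner ℝ e y.2.1 :=
    (by fun_prop : Continuous fun y : ℝ × (E × E) => inner ℝ e y.2.1).measurable
  have h2 : Measurable fun y : ℝ × (E × E) => inner ℝ e y.2.2 :=
    (by fun_prop : Continuous fun y : ℝ × (E × E) => inner ℝ e y.2.2).measurable
  refine Measurable.add ?_ ?_ <;> refine Measurable.ite ?_ measurable_const measurable_const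
  · exact (measurableSet_lt hl (h1.const_mul 2)).inter (measurableSet_lt hl (h2.const_mul 2).neg)
  · exact (measurableSet_lt hl (h1.const_mul 2).neg).inter (measurableSet_lt hl (h2.const_mul 2))

theorem bilinOp_layer (e : ι → E) (S : Finset ι) (i : ι) (hu : BddSpectrum u) (hv : BddSpectrum v)
    (θ : ℝ) (x : E) :
    bilinOp e S (layerProj ((2 : ℝ) • e i) θ u) (layerProj (-((2 : ℝ) • e i)) θ v) x
      + bilinOp e S (layerProj (-((2 : ℝ) • e i)) θ u) (layerProj ((2 : ℝ) • e i) θ v) x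
      = ∫ z : E × E, (𝐞 (inner ℝ (z.1 + z.2) x) : ℂ) * bilinSymbol e S z *
        ((signLayer (inner ℝ (e i) z.1) (inner ℝ (e i) z.2) θ : ℂ) * (u z.1 * v z.2)) := by
  rw [bilinOp, bilinOp, ← integral_add
    (integrable_bilinOp e S x ((hu.layerProj _ _).integrable.mul_prod (hv.layerProj _ _).integrable))
    (integrable_bilinOp e S x ((hu.layerProj _ _).integrable.mul_prod
      (hv.layerProj _ _).integrable))]
  refine integral_congr_ae (Filter.Eventually.of_forall fun z => ?_)
  simp only [← layerProj_mul_add]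
  ring

instance isProbabilityMeasure_restrict_Ioo :
    IsProbabilityMeasure ((volume : Measure ℝ).restrict (Set.Ioo 0 1)) := ⟨by simp⟩

theorem bilinOp_insert (e : ι → E) {S : Finset ι} {i : ι} [DecidableEq ι] (hi : i ∉ S)
    (hu : BddSpectrum u) (hv : BddSpectrum v) (x : E) :
    bilinOp e (insert i S) u v x = bilinOp e S u v x - ∫ θ in Set.Ioo (0 : ℝ) 1,
      (bilinOp e S (layerProj ((2 : ℝ) • e i) θ u) (layerProj (-((2 : ℝ) • e i)) θ v) x
      + bilinOp e S (layerProj (-((2 : ℝ) • e i)) θ u) (layerProj ((2 : ℝ) • e i) θ v) x) := by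
  have hw : Integrable fun z : E × E => u z.1 * v z.2 := hu.integrable.mul_prod hv.integrable
  have hK := integrable_bilinOp e S x hw
  have hF : Integrable (Function.uncurry fun (θ : ℝ) (z : E × E) =>
      (𝐞 (inner ℝ (z.1 + z.2) x) : ℂ) * bilinSymbol e S z *
        ((signLayer (inner ℝ (e i) z.1) (inner ℝ (e i) z.2) θ : ℂ) * (u z.1 * v z.2)))
      (((volume : Measure ℝ).restrict (Set.Ioo 0 1)).prod volume) := by
    have h1 := (hK.comp_snd ((volume : Measure ℝ).restrict (Set.Ioo 0 1))).bdd_mul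
      (f := fun y : ℝ × (E × E) =>
        ((signLayer (inner ℝ (e i) y.2.1) (inner ℝ (e i) y.2.2) y.1 : ℝ) : ℂ)) (c := 2)
      (Complex.measurable_ofReal.comp (measurable_signLayer (e i))).aestronglyMeasurable
      (Filter.Eventually.of_forall fun y => norm_signLayer_le _ _ _)
    refine h1.congr (Filter.Eventually.of_forall fun y => ?_)
    simp only [Function.uncurry]; ring
  simp only [bilinOp_layer e S i hu hv]
  have hF' : Integrable fun z : E × E => ∫ θ in Set.Ioo (0 : ℝ) 1,
      (𝐞 (inner ℝ (z.1 + z.2) x) : ℂ) * bilinSymbol e S z *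
        ((signLayer (inner ℝ (e i) z.1) (inner ℝ (e i) z.2) θ : ℂ) * (u z.1 * v z.2)) :=
    hF.integral_prod_right
  rw [integral_integral_swap hF, bilinOp, bilinOp, ← integral_sub hK hF']
  refine integral_congr_ae (Filter.Eventually.of_forall fun z => ?_)
  have h2 : ∫ θ in Set.Ioo (0 : ℝ) 1, (𝐞 (inner ℝ (z.1 + z.2) x) : ℂ) * bilinSymbol e S z *
        ((signLayer (inner ℝ (e i) z.1) (inner ℝ (e i) z.2) θ : ℂ) * (u z.1 * v z.2))
      = (𝐞 (inner ℝ (z.1 + z.2) x) : ℂ) * bilinSymbol e S z * (u z.1 * v z.2)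
        * ((∫ θ in Set.Ioo (0 : ℝ) 1, signLayer (inner ℝ (e i) z.1) (inner ℝ (e i) z.2) θ : ℝ) : ℂ) := by
    rw [← integral_complex_ofReal, ← integral_const_mul]
    refine integral_congr_ae (Filter.Eventually.of_forall fun θ => ?_)
    simp only []; ring
  have h3 := exp_abs_add_sub_eq (inner ℝ (e i) z.1) (inner ℝ (e i) z.2)
  simp only []
  rw [h2, bilinSymbol, Finset.prod_insert hi, h3, ← bilinSymbol]
  push_cast
  ring

theorem aestronglyMeasurable_bilinOp_layer (e : ι → E) (S : Finset ι) (i : ι)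
    (hu : BddSpectrum u) (hv : BddSpectrum v) :
    AEStronglyMeasurable (fun y : ℝ × E =>
      bilinOp e S (layerProj ((2 : ℝ) • e i) y.1 u) (layerProj (-((2 : ℝ) • e i)) y.1 v) y.2
      + bilinOp e S (layerProj (-((2 : ℝ) • e i)) y.1 u) (layerProj ((2 : ℝ) • e i) y.1 v) y.2)
      (((volume : Measure ℝ).restrict (Set.Ioo 0 1)).prod volume) := by
  simp only [bilinOp_layer e S i hu hv]
  have hw : AEStronglyMeasurable fun z : E × E => u z.1 * v z.2 :=
    (hu.integrable.mul_prod hv.integrable).1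
  refine AEStronglyMeasurable.integral_prod_right' (μ := ((volume : Measure ℝ).restrict
    (Set.Ioo 0 1)).prod (volume : Measure E)) (ν := (volume : Measure (E × E)))
    (f := fun y : (ℝ × E) × (E × E) => (𝐞 (inner ℝ (y.2.1 + y.2.2) y.1.2) : ℂ) *
      bilinSymbol e S y.2 * ((signLayer (inner ℝ (e i) y.2.1) (inner ℝ (e i) y.2.2) y.1.1 : ℂ) *
        (u y.2.1 * v y.2.2))) ?_
  refine AEStronglyMeasurable.mul ?_ (AEStronglyMeasurable.mul ?_ hw.comp_snd)
  · exact ((continuous_bilinKernel e S).comp (f := fun y : (ℝ × E) × (E × E) => (y.1.2, y.2))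
      (by fun_prop)).aestronglyMeasurable
  · have hm : Measurable fun y : (ℝ × E) × (E × E) => (y.1.1, y.2) := by fun_prop
    exact (Complex.measurable_ofReal.comp
      ((measurable_signLayer (e i)).comp hm)).aestronglyMeasurable

theorem aestronglyMeasurable_bilinOp (e : ι → E) (S : Finset ι)
    (hu : BddSpectrum u) (hv : BddSpectrum v) :
    AEStronglyMeasurable (bilinOp e S u v) volume := by
  have hw : AEStronglyMeasurable fun z : E × E => u z.1 * v z.2 :=
    (hu.integrable.mul_prod hv.integrable).1
  exact AEStronglyMeasurable.integral_prod_right' (μ := (volume : Measure E))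
    (ν := (volume : Measure (E × E))) (f := fun y : E × (E × E) =>
      (𝐞 (inner ℝ (y.2.1 + y.2.2) y.1) : ℂ) * bilinSymbol e S y.2 * (u y.2.1 * v y.2.2))
    ((continuous_bilinKernel e S).aestronglyMeasurable.mul hw.comp_snd)

theorem eLpNorm_mul_le_two_mul {f g : E → ℂ} (hf : AEStronglyMeasurable f volume)
    (hg : AEStronglyMeasurable g volume) {r : ℝ} (hr : 1 ≤ r) :
    eLpNorm (fun x => f x * g x) (ENNReal.ofReal r) volume
      ≤ eLpNorm f (ENNReal.ofReal (2 * r)) volume * eLpNorm g (ENNReal.ofReal (2 * r)) volume := by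
  have : ENNReal.HolderTriple (ENNReal.ofReal (2 * r)) (ENNReal.ofReal (2 * r))
      (ENNReal.ofReal r) := ⟨by
    rw [← ENNReal.ofReal_inv_of_pos (by linarith), ← ENNReal.ofReal_inv_of_pos (by linarith),
      ← ENNReal.ofReal_add (by positivity) (by positivity)]
    congr 1; field_simp; norm_num⟩
  have h := eLpNorm_smul_le_mul_eLpNorm (p := ENNReal.ofReal (2 * r))
    (q := ENNReal.ofReal (2 * r)) (r := ENNReal.ofReal r) hg hf
  exact h

theorem exists_eLpNorm_bilinOp_le {r : ℝ} (hr : 1 ≤ r) (S : Finset ι) :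
    ∃ C : ℝ≥0, ∀ (e : ι → E) (u v : E → ℂ), BddSpectrum u → BddSpectrum v →
      eLpNorm (bilinOp e S u v) (ENNReal.ofReal r) volume
        ≤ C * (eLpNorm (𝓕⁻ u) (ENNReal.ofReal (2 * r)) volume
          * eLpNorm (𝓕⁻ v) (ENNReal.ofReal (2 * r)) volume) := by
  classical
  have hr1 : 1 ≤ ENNReal.ofReal r := by simpa using hr
  obtain ⟨D, -, hD⟩ := exists_eLpNorm_fourierInv_half_space_le (E := E)
    (show 2 ≤ 2 * r by linarith)
  induction S using Finset.induction_on with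
  | empty =>
    refine ⟨1, fun e u v hu hv => ?_⟩
    have : bilinOp e ∅ u v = fun x => 𝓕⁻ u x * 𝓕⁻ v x := funext (bilinOp_empty e u v)
    rw [this, ENNReal.coe_one, one_mul]
    exact eLpNorm_mul_le_two_mul hu.continuous_fourierInv.aestronglyMeasurable
      hv.continuous_fourierInv.aestronglyMeasurable hr
  | insert i S hi ih =>
    obtain ⟨C, hC⟩ := ih
    refine ⟨C + 2 * (C * D ^ 2), fun e u v hu hv => ?_⟩
    set N := eLpNorm (𝓕⁻ u) (ENNReal.ofReal (2 * r)) volume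
      * eLpNorm (𝓕⁻ v) (ENNReal.ofReal (2 * r)) volume with hN
    have hlay : ∀ (w₁ w₂ : E) (θ : ℝ), eLpNorm (bilinOp e S (layerProj w₁ θ u) (layerProj w₂ θ v))
        (ENNReal.ofReal r) volume ≤ C * (D ^ 2 * N) := fun w₁ w₂ θ => by
      refine (hC e _ _ (hu.layerProj _ _) (hv.layerProj _ _)).trans (mul_le_mul_right ?_ _)
      calc _ ≤ (D * eLpNorm (𝓕⁻ u) (ENNReal.ofReal (2 * r)) volume)
            * (D * eLpNorm (𝓕⁻ v) (ENNReal.ofReal (2 * r)) volume) :=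
            mul_le_mul' (hD _ _ _ hu) (hD _ _ _ hv)
        _ = _ := by rw [hN]; ring
    have hmeas := aestronglyMeasurable_bilinOp_layer e S i hu hv
    have hInt : eLpNorm (fun x => ∫ θ in Set.Ioo (0 : ℝ) 1,
        (bilinOp e S (layerProj ((2 : ℝ) • e i) θ u) (layerProj (-((2 : ℝ) • e i)) θ v) x
        + bilinOp e S (layerProj (-((2 : ℝ) • e i)) θ u) (layerProj ((2 : ℝ) • e i) θ v) x))
        (ENNReal.ofReal r) volume ≤ C * (D ^ 2 * N) + C * (D ^ 2 * N) := by
      refine eLpNorm_integral_le_of_forall_le hmeas hr fun θ => ?_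
      exact (eLpNorm_add_le (aestronglyMeasurable_bilinOp e S (hu.layerProj _ _) (hv.layerProj _ _))
        (aestronglyMeasurable_bilinOp e S (hu.layerProj _ _) (hv.layerProj _ _)) hr1).trans
        (add_le_add (hlay _ _ θ) (hlay _ _ θ))
    have heq : bilinOp e (insert i S) u v = _ := funext (bilinOp_insert e hi hu hv)
    rw [heq]
    refine (eLpNorm_sub_le (aestronglyMeasurable_bilinOp e S hu hv)
      hmeas.prod_swap.integral_prod_right' hr1).trans ((add_le_add (hC e u v hu hv) hInt).trans_eq ?_)
    push_cast
    ring

end BilinearMultiplierBound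

section Bernstein

variable {E : Type*} [NormedAddCommGroup E] [InnerProductSpace ℝ E] [FiniteDimensional ℝ E]
  [MeasurableSpace E] [BorelSpace E]

theorem lintegral_mul_enorm_rpow_le {α : Type*} [MeasurableSpace α] {μ : Measure α}
    {k : α → ℝ≥0∞} (hk : Measurable k) {f : α → ℂ} (hf : AEStronglyMeasurable f μ)
    {r : ℝ} (hr : 1 ≤ r) :
    (∫⁻ y, k y * ‖f y‖ₑ ∂μ) ^ r ≤ (∫⁻ y, k y ∂μ) ^ (r - 1) * ∫⁻ y, k y * ‖f y‖ₑ ^ r ∂μ := by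
  have hr0 : 0 < r := by linarith
  have hac := withDensity_absolutelyContinuous μ k
  have hf' := hf.mono_ac hac
  have h := eLpNorm_le_eLpNorm_mul_rpow_measure_univ (p := 1) (q := ENNReal.ofReal r)
    (by simpa using hr) hf'
  rw [eLpNorm_one_eq_lintegral_enorm,
    eLpNorm_eq_lintegral_rpow_enorm_toReal (by simpa using hr0) ENNReal.ofReal_ne_top,
    ENNReal.toReal_ofReal hr0.le, withDensity_apply _ MeasurableSet.univ, Measure.restrict_univ,
    lintegral_withDensity_eq_lintegral_mul₀ hk.aemeasurable hf.enorm,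
    lintegral_withDensity_eq_lintegral_mul₀ hk.aemeasurable (hf.enorm.pow_const r)] at h
  simp only [Pi.mul_apply, ENNReal.toReal_one] at h
  refine (ENNReal.rpow_le_rpow h hr0.le).trans_eq ?_
  rw [ENNReal.mul_rpow_of_nonneg _ _ hr0.le, ← ENNReal.rpow_mul, ← ENNReal.rpow_mul,
    one_div_mul_cancel hr0.ne', ENNReal.rpow_one, mul_comm]
  congr 2
  field_simp

/-- **Young's convolution inequality** for a bounded integrable kernel. -/
theorem eLpNorm_le_of_enorm_le_convolution {k : E → ℝ≥0∞} (hk : Measurable k) {M : ℝ≥0∞}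
    (hM : ∀ y, k y ≤ M) (hMt : M ≠ ∞) (hk1 : ∫⁻ y, k y ≠ ∞) {f h : E → ℂ}
    (hf : AEStronglyMeasurable f volume)
    (hh : ∀ x, ‖h x‖ₑ ≤ ∫⁻ y, k (x - y) * ‖f y‖ₑ) {r q : ℝ} (hr : 1 ≤ r) (hrq : r ≤ q) :
    eLpNorm h (ENNReal.ofReal q) volume
      ≤ ((∫⁻ y, k y) ^ (1 - 1 / r) * M ^ (1 / r)) ^ (1 - r / q) * (∫⁻ y, k y) ^ (r / q)
        * eLpNorm f (ENNReal.ofReal r) volume := by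
  have hr0 : 0 < r := by linarith
  have hq0 : 0 < q := by linarith
  have hrr : 0 ≤ 1 - 1 / r := by
    rw [sub_nonneg, div_le_one hr0]; exact hr
  have hrq' : 0 ≤ 1 - r / q := by
    rw [sub_nonneg, div_le_one hq0]; exact hrq
  set I := ∫⁻ y, k y with hI
  have hkx : ∀ x, ∫⁻ y, k (x - y) = I := fun x => lintegral_sub_left_eq_self _ _
  have hNr : eLpNorm f (ENNReal.ofReal r) volume = (∫⁻ y, ‖f y‖ₑ ^ r) ^ (1 / r) := by
    rw [eLpNorm_eq_lintegral_rpow_enorm_toReal (by simpa using hr0) ENNReal.ofReal_ne_top,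
      ENNReal.toReal_ofReal hr0.le]
  have hpt : ∀ x, ‖h x‖ₑ ^ r ≤ I ^ (r - 1) * ∫⁻ y, k (x - y) * ‖f y‖ₑ ^ r := fun x => by
    have h1 := lintegral_mul_enorm_rpow_le (hk.comp (measurable_const.sub measurable_id)) hf hr
      (k := fun y => k (x - y))
    rw [hkx] at h1
    exact (ENNReal.rpow_le_rpow (hh x) hr0.le).trans h1
  have hIr : I ^ (r - 1) ≠ ∞ := ENNReal.rpow_ne_top_of_nonneg (by linarith) hk1
  have hsup : ∀ x, ‖h x‖ₑ ≤ I ^ (1 - 1 / r) * M ^ (1 / r)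
      * eLpNorm f (ENNReal.ofReal r) volume := fun x => by
    rw [hNr, ← ENNReal.rpow_le_rpow_iff hr0, ENNReal.mul_rpow_of_nonneg _ _ hr0.le,
      ENNReal.mul_rpow_of_nonneg _ _ hr0.le, ← ENNReal.rpow_mul, ← ENNReal.rpow_mul,
      ← ENNReal.rpow_mul, one_div_mul_cancel hr0.ne', ENNReal.rpow_one, ENNReal.rpow_one,
      show (1 - 1 / r) * r = r - 1 by field_simp, mul_assoc]
    refine (hpt x).trans (mul_le_mul_right ?_ _)
    rw [← lintegral_const_mul' _ _ hMt]
    exact lintegral_mono fun y => mul_le_mul_left (hM _) _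
  have hLr : eLpNorm h (ENNReal.ofReal r) volume ≤ I * eLpNorm f (ENNReal.ofReal r) volume := by
    rw [hNr, eLpNorm_eq_lintegral_rpow_enorm_toReal (by simpa using hr0) ENNReal.ofReal_ne_top,
      ENNReal.toReal_ofReal hr0.le, ← ENNReal.rpow_le_rpow_iff hr0,
      ENNReal.mul_rpow_of_nonneg _ _ hr0.le, ← ENNReal.rpow_mul, ← ENNReal.rpow_mul,
      one_div_mul_cancel hr0.ne', ENNReal.rpow_one, ENNReal.rpow_one]
    have hmeas : AEMeasurable (Function.uncurry fun x y => k (x - y) * ‖f y‖ₑ ^ r)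
        ((volume : Measure E).prod volume) :=
      (hk.comp (measurable_fst.sub measurable_snd)).aemeasurable.mul
        ((hf.enorm.pow_const r).comp_snd)
    calc ∫⁻ x, ‖h x‖ₑ ^ r ≤ ∫⁻ x, I ^ (r - 1) * ∫⁻ y, k (x - y) * ‖f y‖ₑ ^ r := lintegral_mono hpt
      _ = I ^ (r - 1) * ∫⁻ y, ∫⁻ x, k (x - y) * ‖f y‖ₑ ^ r := by
          rw [lintegral_const_mul' _ _ hIr, lintegral_lintegral_swap hmeas]
      _ = I ^ (r - 1) * ∫⁻ y, I * ‖f y‖ₑ ^ r := by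
          congr 1
          refine lintegral_congr fun y => ?_
          rw [lintegral_mul_const _ (show Measurable fun x => k (x - y) from
            hk.comp (measurable_id.sub measurable_const))]
          congr 1
          exact lintegral_sub_right_eq_self _ _
      _ = I ^ r * ∫⁻ y, ‖f y‖ₑ ^ r := by
          rw [lintegral_const_mul' _ _ hk1, ← mul_assoc]
          congr 1
          nth_rewrite 2 [← ENNReal.rpow_one I]
          rw [← ENNReal.rpow_add_of_nonneg _ _ (by linarith) zero_le_one]
          congr 1; ring
  rcases eq_or_ne (eLpNorm f (ENNReal.ofReal r) volume) ∞ with hN | hN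
  · rcases eq_or_ne I 0 with h0 | h0
    · have hz : ∀ x, h x = 0 := fun x => by
        have h1 := hh x
        have h2 : (fun y => k (x - y)) =ᵐ[volume] 0 :=
          (lintegral_eq_zero_iff (hk.comp (measurable_const.sub measurable_id))).1
            ((hkx x).trans h0)
        have h3 : ∫⁻ y, k (x - y) * ‖f y‖ₑ = 0 := by
          rw [← lintegral_zero]
          refine lintegral_congr_ae ?_
          filter_upwards [h2] with y hy
          simp only [Pi.zero_apply] at hy
          rw [hy, zero_mul]
        rw [h3] at h1
        simpa using h1
      have : h = 0 := funext hz
      simp [this]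
    · have hM0 : M ≠ 0 := fun hM0 => h0 (by
        rw [hI, ← lintegral_zero]
        exact lintegral_congr fun y => le_antisymm (hM0 ▸ hM y) zero_le)
      rw [hN, ENNReal.mul_top]
      · exact le_top
      · have e1 : I ^ (1 - 1 / r) ≠ 0 := fun h => h0 (ENNReal.rpow_eq_zero_iff.1 h |>.elim
          (fun h => h.1) fun h => absurd h.1 hk1)
        have e2 : M ^ (1 / r) ≠ 0 := fun h => hM0 (ENNReal.rpow_eq_zero_iff.1 h |>.elim
          (fun h => h.1) fun h => absurd h.1 hMt)
        have e3 : I ^ (1 - 1 / r) * M ^ (1 / r) ≠ ∞ :=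
          ENNReal.mul_ne_top (ENNReal.rpow_ne_top_of_nonneg hrr hk1)
            (ENNReal.rpow_ne_top_of_nonneg (by positivity) hMt)
        refine mul_ne_zero (fun h => ?_) (fun h => ?_)
        · rcases ENNReal.rpow_eq_zero_iff.1 h with h | h
          · exact mul_ne_zero e1 e2 h.1
          · exact e3 h.1
        · rcases ENNReal.rpow_eq_zero_iff.1 h with h | h
          · exact h0 h.1
          · exact hk1 h.1
  · have hfin : I ^ (1 - 1 / r) * M ^ (1 / r) * eLpNorm f (ENNReal.ofReal r) volume ≠ ∞ :=
      ENNReal.mul_ne_top (ENNReal.mul_ne_top (ENNReal.rpow_ne_top_of_nonneg hrr hk1)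
        (ENNReal.rpow_ne_top_of_nonneg (by positivity) hMt)) hN
    refine (eLpNorm_le_of_enorm_le_of_le hfin hsup hr0 hrq).trans
      ((mul_le_mul_right (ENNReal.rpow_le_rpow hLr (by positivity)) _).trans_eq ?_)
    rw [ENNReal.mul_rpow_of_nonneg _ _ hrq', ENNReal.mul_rpow_of_nonneg _ _ (by positivity : 0 ≤ r / q)]
    have : eLpNorm f (ENNReal.ofReal r) volume ^ (1 - r / q)
        * eLpNorm f (ENNReal.ofReal r) volume ^ (r / q) = eLpNorm f (ENNReal.ofReal r) volume := by
      rw [← ENNReal.rpow_add_of_nonneg _ _ hrq' (by positivity), sub_add_cancel, ENNReal.rpow_one]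
    calc (I ^ (1 - 1 / r) * M ^ (1 / r)) ^ (1 - r / q)
          * eLpNorm f (ENNReal.ofReal r) volume ^ (1 - r / q)
          * (I ^ (r / q) * eLpNorm f (ENNReal.ofReal r) volume ^ (r / q))
        = (I ^ (1 - 1 / r) * M ^ (1 / r)) ^ (1 - r / q) * I ^ (r / q)
          * (eLpNorm f (ENNReal.ofReal r) volume ^ (1 - r / q)
            * eLpNorm f (ENNReal.ofReal r) volume ^ (r / q)) := by ring
      _ = _ := by rw [this]

theorem fourierInv_comp_sub_left (K : E → ℂ) (x ξ : E) :
    𝓕⁻ (fun y => K (x - y)) ξ = 𝐞 (inner ℝ ξ x) • 𝓕 K ξ := by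
  rw [Real.fourierInv_eq, Real.fourier_eq, ← integral_sub_left_eq_self _ _ x,
    Circle.smul_def, ← integral_smul]
  refine integral_congr_ae (Filter.Eventually.of_forall fun y => ?_)
  have h : inner ℝ (x - y) ξ = inner ℝ ξ x + -inner ℝ y ξ := by
    rw [inner_sub_left, real_inner_comm ξ x, sub_eq_add_neg]
  simp only [sub_sub_cancel, Circle.smul_def, smul_eq_mul]
  rw [h, AddChar.map_add_eq_mul, Circle.coe_mul, mul_assoc]

theorem fourierInv_fourier_mul {K w : E → ℂ} (hK : Integrable K) (hw : Integrable w) (x : E) :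
    𝓕⁻ (fun ξ => 𝓕 K ξ * w ξ) x = ∫ y, K (x - y) * 𝓕⁻ w y := by
  have h := integral_fourierInv_mul_eq_of_integrable hw (hK.comp_sub_left x)
  simp only [mul_comm (K _), h, fourierInv_comp_sub_left]
  rw [Real.fourierInv_eq]
  refine integral_congr_ae (Filter.Eventually.of_forall fun ξ => ?_)
  simp only [Circle.smul_def, smul_eq_mul]; ring

theorem fourier_comp_smul (K : E → ℂ) {c : ℝ} (hc : 0 < c) (ξ : E) :
    𝓕 (fun y => ((c ^ Module.finrank ℝ E : ℝ) : ℂ) * K (c • y)) ξ = 𝓕 K (c⁻¹ • ξ) := by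
  rw [Real.fourier_eq, Real.fourier_eq]
  have h := Measure.integral_comp_smul (volume : Measure E)
    (fun y => 𝐞 (-inner ℝ y (c⁻¹ • ξ)) • K y) c
  have h2 : ∫ y, 𝐞 (-inner ℝ y ξ) • (((c ^ Module.finrank ℝ E : ℝ) : ℂ) * K (c • y))
      = ((c ^ Module.finrank ℝ E : ℝ) : ℂ)
        * ∫ y, 𝐞 (-inner ℝ (c • y) (c⁻¹ • ξ)) • K (c • y) := by
    rw [← integral_const_mul]
    refine integral_congr_ae (Filter.Eventually.of_forall fun y => ?_)
    have h3 : inner ℝ (c • y) (c⁻¹ • ξ) = inner ℝ y ξ := by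
      rw [real_inner_smul_left, real_inner_smul_right, mul_inv_cancel_left₀ hc.ne']
    simp only [h3, Circle.smul_def, smul_eq_mul]
    ring
  have hpos : (0 : ℝ) < (c ^ Module.finrank ℝ E)⁻¹ := by positivity
  rw [h2, h, abs_of_pos hpos, Complex.real_smul, ← mul_assoc, ← Complex.ofReal_mul,
    mul_inv_cancel₀ (by positivity), Complex.ofReal_one, one_mul]

theorem exists_eLpNorm_fourierInv_mul_le {ψ : E → ℝ} (hψ : ContDiff ℝ (⊤ : ℕ∞) ψ)
    (hs : HasCompactSupport ψ) {r q : ℝ} (hr : 1 ≤ r) (hrq : r ≤ q) :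
    ∃ C : ℝ≥0, ∀ (j : ℤ) (w : E → ℂ), Integrable w →
      eLpNorm (𝓕⁻ fun ξ => (ψ ((2 : ℝ) ^ (-j) • ξ) : ℂ) * w ξ) (ENNReal.ofReal q) volume
        ≤ C * ENNReal.ofReal ((2 : ℝ) ^ ((j : ℝ) * (Module.finrank ℝ E * (1 / r - 1 / q))))
          * eLpNorm (𝓕⁻ w) (ENNReal.ofReal r) volume := by
  have hr0 : 0 < r := by linarith
  have hq0 : 0 < q := by linarith
  have hrr : 0 ≤ 1 - 1 / r := by
    rw [sub_nonneg, div_le_one hr0]; exact hr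
  have hrq' : 0 ≤ 1 - r / q := by
    rw [sub_nonneg, div_le_one hq0]; exact hrq
  have hψ' : ContDiff ℝ (⊤ : ℕ∞) (fun x => (ψ x : ℂ)) := Complex.ofRealCLM.contDiff.comp hψ
  have hs' : HasCompactSupport (fun x => (ψ x : ℂ)) := hs.comp_left Complex.ofReal_zero
  set Ψ : 𝓢(E, ℂ) := hs'.toSchwartzMap hψ' with hΨ
  set K : 𝓢(E, ℂ) := 𝓕⁻ Ψ with hK
  have hKΨ : ∀ ξ, 𝓕 (K : E → ℂ) ξ = (ψ ξ : ℂ) := fun ξ => by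
    rw [← SchwartzMap.fourier_coe, hK, FourierTransform.fourier_fourierInv_eq]; rfl
  obtain ⟨M, hM⟩ : ∃ M : ℝ≥0, ∀ x, ‖K x‖ₑ ≤ M := by
    obtain ⟨M, hM⟩ := K.toBoundedContinuousFunction.norm_coe_le_norm |> fun h =>
      (⟨_, h⟩ : ∃ M, ∀ x, ‖K x‖ ≤ M)
    refine ⟨M.toNNReal, fun x => ?_⟩
    rw [← ofReal_norm]
    exact ENNReal.ofReal_le_ofReal (hM x)
  set I := ∫⁻ y, ‖K y‖ₑ with hI
  have hI1 : I ≠ ∞ := K.integrable.2.ne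
  have hC : (I ^ (1 - 1 / r) * (M : ℝ≥0∞) ^ (1 / r)) ^ (1 - r / q) * I ^ (r / q) ≠ ∞ :=
    ENNReal.mul_ne_top (ENNReal.rpow_ne_top_of_nonneg hrq' (ENNReal.mul_ne_top
      (ENNReal.rpow_ne_top_of_nonneg hrr hI1)
      (ENNReal.rpow_ne_top_of_nonneg (by positivity) ENNReal.coe_ne_top)))
      (ENNReal.rpow_ne_top_of_nonneg (by positivity) hI1)
  refine ⟨((I ^ (1 - 1 / r) * (M : ℝ≥0∞) ^ (1 / r)) ^ (1 - r / q) * I ^ (r / q)).toNNReal,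
    fun j w hw => ?_⟩
  rw [ENNReal.coe_toNNReal hC]
  set n := Module.finrank ℝ E with hn
  set c : ℝ := (2 : ℝ) ^ j with hc
  have hc0 : 0 < c := by positivity
  set L : E → ℂ := fun y => ((c ^ n : ℝ) : ℂ) * K (c • y) with hL
  have hLi : Integrable L := (K.integrable.comp_smul hc0.ne').const_mul _
  have hLc : Continuous L := continuous_const.mul (K.continuous.comp (continuous_const_smul c))
  have hLe : ∀ y, ‖L y‖ₑ = ENNReal.ofReal (c ^ n) * ‖K (c • y)‖ₑ := fun y => by
    rw [hL, enorm_mul]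
    congr 1
    rw [← ofReal_norm, Complex.norm_real, Real.norm_of_nonneg (by positivity)]
  have hLI : ∫⁻ y, ‖L y‖ₑ = I := by
    simp only [hLe]
    have h0 : (0 : ℝ) < (c ^ n)⁻¹ := by positivity
    rw [lintegral_const_mul' _ _ ENNReal.ofReal_ne_top,
      ← ofReal_integral_norm_eq_lintegral_enorm (K.integrable.comp_smul hc0.ne'),
      Measure.integral_comp_smul volume (fun y => ‖K y‖) c, ← hn, abs_of_pos h0, smul_eq_mul,
      ENNReal.ofReal_mul h0.le, ← mul_assoc, ← ENNReal.ofReal_mul (by positivity),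
      mul_inv_cancel₀ (by positivity), ENNReal.ofReal_one, one_mul,
      ofReal_integral_norm_eq_lintegral_enorm K.integrable]
  have hLM : ∀ y, ‖L y‖ₑ ≤ ENNReal.ofReal (c ^ n) * M := fun y => by
    rw [hLe]; exact mul_le_mul_right (hM _) _
  have hrep : ∀ x, 𝓕⁻ (fun ξ => (ψ ((2 : ℝ) ^ (-j) • ξ) : ℂ) * w ξ) x
      = ∫ y, L (x - y) * 𝓕⁻ w y := fun x => by
    have hLψ : ∀ ξ, 𝓕 L ξ = (ψ ((2 : ℝ) ^ (-j) • ξ) : ℂ) := fun ξ => by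
      rw [hL, fourier_comp_smul _ hc0, hKΨ, hc, zpow_neg]
    rw [← fourierInv_fourier_mul hLi hw x]
    simp only [hLψ]
  have key := eLpNorm_le_of_enorm_le_convolution (k := fun y => ‖L y‖ₑ)
    hLc.enorm.measurable hLM (ENNReal.mul_ne_top ENNReal.ofReal_ne_top ENNReal.coe_ne_top)
    (by rw [hLI]; exact hI1) (continuous_fourierInv_of_integrable hw).aestronglyMeasurable
    (h := 𝓕⁻ fun ξ => (ψ ((2 : ℝ) ^ (-j) • ξ) : ℂ) * w ξ)
    (fun x => by
      rw [hrep x]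
      refine (enorm_integral_le_lintegral_enorm _).trans_eq ?_
      simp only [enorm_mul]) hr hrq
  rw [hLI] at key
  refine key.trans_eq ?_
  congr 1
  have hpow : (ENNReal.ofReal (c ^ n) ^ (1 / r)) ^ (1 - r / q)
      = ENNReal.ofReal ((2 : ℝ) ^ ((j : ℝ) * (n * (1 / r - 1 / q)))) := by
    rw [← ENNReal.rpow_mul, ENNReal.ofReal_rpow_of_pos (by positivity), hc, ← zpow_natCast,
      ← zpow_mul, ← Real.rpow_intCast, ← Real.rpow_mul (by norm_num)]
    congr 2
    push_cast
    field_simp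
  rw [← hpow, ENNReal.mul_rpow_of_nonneg _ _ (by positivity : 0 ≤ 1 / r),
    ENNReal.mul_rpow_of_nonneg _ _ hrq', ENNReal.mul_rpow_of_nonneg _ _ hrq',
    ENNReal.mul_rpow_of_nonneg _ _ hrq']
  ring

end Bernstein

section BilinSpectrum

variable {E : Type*} [NormedAddCommGroup E] [InnerProductSpace ℝ E] [FiniteDimensional ℝ E]
  [MeasurableSpace E] [BorelSpace E] {ι : Type*} {u v : E → ℂ}

theorem fourier_fourierInv_eq_of_integrable {f : E → ℂ} (hc : Continuous f) (hf : Integrable f)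
    (hf' : Integrable (𝓕⁻ f)) : 𝓕 (𝓕⁻ f) = f := by
  refine hc.fourier_fourierInv_eq hf ?_
  have h : 𝓕 f = fun x => 𝓕⁻ f (-x) := funext fun x => by
    rw [Real.fourierInv_eq_fourier_neg, neg_neg]
  rw [h]
  exact hf'.comp_neg

/-- The frequency-side description of `bilinOp`: a twisted convolution. -/
def bilinSpectrum (e : ι → E) (S : Finset ι) (u v : E → ℂ) (ζ : E) : ℂ :=
  ∫ ξ, (bilinSymbol e S (ξ, ζ - ξ) : ℂ) * (u ξ * v (ζ - ξ))

theorem integrable_bilinSpectrum_kernel (e : ι → E) (S : Finset ι) (hu : Integrable u)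
    (hv : Integrable v) : Integrable fun z : E × E =>
      (bilinSymbol e S z : ℂ) * (u z.1 * v z.2) := by
  have h := integrable_bilinOp e S 0 (hu.mul_prod hv)
  simpa using h

theorem integrable_bilinSpectrum (e : ι → E) (S : Finset ι) (hu : Integrable u)
    (hv : Integrable v) : Integrable (bilinSpectrum e S u v) := by
  have h := ((measurePreserving_prod_sub_swap (volume : Measure E) volume).integrable_comp
    (integrable_bilinSpectrum_kernel e S hu hv).1).2 (integrable_bilinSpectrum_kernel e S hu hv)
  exact h.integral_prod_left

theorem fourierInv_bilinSpectrum (e : ι → E) (S : Finset ι) (hu : Integrable u)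
    (hv : Integrable v) : 𝓕⁻ (bilinSpectrum e S u v) = bilinOp e S u v := by
  funext x
  have hT := measurePreserving_prod_sub_swap (volume : Measure E) volume
  have hG := integrable_bilinOp e S x (hu.mul_prod hv)
  have hF : Integrable (fun z : E × E => (𝐞 (inner ℝ (z.2 + (z.1 - z.2)) x) : ℂ)
      * bilinSymbol e S (z.2, z.1 - z.2) * (u z.2 * v (z.1 - z.2))) (volume.prod volume) :=
    (hT.integrable_comp hG.1).2 hG
  have h1 : bilinOp e S u v x = ∫ z : E × E, (𝐞 (inner ℝ (z.2 + (z.1 - z.2)) x) : ℂ)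
      * bilinSymbol e S (z.2, z.1 - z.2) * (u z.2 * v (z.1 - z.2)) := by
    rw [bilinOp, Measure.volume_eq_prod, ← hT.map_eq,
      integral_map hT.measurable.aemeasurable (by rw [hT.map_eq]; exact hG.1), hT.map_eq]
  rw [h1, Measure.volume_eq_prod, integral_prod _ hF, Real.fourierInv_eq]
  refine integral_congr_ae (Filter.Eventually.of_forall fun ζ => ?_)
  simp only [bilinSpectrum, add_sub_cancel, Circle.smul_def, smul_eq_mul]
  rw [← integral_const_mul]
  refine integral_congr_ae (Filter.Eventually.of_forall fun ξ => ?_)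
  ring

theorem bilinSpectrum_eq_zero {e : ι → E} {S : Finset ι} {M N : ℝ} (hu : ∀ ξ, M < ‖ξ‖ → u ξ = 0)
    (hv : ∀ ξ, N < ‖ξ‖ → v ξ = 0) {ζ : E} (hζ : M + N < ‖ζ‖) : bilinSpectrum e S u v ζ = 0 := by
  rw [bilinSpectrum, ← integral_zero E ℂ]
  refine integral_congr_ae (Filter.Eventually.of_forall fun ξ => ?_)
  rcases lt_or_ge M ‖ξ‖ with h | h
  · simp [hu ξ h]
  · have h2 : N < ‖ζ - ξ‖ := by
      have := norm_sub_norm_le ζ ξ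
      linarith
    simp [hv _ h2]

theorem continuous_bilinSpectrum_empty (e : ι → E) (hu : Integrable u) (hvc : Continuous v)
    (hvs : HasCompactSupport v) : Continuous (bilinSpectrum e ∅ u v) := by
  have h := hvs.continuous_convolution_right (ContinuousLinearMap.mul ℝ ℂ) (μ := volume)
    hu.locallyIntegrable hvc
  convert h using 1
  funext ζ
  simp [bilinSpectrum, bilinSymbol, MeasureTheory.convolution]

theorem fourier_mul_fourierInv (e : ι → E) (hu : BddSpectrum u) (hv : BddSpectrum v)
    (hvc : Continuous v) (hvs : HasCompactSupport v) :
    𝓕 (fun x => 𝓕⁻ u x * 𝓕⁻ v x) = bilinSpectrum e ∅ u v := by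
  have h : (fun x => 𝓕⁻ u x * 𝓕⁻ v x) = 𝓕⁻ (bilinSpectrum e ∅ u v) := by
    rw [fourierInv_bilinSpectrum e ∅ hu.integrable hv.integrable]
    exact funext fun x => (bilinOp_empty e u v x).symm
  have h2 : Integrable (fun x => 𝓕⁻ u x * 𝓕⁻ v x) :=
    hu.memLp_two_fourierInv.integrable_mul hv.memLp_two_fourierInv
  rw [h] at h2 ⊢
  exact fourier_fourierInv_eq_of_integrable (continuous_bilinSpectrum_empty e hu.integrable hvc hvs)
    (integrable_bilinSpectrum e ∅ hu.integrable hv.integrable) h2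

theorem norm_fourier_le (u : E → ℂ) (x : E) : ‖𝓕 u x‖ ≤ ∫ ξ, ‖u ξ‖ := by
  have := norm_fourierInv_le u (-x)
  rwa [Real.fourierInv_eq_fourier_neg, neg_neg] at this

/-- Termwise Fourier transformation of a series converging absolutely in `L¹`. -/
theorem hasSum_fourier_tsum {κ : Type*} [Countable κ] {f : κ → E → ℂ}
    (hf : ∀ j, Integrable (f j)) (hs : Summable fun j => ∫ x, ‖f j x‖) (ζ : E) :
    HasSum (fun j => 𝓕 (f j) ζ) (𝓕 (fun x => ∑' j, f j x) ζ) := by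
  have h := hasSum_integral_of_summable_integral_norm (μ := (volume : Measure E))
    (F := fun j x => 𝐞 (-inner ℝ x ζ) • f j x)
    (fun j => (Real.fourierIntegral_convergent_iff ζ).2 (hf j))
    (by simpa only [Circle.norm_smul] using hs)
  have h2 : ∀ x, ∑' j, 𝐞 (-inner ℝ x ζ) • f j x = 𝐞 (-inner ℝ x ζ) • ∑' j, f j x := fun x => by
    simp only [Circle.smul_def, smul_eq_mul, tsum_mul_left]
  simp only [h2] at h
  simpa only [Real.fourier_eq] using h

theorem hasSum_fourierInv_tsum {κ : Type*} [Countable κ] {f : κ → E → ℂ}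
    (hf : ∀ j, Integrable (f j)) (hs : Summable fun j => ∫ x, ‖f j x‖) (ζ : E) :
    HasSum (fun j => 𝓕⁻ (f j) ζ) (𝓕⁻ (fun x => ∑' j, f j x) ζ) := by
  simp only [Real.fourierInv_eq_fourier_neg]
  exact hasSum_fourier_tsum hf hs (-ζ)

theorem eLpNorm_le_tsum_of_hasSum {α κ : Type*} [MeasurableSpace α] {μ : Measure α} [Countable κ]
    [Infinite κ] {f : κ → α → ℂ} {g : α → ℂ} (hf : ∀ j, AEStronglyMeasurable (f j) μ)
    (hs : ∀ x, HasSum (fun j => f j x) (g x)) {p : ℝ≥0∞} (hp : 1 ≤ p) :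
    eLpNorm g p μ ≤ ∑' j, eLpNorm (f j) p μ := by
  obtain ⟨⟨e⟩⟩ : Nonempty (Nonempty (ℕ ≃ κ)) := by
    obtain ⟨h⟩ := nonempty_denumerable κ
    exact ⟨⟨(Denumerable.eqv κ).symm⟩⟩
  have hlim := Lp.eLpNorm_lim_le_liminf_eLpNorm (p := p) (μ := μ)
    (f := fun n => ∑ i ∈ Finset.range n, f (e i))
    (fun n => Finset.aestronglyMeasurable_sum _ fun i _ => hf _) g
    (Filter.Eventually.of_forall fun x => by
      have := (e.hasSum_iff.2 (hs x)).tendsto_sum_nat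
      simpa [Finset.sum_apply] using this)
  refine hlim.trans ?_
  refine Filter.liminf_le_of_le (by isBoundedDefault) fun b hb => ?_
  obtain ⟨n, hn⟩ := hb.exists
  refine hn.trans ((eLpNorm_sum_le (fun i _ => hf _) hp).trans ?_)
  rw [← e.tsum_eq]
  exact ENNReal.sum_le_tsum _

end BilinSpectrum

section WeightedSeries

variable {E : Type*} [NormedAddCommGroup E] [InnerProductSpace ℝ E] [FiniteDimensional ℝ E]
  [MeasurableSpace E] [BorelSpace E] {ι : Type*}

theorem fourier_of_not_integrable {f : E → ℂ} (hf : ¬Integrable f) : 𝓕 f = 0 := by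
  funext ζ
  rw [Real.fourier_eq]
  exact integral_undef fun h => hf ((Real.fourierIntegral_convergent_iff ζ).1 h)

theorem fourierInv_of_not_integrable {f : E → ℂ} (hf : ¬Integrable f) : 𝓕⁻ f = 0 := by
  funext ζ
  rw [Real.fourierInv_eq_fourier_neg, fourier_of_not_integrable hf]
  rfl

theorem fourier_zero_fun : 𝓕 (0 : E → ℂ) = 0 := by
  funext ζ
  simp [Real.fourier_eq]

theorem fourierInv_zero_fun : 𝓕⁻ (0 : E → ℂ) = 0 := by
  funext ζ
  simp [Real.fourierInv_eq]

theorem BddSpectrum.of_continuous {u : E → ℂ} (hu : Continuous u) (hs : HasCompactSupport u) :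
    BddSpectrum u where
  meas := hu.aestronglyMeasurable
  bdd := by
    obtain ⟨M, hM⟩ := hs.exists_bound_of_continuous hu
    exact ⟨M, hM⟩
  supp := by
    obtain ⟨R, hR⟩ := hs.isCompact.isBounded.subset_closedBall (0 : E)
    refine ⟨R, fun ξ hξ => ?_⟩
    by_contra h
    have := hR (subset_tsupport _ h)
    rw [mem_closedBall_zero_iff] at this
    linarith

theorem exp_mul_bilinSpectrum_empty {e : ι → E} {S : Finset ι} {L : E → ℝ}
    (hL : ∀ ζ, L ζ = ∑ i ∈ S, |inner ℝ (e i) ζ|) (U V : E → ℂ) (ζ : E) :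
    (Real.exp (L ζ) : ℂ) * bilinSpectrum e ∅ (fun ξ => (Real.exp (-L ξ) : ℂ) * U ξ)
      (fun ξ => (Real.exp (-L ξ) : ℂ) * V ξ) ζ = bilinSpectrum e S U V ζ := by
  rw [bilinSpectrum, bilinSpectrum, ← integral_const_mul]
  refine integral_congr_ae (Filter.Eventually.of_forall fun ξ => ?_)
  have h : bilinSymbol e S (ξ, ζ - ξ)
      = Real.exp (L ζ) * Real.exp (-L ξ) * Real.exp (-L (ζ - ξ)) := by
    rw [← Real.exp_add, ← Real.exp_add, bilinSymbol, ← Real.exp_sum, hL, hL, hL,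
      ← Finset.sum_neg_distrib, ← Finset.sum_neg_distrib, ← Finset.sum_add_distrib,
      ← Finset.sum_add_distrib]
    congr 1
    refine Finset.sum_congr rfl fun i _ => ?_
    rw [← inner_add_right, add_sub_cancel]
    ring
  have h0 : bilinSymbol e ∅ (ξ, ζ - ξ) = 1 := Finset.prod_empty
  simp only [h, h0, Complex.ofReal_one, one_mul, Complex.ofReal_mul]
  ring

theorem eLpNorm_block_weighted_series_le {e : ι → E} {S : Finset ι} {L : E → ℝ}
    (hL : ∀ ζ, L ζ = ∑ i ∈ S, |inner ℝ (e i) ζ|) {U V : ℤ → E → ℂ}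
    (hU : ∀ j, Continuous (U j)) (hUs : ∀ j, HasCompactSupport (U j))
    (hV : ∀ j, Continuous (V j)) (hVs : ∀ j, HasCompactSupport (V j))
    (hs : Summable fun j => ∫ x, ‖𝓕⁻ (fun ξ => (Real.exp (-L ξ) : ℂ) * U j ξ) x
      * 𝓕⁻ (fun ξ => (Real.exp (-L ξ) : ℂ) * V j ξ) x‖)
    {χ : E → ℂ} (hχ : Continuous χ) (hχs : HasCompactSupport χ) {q : ℝ≥0∞} (hq : 1 ≤ q) :
    eLpNorm (𝓕⁻ fun ξ => χ ξ * 𝓕 (𝓕⁻ fun ξ => (Real.exp (L ξ) : ℂ)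
        * 𝓕 (fun x => ∑' j, 𝓕⁻ (fun ξ => (Real.exp (-L ξ) : ℂ) * U j ξ) x
          * 𝓕⁻ (fun ξ => (Real.exp (-L ξ) : ℂ) * V j ξ) x) ξ) ξ) q volume
      ≤ ∑' j, eLpNorm (𝓕⁻ fun ξ => χ ξ * bilinSpectrum e S (U j) (V j) ξ) q volume := by
  have hLc : Continuous L := by
    rw [show L = fun ζ => ∑ i ∈ S, |inner ℝ (e i) ζ| from funext hL]
    fun_prop
  have hexp : ∀ c : ℝ, Continuous fun ξ => (Real.exp (c * L ξ) : ℂ) := fun c =>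
    Complex.continuous_ofReal.comp (Real.continuous_exp.comp (continuous_const.mul hLc))
  have hexpn : Continuous fun ξ => (Real.exp (-L ξ) : ℂ) := by simpa using hexp (-1)
  have hexpp : Continuous fun ξ => (Real.exp (L ξ) : ℂ) := by simpa using hexp 1
  set u : ℤ → E → ℂ := fun j ξ => (Real.exp (-L ξ) : ℂ) * U j ξ with hu
  set v : ℤ → E → ℂ := fun j ξ => (Real.exp (-L ξ) : ℂ) * V j ξ with hv
  have huc : ∀ j, Continuous (u j) := fun j => hexpn.mul (hU j)
  have hvc : ∀ j, Continuous (v j) := fun j => hexpn.mul (hV j)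
  have hus : ∀ j, HasCompactSupport (u j) := fun j => (hUs j).mul_left
  have hvs : ∀ j, HasCompactSupport (v j) := fun j => (hVs j).mul_left
  have hub : ∀ j, BddSpectrum (u j) := fun j => .of_continuous (huc j) (hus j)
  have hvb : ∀ j, BddSpectrum (v j) := fun j => .of_continuous (hvc j) (hvs j)
  have hUi : ∀ j, Integrable (U j) := fun j => (hU j).integrable_of_hasCompactSupport (hUs j)
  have hVi : ∀ j, Integrable (V j) := fun j => (hV j).integrable_of_hasCompactSupport (hVs j)
  set F : ℤ → E → ℂ := fun j x => 𝓕⁻ (u j) x * 𝓕⁻ (v j) x with hF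
  have hFi : ∀ j, Integrable (F j) := fun j =>
    (hub j).memLp_two_fourierInv.integrable_mul (hvb j).memLp_two_fourierInv
  set R : E → ℂ := fun x => ∑' j, F j x with hR
  change Summable fun j => ∫ x, ‖F j x‖ at hs
  change eLpNorm (𝓕⁻ fun ξ => χ ξ * 𝓕 (𝓕⁻ fun ξ => (Real.exp (L ξ) : ℂ) * 𝓕 R ξ) ξ) q volume ≤ _
  set w : ℤ → E → ℂ := fun j => bilinSpectrum e S (U j) (V j) with hw
  have hwF : ∀ j ζ, w j ζ = (Real.exp (L ζ) : ℂ) * 𝓕 (F j) ζ := fun j ζ => by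
    rw [hF, fourier_mul_fourierInv e (hub j) (hvb j) (hvc j) (hvs j)]
    exact (exp_mul_bilinSpectrum_empty hL (U j) (V j) ζ).symm
  set g : E → ℂ := fun ξ => (Real.exp (L ξ) : ℂ) * 𝓕 R ξ with hg
  have hgs : ∀ ζ, HasSum (fun j => w j ζ) (g ζ) := fun ζ => by
    simp only [hwF, hg]
    exact (hasSum_fourier_tsum hFi hs ζ).mul_left _
  have hzero : 𝓕 (𝓕⁻ g) = 0 → eLpNorm (𝓕⁻ fun ξ => χ ξ * 𝓕 (𝓕⁻ g) ξ) q volume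
      ≤ ∑' j, eLpNorm (𝓕⁻ fun ξ => χ ξ * w j ξ) q volume := fun h => by
    have h0 : (fun ξ => χ ξ * 𝓕 (𝓕⁻ g) ξ) = 0 := by
      rw [h]; funext ξ; simp
    rw [h0, fourierInv_zero_fun, eLpNorm_zero]
    exact zero_le
  by_cases hRi : Integrable R
  swap
  · refine hzero ?_
    have h0 : g = 0 := by
      rw [hg, fourier_of_not_integrable hRi]; funext ξ; simp
    rw [h0, fourierInv_zero_fun, fourier_zero_fun]
  by_cases hgi : Integrable g
  swap
  · exact hzero (by rw [fourierInv_of_not_integrable hgi, fourier_zero_fun])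
  by_cases hGi : Integrable (𝓕⁻ g)
  swap
  · exact hzero (fourier_of_not_integrable hGi)
  have hgc : Continuous g := hexpp.mul (continuous_fourier_of_integrable hRi)
  rw [fourier_fourierInv_eq_of_integrable hgc hgi hGi]
  obtain ⟨M, hM⟩ := hχs.exists_bound_of_continuous hχ
  have hwi : ∀ j, Integrable fun ξ => χ ξ * w j ξ := fun j =>
    (integrable_bilinSpectrum e S (hUi j) (hVi j)).bdd_mul hχ.aestronglyMeasurable
      (Filter.Eventually.of_forall hM)
  have hχe : Integrable fun ξ => χ ξ * (Real.exp (L ξ) : ℂ) :=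
    (hχ.mul hexpp).integrable_of_hasCompactSupport hχs.mul_right
  have hsum : Summable fun j => ∫ ξ, ‖χ ξ * w j ξ‖ := by
    refine Summable.of_nonneg_of_le (fun j => integral_nonneg fun _ => norm_nonneg _) (fun j => ?_)
      (hs.mul_left (∫ ξ, ‖χ ξ * (Real.exp (L ξ) : ℂ)‖))
    rw [← integral_mul_const]
    refine integral_mono (hwi j).norm (hχe.norm.mul_const _) fun ξ => ?_
    simp only [hwF, ← mul_assoc]
    rw [norm_mul (χ ξ * _)]
    exact mul_le_mul_of_nonneg_left (norm_fourier_le _ _) (norm_nonneg _)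
  have hpt : ∀ x, HasSum (fun j => 𝓕⁻ (fun ξ => χ ξ * w j ξ) x) (𝓕⁻ (fun ξ => χ ξ * g ξ) x) :=
    fun x => by
      have h := hasSum_fourierInv_tsum hwi hsum x
      have h2 : (fun ξ => ∑' j, χ ξ * w j ξ) = fun ξ => χ ξ * g ξ := funext fun ξ =>
        ((hgs ξ).mul_left (χ ξ)).tsum_eq
      rwa [h2] at h
  exact eLpNorm_le_tsum_of_hasSum
    (fun j => (continuous_fourierInv_of_integrable (hwi j)).aestronglyMeasurable) hpt hq

end WeightedSeries

section DyadicPartition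

variable {E : Type*} [NormedAddCommGroup E] [InnerProductSpace ℝ E] {φ ψ : E → ℝ}

/-- The enlarged dyadic cut-off `φ(2·) + φ + φ(·/2)`. -/
def fatCutoff (φ : E → ℝ) (ξ : E) : ℝ := φ ((2 : ℝ) • ξ) + φ ξ + φ ((2 : ℝ)⁻¹ • ξ)

theorem contDiff_fatCutoff (hφ : ContDiff ℝ (⊤ : ℕ∞) φ) : ContDiff ℝ (⊤ : ℕ∞) (fatCutoff φ) :=
  ((hφ.comp (contDiff_const_smul _)).add hφ).add (hφ.comp (contDiff_const_smul _))

theorem norm_bounds_of_fatCutoff_ne_zero (hφ : ∀ x, φ x ≠ 0 → 3 / 4 ≤ ‖x‖ ∧ ‖x‖ ≤ 8 / 3) {ξ : E}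
    (h : fatCutoff φ ξ ≠ 0) : 3 / 8 ≤ ‖ξ‖ ∧ ‖ξ‖ ≤ 16 / 3 := by
  by_contra hcon
  refine h ?_
  have h0 : ∀ x, ¬(3 / 4 ≤ ‖x‖ ∧ ‖x‖ ≤ 8 / 3) → φ x = 0 := fun x hx => by
    by_contra h'; exact hx (hφ x h')
  have hn := norm_nonneg ξ
  have h1 := h0 ((2 : ℝ) • ξ) fun h => hcon (by
    rw [norm_smul, Real.norm_of_nonneg (by norm_num)] at h
    constructor <;> linarith [h.1, h.2])
  have h2 := h0 ξ fun h => hcon (by constructor <;> linarith [h.1, h.2])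
  have h3 := h0 ((2 : ℝ)⁻¹ • ξ) fun h => hcon (by
    rw [norm_smul, Real.norm_of_nonneg (by norm_num)] at h
    constructor <;> linarith [h.1, h.2])
  rw [fatCutoff, h1, h2, h3]; norm_num

theorem hasCompactSupport_of_norm_le [FiniteDimensional ℝ E] {R : ℝ}
    (h : ∀ x, ψ x ≠ 0 → ‖x‖ ≤ R) : HasCompactSupport ψ :=
  HasCompactSupport.intro (isCompact_closedBall (0 : E) R) fun x hx => by
    by_contra h'
    exact hx (mem_closedBall_zero_iff.2 (h x h'))

theorem fatCutoff_smul (φ : E → ℝ) (j : ℤ) (ξ : E) : fatCutoff φ ((2 : ℝ) ^ (-j) • ξ)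
    = φ ((2 : ℝ) ^ (-(j - 1)) • ξ) + φ ((2 : ℝ) ^ (-j) • ξ) + φ ((2 : ℝ) ^ (-(j + 1)) • ξ) := by
  have h1 : (2 : ℝ) * 2 ^ (-j) = 2 ^ (-(j - 1)) := by
    rw [← zpow_one_add₀ (by norm_num)]; congr 1; ring
  have h2 : (2 : ℝ)⁻¹ * 2 ^ (-j) = 2 ^ (-(j + 1)) := by
    rw [← zpow_neg_one, ← zpow_add₀ (by norm_num)]; congr 1; ring
  rw [fatCutoff, smul_smul, smul_smul, h1, h2]

theorem norm_zpow_smul (j : ℤ) (ξ : E) : ‖(2 : ℝ) ^ (-j) • ξ‖ = ‖ξ‖ / 2 ^ j := by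
  rw [norm_smul, Real.norm_of_nonneg (by positivity), zpow_neg, inv_mul_eq_div]

theorem sub_lt_of_zpow_le {i j : ℤ} {a b x : ℝ} (ha : 0 < a) (n : ℤ) (hn : b < a * 2 ^ n)
    (hi : a ≤ x / 2 ^ i) (hj : x / 2 ^ j ≤ b) : i - j < n := by
  have hi' : (0 : ℝ) < 2 ^ i := by positivity
  have hj' : (0 : ℝ) < 2 ^ j := by positivity
  rw [le_div_iff₀ hi'] at hi
  rw [div_le_iff₀ hj'] at hj
  have h : a * 2 ^ i < a * 2 ^ (n + j) := by
    rw [zpow_add₀ (by norm_num), ← mul_assoc]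
    exact (hi.trans hj).trans_lt (mul_lt_mul_of_pos_right hn hj')
  have := (zpow_lt_zpow_iff_right₀ (by norm_num : (1 : ℝ) < 2)).1 (lt_of_mul_lt_mul_left h ha.le)
  linarith

theorem fatCutoff_mul_self (hφ : ∀ x, φ x ≠ 0 → 3 / 4 ≤ ‖x‖ ∧ ‖x‖ ≤ 8 / 3)
    (hφ1 : ∀ ξ : E, ξ ≠ 0 → ∑' j : ℤ, φ (((2 : ℝ) ^ (-j)) • ξ) = 1) (ξ : E) :
    fatCutoff φ ξ * φ ξ = φ ξ := by
  by_cases h : φ ξ = 0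
  · rw [h, mul_zero]
  have hξ := hφ ξ h
  have hξ0 : ξ ≠ 0 := norm_pos_iff.1 (by linarith [hξ.1])
  have hsum := hφ1 ξ hξ0
  rw [tsum_eq_sum (s := {-1, 0, 1})] at hsum
  · have h2 := fatCutoff_smul φ 0 ξ
    rw [Finset.sum_insert (by decide), Finset.sum_insert (by decide), Finset.sum_singleton] at hsum
    norm_num at h2 hsum
    rw [h2, add_assoc, hsum, one_mul]
  · intro j hj
    by_contra hne
    have hb := hφ _ hne
    rw [norm_zpow_smul] at hb
    have h1 : j - 0 < 2 := sub_lt_of_zpow_le (by norm_num) 2 (by norm_num) hb.1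
      (x := ‖ξ‖) (b := 8 / 3) (by simpa using hξ.2)
    have h2 : 0 - j < 2 := sub_lt_of_zpow_le (by norm_num) 2 (by norm_num)
      (x := ‖ξ‖) (a := 3 / 4) (by simpa using hξ.1) hb.2
    refine hj ?_
    have : j = -1 ∨ j = 0 ∨ j = 1 := by omega
    simpa using this

theorem tsum_enorm_sq_dyadic_le (hψ : ∀ x, ψ x ≠ 0 → 3 / 8 ≤ ‖x‖ ∧ ‖x‖ ≤ 16 / 3) {M : ℝ≥0∞}
    (hM : ∀ x, ‖ψ x‖ₑ ≤ M) (ξ : E) :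
    ∑' j : ℤ, ‖ψ ((2 : ℝ) ^ (-j) • ξ)‖ₑ ^ 2 ≤ 7 * M ^ 2 := by
  by_cases h : ∃ i : ℤ, ψ ((2 : ℝ) ^ (-i) • ξ) ≠ 0
  · obtain ⟨i, hi⟩ := h
    have hi := hψ _ hi
    rw [norm_zpow_smul] at hi
    rw [tsum_eq_sum (s := Finset.Icc (i - 3) (i + 3))]
    · refine (Finset.sum_le_card_nsmul _ _ (M ^ 2) fun j _ => by gcongr; exact hM _).trans_eq ?_
      rw [Int.card_Icc, nsmul_eq_mul, show (i + 3 + 1 - (i - 3)).toNat = 7 by omega]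
      rfl
    · intro j hj
      have : ψ ((2 : ℝ) ^ (-j) • ξ) = 0 := by
        by_contra hne
        have hb := hψ _ hne
        rw [norm_zpow_smul] at hb
        have h1 := sub_lt_of_zpow_le (by norm_num) 4 (by norm_num) hb.1 hi.2
        have h2 := sub_lt_of_zpow_le (by norm_num) 4 (by norm_num) hi.1 hb.2
        exact hj (Finset.mem_Icc.2 (by omega))
      rw [this, enorm_zero, zero_pow (by norm_num)]
  · push Not at h
    simp only [h, enorm_zero, zero_pow (two_ne_zero), tsum_zero]
    exact zero_le

variable [FiniteDimensional ℝ E] [MeasurableSpace E] [BorelSpace E]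

theorem tsum_lintegral_dyadic_lt_top (hψ : ∀ x, ψ x ≠ 0 → 3 / 8 ≤ ‖x‖ ∧ ‖x‖ ≤ 16 / 3)
    (hψc : Continuous ψ) {α : E → ℂ} (hα : MemLp α 2 volume) :
    ∑' j : ℤ, ∫⁻ ξ, ‖(ψ ((2 : ℝ) ^ (-j) • ξ) : ℂ) * α ξ‖ₑ ^ 2 ≠ ∞ := by
  have hψs : HasCompactSupport ψ := hasCompactSupport_of_norm_le fun x hx => (hψ x hx).2
  obtain ⟨M, hM⟩ := hψs.exists_bound_of_continuous hψc
  have hM' : ∀ x, ‖ψ x‖ₑ ≤ ENNReal.ofReal M := fun x => by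
    rw [← ofReal_norm]; exact ENNReal.ofReal_le_ofReal (hM x)
  have hmeas : ∀ j : ℤ, AEMeasurable
      (fun ξ => ‖(ψ ((2 : ℝ) ^ (-j) • ξ) : ℂ) * α ξ‖ₑ ^ 2) volume := fun j =>
    (((Complex.continuous_ofReal.comp (hψc.comp
      (continuous_const_smul _))).aestronglyMeasurable.mul hα.1).enorm.pow_const 2)
  rw [← lintegral_tsum hmeas]
  have hα2 : ∫⁻ ξ, ‖α ξ‖ₑ ^ 2 ≠ ∞ := by
    have := hα.2
    rw [eLpNorm_lt_top_iff_lintegral_rpow_enorm_lt_top (by norm_num) (by norm_num)] at this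
    simpa using this.ne
  refine ne_top_of_le_ne_top (ENNReal.mul_ne_top (a := 7 * ENNReal.ofReal M ^ 2)
    (ENNReal.mul_ne_top (by norm_num) (ENNReal.pow_ne_top ENNReal.ofReal_ne_top)) hα2) ?_
  rw [← lintegral_const_mul' _ _ (ENNReal.mul_ne_top (by norm_num)
    (ENNReal.pow_ne_top ENNReal.ofReal_ne_top))]
  refine lintegral_mono fun ξ => ?_
  have hr : ∀ x : ℝ, ‖(x : ℂ)‖ₑ = ‖x‖ₑ := fun x => by
    rw [← ofReal_norm, ← ofReal_norm, Complex.norm_real]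
  simp only [enorm_mul, mul_pow, ENNReal.tsum_mul_right, hr]
  exact mul_le_mul_left (tsum_enorm_sq_dyadic_le hψ hM' ξ) _

theorem BddSpectrum.lintegral_enorm_sq_fourierInv {u : E → ℂ} (hu : BddSpectrum u) :
    ∫⁻ x, ‖𝓕⁻ u x‖ₑ ^ 2 = ∫⁻ ξ, ‖u ξ‖ₑ ^ 2 := by
  have h := eLpNorm_two_fourierInv hu.integrable (hu.memLp 2)
  rw [eLpNorm_eq_lintegral_rpow_enorm_toReal (by norm_num) (by norm_num),
    eLpNorm_eq_lintegral_rpow_enorm_toReal (by norm_num) (by norm_num)] at h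
  have h2 := (ENNReal.rpow_left_injective (x := (1 / (2 : ℝ))) (by norm_num)) (by simpa using h)
  simpa using h2

theorem summable_integral_norm_mul_fourierInv {u v : ℤ → E → ℂ} (hu : ∀ j, BddSpectrum (u j))
    (hv : ∀ j, BddSpectrum (v j)) (hus : ∑' j, ∫⁻ ξ, ‖u j ξ‖ₑ ^ 2 ≠ ∞)
    (hvs : ∑' j, ∫⁻ ξ, ‖v j ξ‖ₑ ^ 2 ≠ ∞) :
    Summable fun j => ∫ x, ‖𝓕⁻ (u j) x * 𝓕⁻ (v j) x‖ := by
  have hle : ∀ j, ∫⁻ x, ‖𝓕⁻ (u j) x * 𝓕⁻ (v j) x‖ₑ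
      ≤ (∫⁻ ξ, ‖u j ξ‖ₑ ^ 2) + ∫⁻ ξ, ‖v j ξ‖ₑ ^ 2 := fun j => by
    rw [← (hu j).lintegral_enorm_sq_fourierInv, ← (hv j).lintegral_enorm_sq_fourierInv,
      ← lintegral_add_left ((hu j).continuous_fourierInv.enorm.measurable.pow_const 2)]
    refine lintegral_mono fun x => ?_
    simp only [enorm_mul]
    rcases le_total ‖𝓕⁻ (u j) x‖ₑ ‖𝓕⁻ (v j) x‖ₑ with h | h
    · refine le_add_left ?_
      rw [sq]; exact mul_le_mul_left h _
    · refine le_add_right ?_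
      rw [sq]; exact mul_le_mul_right h _
  have hfin : ∑' j, ∫⁻ x, ‖𝓕⁻ (u j) x * 𝓕⁻ (v j) x‖ₑ ≠ ∞ := by
    refine ne_top_of_le_ne_top (ENNReal.add_ne_top.2 ⟨hus, hvs⟩) ?_
    rw [← ENNReal.tsum_add]
    exact ENNReal.tsum_le_tsum hle
  refine (ENNReal.summable_toReal hfin).congr fun j => ?_
  rw [integral_norm_eq_lintegral_enorm]
  exact ((hu j).continuous_fourierInv.mul (hv j).continuous_fourierInv).aestronglyMeasurable

end DyadicPartition

section BesovBlocks

theorem ofReal_two_rpow_mul (x y : ℝ) :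
    ENNReal.ofReal ((2 : ℝ) ^ x) * ENNReal.ofReal ((2 : ℝ) ^ y)
      = ENNReal.ofReal ((2 : ℝ) ^ (x + y)) := by
  rw [← ENNReal.ofReal_mul (by positivity), ← Real.rpow_add (by norm_num)]

theorem exists_tsum_dyadic_le {κ : ℝ} (hκ : 0 < κ) : ∃ C : ℝ≥0, ∀ m : ℤ,
    ∑' j : ℤ, (if m - 3 ≤ j then ENNReal.ofReal ((2 : ℝ) ^ (((m : ℝ) - j) * κ)) else 0) ≤ C := by
  set ω : ℤ → ℝ≥0∞ := fun n => if -3 ≤ n then ENNReal.ofReal ((2 : ℝ) ^ (-(n : ℝ) * κ)) else 0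
    with hω
  have hinj : Function.Injective fun n : ℕ => (n : ℤ) - 3 := fun a b h => by
    simpa using h
  have hsupp : Function.support ω ⊆ Set.range fun n : ℕ => (n : ℤ) - 3 := fun n hn => by
    have : -3 ≤ n := by
      by_contra h
      exact hn (if_neg h)
    exact ⟨(n + 3).toNat, by simp only; omega⟩
  set ρ : ℝ := 2 ^ (-κ) with hρ
  have hρ0 : 0 ≤ ρ := by positivity
  have hρ1 : ρ < 1 := Real.rpow_lt_one_of_one_lt_of_neg (by norm_num) (by linarith)
  have hterm : ∀ n : ℕ, ω ((n : ℤ) - 3) = ENNReal.ofReal (2 ^ (3 * κ) * ρ ^ n) := fun n => by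
    rw [hω]
    simp only
    rw [if_pos (by omega), hρ, ← Real.rpow_natCast, ← Real.rpow_mul (by norm_num),
      ← Real.rpow_add (by norm_num)]
    congr 2
    push_cast
    ring
  have hfin : ∑' n, ω n ≠ ∞ := by
    rw [← hinj.tsum_eq hsupp]
    simp only [hterm]
    exact ((summable_geometric_of_lt_one hρ0 hρ1).mul_left _).tsum_ofReal_ne_top
  refine ⟨(∑' n, ω n).toNNReal, fun m => ?_⟩
  rw [ENNReal.coe_toNNReal hfin, ← (Equiv.subRight m).tsum_eq ω]
  refine ENNReal.tsum_le_tsum fun j => le_of_eq ?_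
  simp only [hω, Equiv.subRight_apply]
  congr 1
  · exact propext ⟨fun h => by omega, fun h => by omega⟩
  · push_cast
    congr 3
    ring

variable {d : ℕ} {φ : Rd d → ℝ}

theorem besovNorm_top (s : ℝ) (p : ℝ≥0∞) (f : Rd d → ℂ) : besovNorm d φ s p ∞ f
    = ⨆ j : ℤ, ENNReal.ofReal ((2 : ℝ) ^ ((j : ℝ) * s)) * eLpNorm (LPblock d φ j f) p volume := by
  rw [besovNorm, seqNorm, if_pos rfl]

theorem eLpNorm_LPblock_le (s : ℝ) (p : ℝ≥0∞) (f : Rd d → ℂ) (j : ℤ) :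
    eLpNorm (LPblock d φ j f) p volume
      ≤ ENNReal.ofReal ((2 : ℝ) ^ ((j : ℝ) * -s)) * besovNorm d φ s p ∞ f := by
  have h := le_iSup (fun j : ℤ => ENNReal.ofReal ((2 : ℝ) ^ ((j : ℝ) * s))
    * eLpNorm (LPblock d φ j f) p volume) j
  rw [← besovNorm_top] at h
  refine le_trans (le_of_eq ?_) (mul_le_mul_right h _)
  rw [← mul_assoc, ofReal_two_rpow_mul]
  simp

theorem integrable_cutoff_mul_fourier {ψ : Rd d → ℝ} (hψ : Continuous ψ) (hs : HasCompactSupport ψ)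
    (f : 𝓢(Rd d, ℂ)) (j : ℤ) :
    Integrable fun ξ => (ψ ((2 : ℝ) ^ (-j) • ξ) : ℂ) * 𝓕 (f : Rd d → ℂ) ξ := by
  obtain ⟨M, hM⟩ := hs.exists_bound_of_continuous hψ
  rw [← SchwartzMap.fourier_coe]
  refine (𝓕 f).integrable.bdd_mul (c := M) (Complex.continuous_ofReal.comp
    (hψ.comp (continuous_const_smul _))).aestronglyMeasurable
    (Filter.Eventually.of_forall fun ξ => ?_)
  rw [Complex.norm_real]
  exact hM _

theorem exists_eLpNorm_LPblock_bernstein (hφ1 : ContDiff ℝ (⊤ : ℕ∞) φ)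
    (hφ3 : ∀ x : Rd d, φ x ≠ 0 → 3 / 4 ≤ ‖x‖ ∧ ‖x‖ ≤ 8 / 3)
    (hφ4 : ∀ ξ : Rd d, ξ ≠ 0 → ∑' j : ℤ, φ (((2 : ℝ) ^ (-j)) • ξ) = 1)
    {p t : ℝ} (hp : 1 ≤ p) (hpt : p ≤ t) (σ : ℝ) :
    ∃ C : ℝ≥0, ∀ (f : 𝓢(Rd d, ℂ)) (j : ℤ),
      eLpNorm (LPblock d φ j f) (ENNReal.ofReal t) volume
        ≤ C * ENNReal.ofReal ((2 : ℝ) ^ ((j : ℝ) * (d * (1 / p - 1 / t) - σ)))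
          * besovNorm d φ σ (ENNReal.ofReal p) ∞ f := by
  obtain ⟨C, hC⟩ := exists_eLpNorm_fourierInv_mul_le (contDiff_fatCutoff hφ1)
    (hasCompactSupport_of_norm_le fun x hx => (norm_bounds_of_fatCutoff_ne_zero hφ3 hx).2) hp hpt
  refine ⟨C, fun f j => ?_⟩
  have hφs : HasCompactSupport φ := hasCompactSupport_of_norm_le fun x hx => (hφ3 x hx).2
  have h := hC j _ (integrable_cutoff_mul_fourier hφ1.continuous hφs f j)
  simp only [← mul_assoc, ← Complex.ofReal_mul, fatCutoff_mul_self hφ3 hφ4,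
    finrank_euclideanSpace_fin] at h
  refine h.trans ((mul_le_mul_right (eLpNorm_LPblock_le σ _ f j) _).trans_eq ?_)
  rw [← mul_assoc, mul_assoc (C : ℝ≥0∞), ofReal_two_rpow_mul]
  congr 4
  ring

theorem fourierInv_fatCutoff_mul {g : Rd d → ℂ}
    (hg : ∀ j : ℤ, Integrable fun ξ => (φ ((2 : ℝ) ^ (-j) • ξ) : ℂ) * g ξ) (j : ℤ) (x : Rd d) :
    𝓕⁻ (fun ξ => (fatCutoff φ ((2 : ℝ) ^ (-j) • ξ) : ℂ) * g ξ) x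
      = 𝓕⁻ (fun ξ => (φ ((2 : ℝ) ^ (-(j - 1)) • ξ) : ℂ) * g ξ) x
        + 𝓕⁻ (fun ξ => (φ ((2 : ℝ) ^ (-j) • ξ) : ℂ) * g ξ) x
        + 𝓕⁻ (fun ξ => (φ ((2 : ℝ) ^ (-(j + 1)) • ξ) : ℂ) * g ξ) x := by
  simp only [fatCutoff_smul, Complex.ofReal_add, add_mul]
  rw [fourierInv_fun_add (u := fun ξ => (φ ((2 : ℝ) ^ (-(j - 1)) • ξ) : ℂ) * g ξ
    + (φ ((2 : ℝ) ^ (-j) • ξ) : ℂ) * g ξ) ((hg (j - 1)).add (hg j)) (hg (j + 1)),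
    fourierInv_fun_add (hg (j - 1)) (hg j)]

theorem exists_eLpNorm_fat_LPblock_le (hφ1 : ContDiff ℝ (⊤ : ℕ∞) φ)
    (hφ3 : ∀ x : Rd d, φ x ≠ 0 → 3 / 4 ≤ ‖x‖ ∧ ‖x‖ ≤ 8 / 3)
    (hφ4 : ∀ ξ : Rd d, ξ ≠ 0 → ∑' j : ℤ, φ (((2 : ℝ) ^ (-j)) • ξ) = 1)
    {p t : ℝ} (hp : 1 ≤ p) (hpt : p ≤ t) (σ : ℝ) :
    ∃ C : ℝ≥0, ∀ (f : 𝓢(Rd d, ℂ)) (j : ℤ),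
      eLpNorm (𝓕⁻ fun ξ => (fatCutoff φ ((2 : ℝ) ^ (-j) • ξ) : ℂ) * 𝓕 (f : Rd d → ℂ) ξ)
          (ENNReal.ofReal t) volume
        ≤ C * ENNReal.ofReal ((2 : ℝ) ^ ((j : ℝ) * (d * (1 / p - 1 / t) - σ)))
          * besovNorm d φ σ (ENNReal.ofReal p) ∞ f := by
  obtain ⟨C, hC⟩ := exists_eLpNorm_LPblock_bernstein hφ1 hφ3 hφ4 hp hpt σ
  set β : ℝ := d * (1 / p - 1 / t) - σ with hβ
  have hφs : HasCompactSupport φ := hasCompactSupport_of_norm_le fun x hx => (hφ3 x hx).2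
  refine ⟨C * ((2 : ℝ) ^ (-β)).toNNReal + C + C * ((2 : ℝ) ^ β).toNNReal, fun f j => ?_⟩
  have hi := integrable_cutoff_mul_fourier hφ1.continuous hφs f
  have hc : ∀ j, AEStronglyMeasurable (LPblock d φ j f) volume := fun j =>
    (continuous_fourierInv_of_integrable (hi j)).aestronglyMeasurable
  have hsplit : (𝓕⁻ fun ξ => (fatCutoff φ ((2 : ℝ) ^ (-j) • ξ) : ℂ) * 𝓕 (f : Rd d → ℂ) ξ)
      = LPblock d φ (j - 1) f + LPblock d φ j f + LPblock d φ (j + 1) f := by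
    exact funext fun x => fourierInv_fatCutoff_mul hi j x
  have ht : 1 ≤ ENNReal.ofReal t := by simpa using hp.trans hpt
  rw [hsplit]
  refine (eLpNorm_add_le ((hc _).add (hc _)) (hc _) ht).trans
    ((add_le_add (eLpNorm_add_le (hc _) (hc _) ht) le_rfl).trans
      ((add_le_add (add_le_add (hC f (j - 1)) (hC f j)) (hC f (j + 1))).trans_eq ?_))
  have e1 : ENNReal.ofReal ((2 : ℝ) ^ (((j - 1 : ℤ) : ℝ) * β))
      = ENNReal.ofReal (2 ^ (-β)) * ENNReal.ofReal ((2 : ℝ) ^ ((j : ℝ) * β)) := by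
    rw [ofReal_two_rpow_mul]; congr 2; push_cast; ring
  have e2 : ENNReal.ofReal ((2 : ℝ) ^ (((j + 1 : ℤ) : ℝ) * β))
      = ENNReal.ofReal (2 ^ β) * ENNReal.ofReal ((2 : ℝ) ^ ((j : ℝ) * β)) := by
    rw [ofReal_two_rpow_mul]; congr 2; push_cast; ring
  rw [e1, e2, ENNReal.coe_add, ENNReal.coe_add, ENNReal.coe_mul, ENNReal.coe_mul]
  change _ = (_ * ENNReal.ofReal (2 ^ (-β)) + _ + _ * ENNReal.ofReal (2 ^ β)) * _ * _
  ring

end BesovBlocks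

section RemainderEstimate

variable {d : ℕ} {φ : Rd d → ℝ}

theorem continuous_cutoff_mul {ψ : Rd d → ℝ} (hψ : Continuous ψ) {g : Rd d → ℂ} (hg : Continuous g)
    (j : ℤ) : Continuous fun ξ => (ψ ((2 : ℝ) ^ (-j) • ξ) : ℂ) * g ξ :=
  (Complex.continuous_ofReal.comp (hψ.comp (continuous_const_smul _))).mul hg

theorem hasCompactSupport_cutoff {ψ : Rd d → ℝ} (hs : HasCompactSupport ψ) (j : ℤ) :
    HasCompactSupport fun ξ => (ψ ((2 : ℝ) ^ (-j) • ξ) : ℂ) :=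
  (hs.comp_smul (by positivity : (2 : ℝ) ^ (-j) ≠ 0)).comp_left (g := fun x : ℝ => (x : ℂ))
    Complex.ofReal_zero

theorem cutoff_eq_zero {ψ : Rd d → ℝ} {R : ℝ} (h : ∀ x, ψ x ≠ 0 → ‖x‖ ≤ R) (j : ℤ) {ξ : Rd d}
    (hξ : R * 2 ^ j < ‖ξ‖) : ψ ((2 : ℝ) ^ (-j) • ξ) = 0 := by
  by_contra hne
  have := h _ hne
  rw [norm_zpow_smul, div_le_iff₀ (by positivity)] at this
  linarith

theorem exists_eLpNorm_block_bilinSpectrum_le (hφ1 : ContDiff ℝ (⊤ : ℕ∞) φ)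
    (hφ3 : ∀ x : Rd d, φ x ≠ 0 → 3 / 4 ≤ ‖x‖ ∧ ‖x‖ ≤ 8 / 3)
    (hφ4 : ∀ ξ : Rd d, ξ ≠ 0 → ∑' j : ℤ, φ (((2 : ℝ) ^ (-j)) • ξ) = 1)
    {p q r : ℝ} (hp : 1 ≤ p) (hr : 1 ≤ r) (hrq : r ≤ q) (hpr : p ≤ 2 * r) (σ₁ σ₂ : ℝ) :
    ∃ C : ℝ≥0, ∀ (e : Fin d → Rd d) (A B : 𝓢(Rd d, ℂ)) (m j : ℤ),
      eLpNorm (𝓕⁻ fun ξ => (φ ((2 : ℝ) ^ (-m) • ξ) : ℂ) * bilinSpectrum e Finset.univ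
          (fun ξ => (fatCutoff φ ((2 : ℝ) ^ (-j) • ξ) : ℂ) * 𝓕 (A : Rd d → ℂ) ξ)
          (fun ξ => (φ ((2 : ℝ) ^ (-j) • ξ) : ℂ) * 𝓕 (B : Rd d → ℂ) ξ) ξ) (ENNReal.ofReal q) volume
        ≤ C * (if m - 3 ≤ j then ENNReal.ofReal ((2 : ℝ) ^ ((m : ℝ) * (d * (1 / r - 1 / q))
            + (j : ℝ) * (2 * d / p - d / r - σ₁ - σ₂))) else 0)
          * (besovNorm d φ σ₁ (ENNReal.ofReal p) ∞ A * besovNorm d φ σ₂ (ENNReal.ofReal p) ∞ B) := by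
  have hφs : HasCompactSupport φ := hasCompactSupport_of_norm_le fun x hx => (hφ3 x hx).2
  have hfat := fun x => norm_bounds_of_fatCutoff_ne_zero hφ3 (ξ := x)
  have hfs : HasCompactSupport (fatCutoff φ) :=
    hasCompactSupport_of_norm_le fun x hx => (hfat x hx).2
  have hfc := (contDiff_fatCutoff hφ1).continuous
  obtain ⟨C₁, hC₁⟩ := exists_eLpNorm_fourierInv_mul_le hφ1 hφs hr hrq
  obtain ⟨C₂, hC₂⟩ := exists_eLpNorm_bilinOp_le (E := Rd d) hr (Finset.univ : Finset (Fin d))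
  obtain ⟨C₃, hC₃⟩ := exists_eLpNorm_fat_LPblock_le hφ1 hφ3 hφ4 hp hpr σ₁
  obtain ⟨C₄, hC₄⟩ := exists_eLpNorm_LPblock_bernstein hφ1 hφ3 hφ4 hp hpr σ₂
  refine ⟨C₁ * C₂ * C₃ * C₄, fun e A B m j => ?_⟩
  set U : Rd d → ℂ := fun ξ => (fatCutoff φ ((2 : ℝ) ^ (-j) • ξ) : ℂ) * 𝓕 (A : Rd d → ℂ) ξ with hU
  set V : Rd d → ℂ := fun ξ => (φ ((2 : ℝ) ^ (-j) • ξ) : ℂ) * 𝓕 (B : Rd d → ℂ) ξ with hV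
  have hcA := continuous_fourier_of_integrable A.integrable
  have hcB := continuous_fourier_of_integrable B.integrable
  have hUb : BddSpectrum U := .of_continuous (continuous_cutoff_mul hfc hcA j)
    (hasCompactSupport_cutoff hfs j).mul_right
  have hVb : BddSpectrum V := .of_continuous (continuous_cutoff_mul hφ1.continuous hcB j)
    (hasCompactSupport_cutoff hφs j).mul_right
  split_ifs with hmj
  · have h1 := hC₁ m _ (integrable_bilinSpectrum e Finset.univ hUb.integrable hVb.integrable)
    rw [fourierInv_bilinSpectrum e _ hUb.integrable hVb.integrable,
      finrank_euclideanSpace_fin] at h1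
    refine h1.trans ((mul_le_mul_right (hC₂ e U V hUb hVb) _).trans
      ((mul_le_mul_right (mul_le_mul_right (mul_le_mul' (hC₃ A j) (hC₄ B j)) _) _).trans_eq ?_))
    have hx : (m : ℝ) * (d * (1 / r - 1 / q)) + (j : ℝ) * (2 * d / p - d / r - σ₁ - σ₂)
        = (m : ℝ) * (d * (1 / r - 1 / q)) + ((j : ℝ) * (d * (1 / p - 1 / (2 * r)) - σ₁)
          + (j : ℝ) * (d * (1 / p - 1 / (2 * r)) - σ₂)) := by
      have hp0 : p ≠ 0 := by positivity
      have hr0 : r ≠ 0 := by positivity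
      field_simp
      ring
    rw [hx, ← ofReal_two_rpow_mul, ← ofReal_two_rpow_mul]
    push_cast
    ring
  · have h0 : (fun ξ => (φ ((2 : ℝ) ^ (-m) • ξ) : ℂ) * bilinSpectrum e Finset.univ U V ξ) = 0 := by
      funext ξ
      by_cases hξ : φ ((2 : ℝ) ^ (-m) • ξ) = 0
      · simp only [hξ, Complex.ofReal_zero, zero_mul, Pi.zero_apply]
      have hlow := (hφ3 _ hξ).1
      rw [norm_zpow_smul] at hlow
      have hbig : 16 / 3 * (2 : ℝ) ^ j + 8 / 3 * 2 ^ j < ‖ξ‖ := by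
        by_contra! hcon
        have := sub_lt_of_zpow_le (by norm_num) 4 (by norm_num) hlow
          (j := j) (b := 8) (by rw [div_le_iff₀ (by positivity)]; linarith)
        omega
      rw [bilinSpectrum_eq_zero (M := 16 / 3 * (2 : ℝ) ^ j) (N := 8 / 3 * (2 : ℝ) ^ j) _ _ hbig,
        mul_zero, Pi.zero_apply]
      · intro η hη
        rw [hU]
        simp only
        rw [cutoff_eq_zero (fun x hx => (hfat x hx).2) j hη, Complex.ofReal_zero, zero_mul]
      · intro η hη
        rw [hV]
        simp only
        rw [cutoff_eq_zero (fun x hx => (hφ3 x hx).2) j hη, Complex.ofReal_zero, zero_mul]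
    rw [h0, fourierInv_zero_fun, eLpNorm_zero]
    exact zero_le

theorem expL1_zero_fun (τ : ℝ) : expL1 d τ 0 = 0 := by
  have h : (fun ξ : Rd d => (Real.exp (τ * ∑ i, |ξ i|) : ℂ) * 𝓕 (0 : Rd d → ℂ) ξ) = 0 := by
    rw [fourier_zero_fun]; funext ξ; simp
  rw [expL1, h, fourierInv_zero_fun]

theorem LPblock_of_fourier_eq_zero {f : Rd d → ℂ} (hf : 𝓕 f = 0) (j : ℤ) :
    LPblock d φ j f = 0 := by
  have h : (fun ξ : Rd d => (φ ((2 : ℝ) ^ (-j) • ξ) : ℂ) * 𝓕 f ξ) = 0 := by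
    rw [hf]; funext ξ; simp
  rw [LPblock, h, fourierInv_zero_fun]

theorem norm_exp_neg_mul_sum_abs_le {τ : ℝ} (hτ : 0 ≤ τ) (ξ : Rd d) (z : ℂ) :
    ‖(Real.exp (-(τ * ∑ i, |ξ i|)) : ℂ) * z‖ ≤ ‖z‖ := by
  rw [norm_mul, Complex.norm_real, Real.norm_of_nonneg (Real.exp_nonneg _)]
  refine mul_le_of_le_one_left (norm_nonneg _) (Real.exp_le_one_iff.2 ?_)
  have : 0 ≤ ∑ i, |ξ i| := Finset.sum_nonneg fun i _ => abs_nonneg _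
  nlinarith

theorem fourier_expL1_neg {τ : ℝ} (hτ : 0 ≤ τ) (A : 𝓢(Rd d, ℂ))
    (hi : Integrable (expL1 d (-τ) A)) :
    𝓕 (expL1 d (-τ) A)
      = fun ξ => (Real.exp (-(τ * ∑ i, |ξ i|)) : ℂ) * 𝓕 (A : Rd d → ℂ) ξ := by
  have hA : expL1 d (-τ) A
      = 𝓕⁻ fun ξ => (Real.exp (-(τ * ∑ i, |ξ i|)) : ℂ) * 𝓕 (A : Rd d → ℂ) ξ := by
    simp only [expL1, neg_mul]
  have hc : Continuous fun ξ : Rd d =>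
      (Real.exp (-(τ * ∑ i, |ξ i|)) : ℂ) * 𝓕 (A : Rd d → ℂ) ξ :=
    (Complex.continuous_ofReal.comp (by fun_prop)).mul
      (continuous_fourier_of_integrable A.integrable)
  rw [hA] at hi ⊢
  refine fourier_fourierInv_eq_of_integrable hc ?_ hi
  have hAi : Integrable (𝓕 (A : Rd d → ℂ)) := by
    rw [← SchwartzMap.fourier_coe]; exact (𝓕 A).integrable
  exact hAi.mono hc.aestronglyMeasurable
    (Filter.Eventually.of_forall fun ξ => norm_exp_neg_mul_sum_abs_le hτ ξ _)

theorem remainder_expL1_eq (hφc : Continuous φ) (hφs : HasCompactSupport φ) {τ : ℝ} (hτ : 0 ≤ τ)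
    (A B : 𝓢(Rd d, ℂ)) (hA : Integrable (expL1 d (-τ) A)) (hB : Integrable (expL1 d (-τ) B)) :
    remainder d φ (expL1 d (-τ) A) (expL1 d (-τ) B) = fun x => ∑' j : ℤ,
      𝓕⁻ (fun ξ => (Real.exp (-(τ * ∑ i, |ξ i|)) : ℂ)
          * ((fatCutoff φ ((2 : ℝ) ^ (-j) • ξ) : ℂ) * 𝓕 (A : Rd d → ℂ) ξ)) x
        * 𝓕⁻ (fun ξ => (Real.exp (-(τ * ∑ i, |ξ i|)) : ℂ)
          * ((φ ((2 : ℝ) ^ (-j) • ξ) : ℂ) * 𝓕 (B : Rd d → ℂ) ξ)) x := by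
  funext x
  simp only [remainder, LPblock]
  refine tsum_congr fun j => ?_
  have hc : Continuous (𝓕 (expL1 d (-τ) A)) := continuous_fourier_of_integrable hA
  rw [← fourierInv_fatCutoff_mul (fun j => (continuous_cutoff_mul hφc hc
    j).integrable_of_hasCompactSupport (hasCompactSupport_cutoff hφs j).mul_right),
    fourier_expL1_neg hτ A hA, fourier_expL1_neg hτ B hB]
  simp only [mul_left_comm]

end RemainderEstimate

section WeightedRemainder

variable {d : ℕ} {φ : Rd d → ℝ}

theorem remainder_expL1_eq_zero {τ : ℝ} {f g : Rd d → ℂ}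
    (h : ¬(Integrable (expL1 d (-τ) f) ∧ Integrable (expL1 d (-τ) g))) :
    remainder d φ (expL1 d (-τ) f) (expL1 d (-τ) g) = 0 := by
  funext x
  rw [not_and_or] at h
  rcases h with h | h
  · simp [remainder, LPblock_of_fourier_eq_zero (fourier_of_not_integrable h)]
  · simp [remainder, LPblock_of_fourier_eq_zero (fourier_of_not_integrable h)]

theorem tsum_lintegral_exp_dyadic_ne_top {ψ : Rd d → ℝ}
    (hψ : ∀ x, ψ x ≠ 0 → 3 / 8 ≤ ‖x‖ ∧ ‖x‖ ≤ 16 / 3) (hψc : Continuous ψ) {τ : ℝ} (hτ : 0 ≤ τ)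
    (A : 𝓢(Rd d, ℂ)) :
    ∑' j : ℤ, ∫⁻ ξ, ‖(Real.exp (-(τ * ∑ i, |ξ i|)) : ℂ)
      * ((ψ ((2 : ℝ) ^ (-j) • ξ) : ℂ) * 𝓕 (A : Rd d → ℂ) ξ)‖ₑ ^ 2 ≠ ∞ := by
  have hA : MemLp (𝓕 (A : Rd d → ℂ)) 2 volume := by
    rw [← SchwartzMap.fourier_coe]
    exact (𝓕 A).memLp 2
  refine ne_top_of_le_ne_top (tsum_lintegral_dyadic_lt_top hψ hψc hA)
    (ENNReal.tsum_le_tsum fun j => lintegral_mono fun ξ => ?_)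
  exact pow_le_pow_left' (enorm_le_iff_norm_le.2 (norm_exp_neg_mul_sum_abs_le hτ ξ _)) 2

theorem eLpNorm_LPblock_expL1_remainder_le (hφ1 : ContDiff ℝ (⊤ : ℕ∞) φ)
    (hφ3 : ∀ x : Rd d, φ x ≠ 0 → 3 / 4 ≤ ‖x‖ ∧ ‖x‖ ≤ 8 / 3) {τ : ℝ} (hτ : 0 ≤ τ)
    (A B : 𝓢(Rd d, ℂ)) (m : ℤ) {q : ℝ≥0∞} (hq : 1 ≤ q) :
    eLpNorm (LPblock d φ m (expL1 d τ (remainder d φ (expL1 d (-τ) A) (expL1 d (-τ) B)))) q volume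
      ≤ ∑' j : ℤ, eLpNorm (𝓕⁻ fun ξ => (φ ((2 : ℝ) ^ (-m) • ξ) : ℂ) * bilinSpectrum
          (fun i => τ • EuclideanSpace.single i (1 : ℝ)) Finset.univ
          (fun ξ => (fatCutoff φ ((2 : ℝ) ^ (-j) • ξ) : ℂ) * 𝓕 (A : Rd d → ℂ) ξ)
          (fun ξ => (φ ((2 : ℝ) ^ (-j) • ξ) : ℂ) * 𝓕 (B : Rd d → ℂ) ξ) ξ) q volume := by
  by_cases hInt : Integrable (expL1 d (-τ) A) ∧ Integrable (expL1 d (-τ) B)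
  swap
  · rw [remainder_expL1_eq_zero hInt, expL1_zero_fun, LPblock_of_fourier_eq_zero fourier_zero_fun,
      eLpNorm_zero]
    exact zero_le
  have hφs : HasCompactSupport φ := hasCompactSupport_of_norm_le fun x hx => (hφ3 x hx).2
  have hφc := hφ1.continuous
  have hfat := fun x => norm_bounds_of_fatCutoff_ne_zero hφ3 (ξ := x)
  have hfs : HasCompactSupport (fatCutoff φ) :=
    hasCompactSupport_of_norm_le fun x hx => (hfat x hx).2
  have hfc := (contDiff_fatCutoff hφ1).continuous
  have hφw : ∀ x : Rd d, φ x ≠ 0 → 3 / 8 ≤ ‖x‖ ∧ ‖x‖ ≤ 16 / 3 := fun x hx => by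
    obtain ⟨h1, h2⟩ := hφ3 x hx
    constructor <;> linarith
  have hcA := continuous_fourier_of_integrable A.integrable
  have hcB := continuous_fourier_of_integrable B.integrable
  have hexp : Continuous fun ξ : Rd d => (Real.exp (-(τ * ∑ i, |ξ i|)) : ℂ) :=
    Complex.continuous_ofReal.comp (by fun_prop)
  have hUc := fun j => continuous_cutoff_mul hfc hcA j
  have hVc := fun j => continuous_cutoff_mul hφc hcB j
  have hUs := fun j => (hasCompactSupport_cutoff hfs j).mul_right (f' := 𝓕 (A : Rd d → ℂ))
  have hVs := fun j => (hasCompactSupport_cutoff hφs j).mul_right (f' := 𝓕 (B : Rd d → ℂ))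
  rw [remainder_expL1_eq hφc hφs hτ A B hInt.1 hInt.2]
  refine eLpNorm_block_weighted_series_le (L := fun ξ : Rd d => τ * ∑ i, |ξ i|) (fun ζ => ?_)
    hUc hUs hVc hVs ?_ ?_ (hasCompactSupport_cutoff hφs m) hq
  · rw [Finset.mul_sum]
    refine Finset.sum_congr rfl fun i _ => ?_
    rw [real_inner_smul_left, EuclideanSpace.inner_single_left, map_one, one_mul, abs_mul,
      abs_of_nonneg hτ]
  · exact summable_integral_norm_mul_fourierInv
      (fun j => .of_continuous (hexp.mul (hUc j)) (hUs j).mul_left)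
      (fun j => .of_continuous (hexp.mul (hVc j)) (hVs j).mul_left)
      (tsum_lintegral_exp_dyadic_ne_top hfat hfc hτ A)
      (tsum_lintegral_exp_dyadic_ne_top hφw hφc hτ B)
  · exact Complex.continuous_ofReal.comp (hφc.comp (continuous_const_smul _))

end WeightedRemainder

/-- Gevrey remainder estimate: for 1 < p,q < ∞ with s > k − d·min(1/p, 1/p′) and p ≤ 2q,
uniformly in τ ≥ 0, ‖e^{τΛ₁}R(a,b)‖_{Ḃ^{s−k+d/q−d/p}_{q,∞}} ≲
‖A‖_{Ḃ^{d/p−k₁}_{p,∞}}·‖B‖_{Ḃ^{s−k₂}_{p,∞}} where a = e^{−τΛ₁}A, b = e^{−τΛ₁}B. -/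
theorem gevrey_remainder_estimate
    (d : ℕ) (hd : 1 ≤ d) (φ : Rd d → ℝ)
    (hφ1 : ContDiff ℝ (⊤ : ℕ∞) φ)
    (hφ2 : ∀ x y : Rd d, ‖x‖ = ‖y‖ → φ x = φ y)
    (hφ3 : ∀ x : Rd d, φ x ≠ 0 → 3/4 ≤ ‖x‖ ∧ ‖x‖ ≤ 8/3)
    (hφ4 : ∀ ξ : Rd d, ξ ≠ 0 → ∑' j : ℤ, φ (((2:ℝ) ^ (-j)) • ξ) = 1)
    (p q : ℝ) (hp1 : 1 < p) (hq1 : 1 < q)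
    (s k₁ k₂ : ℝ)
    (hs : (k₁ + k₂) - (d : ℝ) * min (1/p) (1 - 1/p) < s)
    (hpq : p ≤ 2 * q) :
    ∃ C : ℝ, 0 < C ∧ ∀ τ : ℝ, 0 ≤ τ → ∀ A B : 𝓢(Rd d, ℂ),
      besovNorm d φ (s - (k₁ + k₂) + (d : ℝ)/q - (d : ℝ)/p) (ENNReal.ofReal q) ∞
          (expL1 d τ (remainder d φ (expL1 d (-τ) A) (expL1 d (-τ) B)))
        ≤ ENNReal.ofReal C
            * besovNorm d φ ((d : ℝ)/p - k₁) (ENNReal.ofReal p) ∞ A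
            * besovNorm d φ (s - k₂) (ENNReal.ofReal p) ∞ B := by
  obtain ⟨r, hr, hrq, hpr, hmin⟩ : ∃ r : ℝ, 1 ≤ r ∧ r ≤ q ∧ p ≤ 2 * r ∧
      min (1 / p) (1 - 1 / p) ≤ 1 / r - 1 / p := by
    rcases le_total p 2 with h2 | h2
    · exact ⟨1, le_rfl, hq1.le, by linarith, (min_le_right _ _).trans_eq (by norm_num)⟩
    · refine ⟨p / 2, by linarith, by linarith, by linarith, (min_le_left _ _).trans_eq ?_⟩
      field_simp
      norm_num
  set κ : ℝ := s - (k₁ + k₂) + d * (1 / r - 1 / p) with hκ_def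
  have hκ : 0 < κ := by
    have := mul_le_mul_of_nonneg_left hmin (Nat.cast_nonneg (α := ℝ) d)
    linarith
  obtain ⟨C, hC⟩ := exists_eLpNorm_block_bilinSpectrum_le hφ1 hφ3 hφ4 hp1.le hr hrq hpr
    ((d : ℝ) / p - k₁) (s - k₂)
  obtain ⟨G, hG⟩ := exists_tsum_dyadic_le hκ
  refine ⟨C * G + 1, by positivity, fun τ hτ A B => ?_⟩
  set N := besovNorm d φ ((d : ℝ) / p - k₁) (ENNReal.ofReal p) ∞ A
    * besovNorm d φ (s - k₂) (ENNReal.ofReal p) ∞ B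
  have hCG : (C : ℝ≥0∞) * G ≤ ENNReal.ofReal (C * G + 1) := by
    rw [← ENNReal.coe_mul, ← ENNReal.ofReal_coe_nnreal]
    exact ENNReal.ofReal_le_ofReal (by push_cast; linarith)
  rw [besovNorm_top, mul_assoc]
  refine iSup_le fun m => ?_
  refine (mul_le_mul_right ((eLpNorm_LPblock_expL1_remainder_le hφ1 hφ3 hτ A B m
    (ENNReal.one_le_ofReal.2 hq1.le)).trans (ENNReal.tsum_le_tsum fun j => hC _ A B m j)) _).trans ?_
  rw [← ENNReal.tsum_mul_left]
  refine (ENNReal.tsum_le_tsum (g := fun j : ℤ => (C : ℝ≥0∞) * (if m - 3 ≤ j then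
    ENNReal.ofReal ((2 : ℝ) ^ (((m : ℝ) - j) * κ)) else 0) * N) fun j => ?_).trans ?_
  · refine le_of_eq ?_
    split_ifs
    · have hx : ((m : ℝ) - j) * κ = (m : ℝ) * (s - (k₁ + k₂) + (d : ℝ) / q - (d : ℝ) / p)
          + ((m : ℝ) * (d * (1 / r - 1 / q))
            + (j : ℝ) * (2 * d / p - d / r - ((d : ℝ) / p - k₁) - (s - k₂))) := by
        rw [hκ_def]
        ring
      rw [hx, ← mul_assoc, mul_left_comm _ (C : ℝ≥0∞), ofReal_two_rpow_mul]
    · simp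
  · rw [ENNReal.tsum_mul_right, ENNReal.tsum_mul_left]
    exact mul_le_mul_left ((mul_le_mul_right (hG m) _).trans hCG) _
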